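/- arXiv:2003.00510 — 4 statements merged into one kernel-verified Lean document; each statement's English description precedes it below -/
import Mathlib

section
/- There exists an absolute constant C > 0 with the following property. Let F be a field; if F has positive characteristic p > 0, let A ⊆ F² be a finite set with |A| ≤ p^{4/3} (no cardinality assumption if char F = 0). Suppose at most M points of A lie on a common line or on a common circle, and let r ∈ F with r ≠ 0. Then the number of pairs of segments ((a,b),(c,d)) ∈ S_r(A) × S_r(A) such that (a,b) is axially symmetric to (c,d) is at most C·( M|S_r(A)| + |S_r(A)|^{3/2} ). -/
namespace Stmt8

/-- The (algebraic) squared distance in the plane `F²`. -/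
def dist2 {F : Type*} [CommRing F] (x y : F × F) : F :=
  (x.1 - y.1) ^ 2 + (x.2 - y.2) ^ 2

/-- The dot product on `F²`. -/
def dot {F : Type*} [CommRing F] (x y : F × F) : F :=
  x.1 * y.1 + x.2 * y.2

/-- A line in `F²`. -/
def IsLine {F : Type*} [CommRing F] (L : Set (F × F)) : Prop :=
  ∃ x v : F × F, v ≠ 0 ∧ L = {y | ∃ t : F, y = x + t • v}

/-- A circle in `F²`: centre `c`, radius `r ≠ 0`. -/
def IsCircle {F : Type*} [CommRing F] (S : Set (F × F)) : Prop :=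
  ∃ (c : F × F) (r : F), r ≠ 0 ∧ S = {x | dist2 x c = r}

/-- `S_r(A)`: ordered pairs of distinct points of `A` at distance `r`. -/
def Sr {F : Type*} [CommRing F] (A : Finset (F × F)) (r : F) : Set ((F × F) × (F × F)) :=
  {q | q.1 ∈ A ∧ q.2 ∈ A ∧ q.1 ≠ q.2 ∧ dist2 q.1 q.2 = r}

/-- The reflection over the non-isotropic line `{x | n·x = e}` with normal vector `n`
(`n·n ≠ 0`): the unique distance-preserving affine involution fixing the line pointwise. -/
noncomputable def reflct {F : Type*} [Field F] (n : F × F) (e : F) (x : F × F) : F × F :=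
  x - (2 * (dot n x - e) / dot n n) • n

/-- The pairs `(a,b)` and `(c,d)` are axially symmetric: some reflection over a non-isotropic
line takes `a` to `c` and `b` to `d`. -/
def AxiallySymmetric {F : Type*} [Field F] (a b c d : F × F) : Prop :=
  ∃ (n : F × F) (e : F), dot n n ≠ 0 ∧ reflct n e a = c ∧ reflct n e b = d

section LightRays
open MvPolynomial
variable {K : Type*} [Field K]

lemma card_degree_le (m : ℕ) :
    Nat.card {n : Fin 3 →₀ ℕ | (n.sum fun _ e => e) ≤ m} = (m + 3).choose 3 := by
  classical
  have h1 : {n : Fin 3 →₀ ℕ | (n.sum fun _ e => e) ≤ m} =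
      ((Finset.range (m + 1)).biUnion fun k =>
        (Finset.univ : Finset (Fin 3)).finsuppAntidiag k : Finset (Fin 3 →₀ ℕ)) := by
    ext n
    simp [Finsupp.sum_fintype, Finset.mem_finsuppAntidiag]
  rw [h1, Nat.card_coe_set_eq, Set.ncard_coe_finset, Finset.card_biUnion]
  · simp only [Finset.card_finsuppAntidiag_nat_eq_choose]
    clear h1
    induction m with
    | zero => simp
    | succ m ih =>
      rw [Finset.sum_range_succ, ih]
      simp only [Finset.card_univ, Fintype.card_fin]
      have : (m + 1 + 3).choose 3 = (m + 3).choose 2 + (m + 3).choose 3 := by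
        rw [show m + 1 + 3 = (m + 3) + 1 by ring, Nat.choose_succ_succ]
      rw [this, show 3 + (m + 1) - 1 = m + 3 by omega,
        ← Nat.choose_symm_of_eq_add (show m + 3 = 2 + (m + 1) by ring)]
      ring
  · intro i _ j _ hij
    rw [Function.onFun, Finset.disjoint_left]
    intro n hi hj
    rw [Finset.mem_finsuppAntidiag] at hi hj
    exact hij (hi.1.symm.trans hj.1)

lemma six_mul_finrank_restrictTotalDegree (K : Type*) [Field K] (m : ℕ) :
    6 * Module.finrank K (restrictTotalDegree (Fin 3) K m) = (m + 1) * (m + 2) * (m + 3) := by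
  have h : Module.finrank K (restrictTotalDegree (Fin 3) K m) = (m + 3).choose 3 := by
    rw [← card_degree_le]
    exact Module.finrank_eq_nat_card_basis (basisRestrictSupport K _)
  rw [h]
  have := Nat.descFactorial_eq_factorial_mul_choose (m + 3) 3
  rw [show Nat.factorial 3 = 6 by rfl] at this
  rw [← this]
  simp [Nat.descFactorial]
  ring

/-- The restriction of a polynomial to the light ray
`{(x, b + s x, γ + s b + s² x)}` encoded by `q = (s, b, γ)`. -/
noncomputable def res {K : Type*} [Field K] (q : K × K × K) :
    MvPolynomial (Fin 3) K →ₐ[K] Polynomial K :=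
  aeval ![Polynomial.X, Polynomial.C q.2.1 + Polynomial.C q.1 * Polynomial.X,
    Polynomial.C (q.2.2 + q.1 * q.2.1) + Polynomial.C (q.1 ^ 2) * Polynomial.X]


lemma natDegree_res_le (q : K × K × K) (f : MvPolynomial (Fin 3) K) :
    (res q f).natDegree ≤ f.totalDegree := by
  have := aeval_natDegree_le (m := f.totalDegree) (n := 1) f le_rfl
    ![Polynomial.X, Polynomial.C q.2.1 + Polynomial.C q.1 * Polynomial.X,
      Polynomial.C (q.2.2 + q.1 * q.2.1) + Polynomial.C (q.1 ^ 2) * Polynomial.X] ?_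
  · simpa [res] using this
  · intro i
    fin_cases i
    · simp
    · simp; compute_degree
    · simp only [Fin.reduceFinMk, Matrix.cons_val]; compute_degree

lemma eval_res (q : K × K × K) (f : MvPolynomial (Fin 3) K) (x : K) :
    (res q f).eval x =
      eval ![x, q.2.1 + q.1 * x, q.2.2 + q.1 * q.2.1 + q.1 ^ 2 * x] f := by
  induction f using MvPolynomial.induction_on with
  | C a => simp [res]
  | add p r hp hr => simp [hp, hr]
  | mul_X p i hp =>
    simp only [map_mul, Polynomial.eval_mul, hp]
    fin_cases i <;> simp [res]

lemma pderiv_comm' (i j : Fin 3) (f : MvPolynomial (Fin 3) K) :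
    pderiv i (pderiv j f) = pderiv j (pderiv i f) := by
  classical
  have : ⁅(pderiv i : Derivation K (MvPolynomial (Fin 3) K) (MvPolynomial (Fin 3) K)),
      (pderiv j : Derivation K (MvPolynomial (Fin 3) K) (MvPolynomial (Fin 3) K))⁆ = 0 := by
    apply MvPolynomial.derivation_ext
    intro k
    simp [Derivation.commutator_apply, pderiv_X, Pi.single_apply, apply_ite]
  have h := congrArg (fun D => D f) this
  simpa [Derivation.commutator_apply, sub_eq_zero] using h

lemma derivative_res (q : K × K × K) (f : MvPolynomial (Fin 3) K) :
    Polynomial.derivative (res q f) = res q (pderiv 0 f) +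
      Polynomial.C q.1 * res q (pderiv 1 f) + Polynomial.C (q.1 ^ 2) * res q (pderiv 2 f) := by
  induction f using MvPolynomial.induction_on with
  | C a => simp [res]
  | add p r hp hr => simp only [map_add, hp, hr]; ring
  | mul_X p i hp =>
    simp only [map_mul, Polynomial.derivative_mul, hp, pderiv_mul, map_add]
    fin_cases i <;>
      simp [res, Polynomial.derivative_pow] <;> ring

lemma totalDegree_pderiv_lt (i : Fin 3) (f : MvPolynomial (Fin 3) K) (h : pderiv i f ≠ 0) :
    (pderiv i f).totalDegree < f.totalDegree := by
  obtain ⟨e, he, hd⟩ := Finset.exists_mem_eq_sup (pderiv i f).support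
    (by simpa [Finset.nonempty_iff_ne_empty] using h) (fun s => s.sum fun _ e => e)
  rw [totalDegree, hd]
  rw [mem_support_iff, coeff_pderiv] at he
  have h1 : e + Finsupp.single i 1 ∈ f.support := by
    rw [mem_support_iff]; intro h0; simp [h0] at he
  have h2 := le_totalDegree h1
  rw [Finsupp.sum_add_index' (by simp) (by simp)] at h2
  simp at h2
  omega

lemma totalDegree_pderiv_le (i : Fin 3) (f : MvPolynomial (Fin 3) K) :
    (pderiv i f).totalDegree ≤ f.totalDegree := by
  by_cases h : pderiv i f = 0
  · simp [h]
  · exact (totalDegree_pderiv_lt i f h).le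

lemma coeff_eq_zero_of_pderiv_eq_zero {p : ℕ} [CharP K p] {i : Fin 3}
    {f : MvPolynomial (Fin 3) K} (hp : p = 0 ∨ f.totalDegree < p) (h : pderiv i f = 0) :
    i ∉ f.vars := by
  classical
  rw [mem_vars_iff_mem_support]
  rintro ⟨e, he, hi⟩
  have h0 : e i ≠ 0 := by simpa using hi
  have h1 : e i ≤ f.totalDegree :=
    (Finset.single_le_sum (fun _ _ ↦ Nat.zero_le _) hi).trans (le_totalDegree he)
  have h2 := coeff_pderiv f (e - Finsupp.single i 1) (i := i)
  rw [h, tsub_add_cancel_of_le (by simpa using Nat.one_le_iff_ne_zero.2 h0)] at h2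
  have h3 : ((e i : ℕ) : K) ≠ 0 := by
    intro hz
    rw [CharP.cast_eq_zero_iff K p] at hz
    rcases hp with rfl | hp
    · simp at hz; exact h0 hz
    · exact absurd (Nat.le_of_dvd (Nat.pos_of_ne_zero h0) hz) (by omega)
  have h4 : (((e - Finsupp.single i 1 : Fin 3 →₀ ℕ) i : ℕ) : K) + 1 = (e i : ℕ) := by
    rw [← Nat.cast_add_one]; congr 1; simp; omega
  rw [h4] at h2
  rw [mem_support_iff] at he
  simp at h2
  tauto

lemma eq_zero_of_res_of_vars {q : K × K × K} {f : MvPolynomial (Fin 3) K}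
    (h1 : 1 ∉ f.vars) (h2 : 2 ∉ f.vars) (h : res q f = 0) : f = 0 := by
  have : (((Polynomial.aeval (X 0 : MvPolynomial (Fin 3) K)).comp (res q) : _ →ₐ[K] _) :
      MvPolynomial (Fin 3) K →+* MvPolynomial (Fin 3) K) f
      = (RingHom.id _) f := by
    apply MvPolynomial.hom_congr_vars
    · ext; simp
    · intro i hi _
      fin_cases i
      · simp [res]
      · exact absurd hi h1
      · exact absurd hi h2
    · rfl
  simpa [h] using this.symm

lemma exists_vanishing (S : Finset (K × K × K)) (D : ℕ)
    (h : 6 * S.card < (D + 2) * (D + 3)) :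
    ∃ f : MvPolynomial (Fin 3) K, f ≠ 0 ∧ f.totalDegree ≤ D ∧ ∀ q ∈ S, res q f = 0 := by
  classical
  let V := restrictTotalDegree (Fin 3) K D
  let φ : V →ₗ[K] (S → Polynomial.degreeLT K (D + 1)) :=
    LinearMap.pi fun q => ((res q.1).toLinearMap.comp V.subtype).codRestrict _ (by
      rintro ⟨g, hg⟩
      rw [mem_restrictTotalDegree] at hg
      simp only [LinearMap.comp_apply, Submodule.subtype_apply, AlgHom.toLinearMap_apply]
      rw [Polynomial.mem_degreeLT]
      refine lt_of_le_of_lt Polynomial.degree_le_natDegree ?_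
      exact_mod_cast Nat.lt_succ_of_le ((natDegree_res_le _ _).trans hg))
  have hdim : Module.finrank K (S → Polynomial.degreeLT K (D + 1)) < Module.finrank K V := by
    have h1 : Module.finrank K (Polynomial.degreeLT K (D + 1)) = D + 1 := by
      rw [(Polynomial.degreeLTEquiv K (D + 1)).finrank_eq]; simp
    rw [Module.finrank_pi_fintype]
    simp only [h1, Finset.sum_const, Finset.card_univ, Fintype.card_coe, smul_eq_mul]
    have := six_mul_finrank_restrictTotalDegree K D
    have h2 : 6 * (S.card * (D + 1)) < 6 * Module.finrank K V := by
      rw [this]; nlinarith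
    omega
  have : Module.Finite K (Polynomial.degreeLT K (D + 1)) :=
    Module.Finite.equiv (Polynomial.degreeLTEquiv K (D + 1)).symm
  have hker := LinearMap.ker_ne_bot_of_finrank_lt (f := φ) hdim
  obtain ⟨g, hg, hg0⟩ := Submodule.exists_mem_ne_zero_of_ne_bot hker
  refine ⟨g.1, by simpa using hg0, (mem_restrictTotalDegree _ _ _).1 g.2, fun q hq => ?_⟩
  have := congrFun (LinearMap.mem_ker.1 hg) ⟨q, hq⟩
  exact congrArg Subtype.val this

lemma exists_separating_form {q q' : K × K × K} (h : q ≠ q') :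
    ∃ g : MvPolynomial (Fin 3) K, g.totalDegree ≤ 1 ∧ res q' g = 0 ∧ res q g ≠ 0 := by
  have key : ∀ (i : Fin 3) (u v : K), (X i - C u - C v * X 0 :
      MvPolynomial (Fin 3) K).totalDegree ≤ 1 := by
    intro i u v
    refine (totalDegree_sub _ _).trans (max_le ((totalDegree_sub _ _).trans (max_le ?_ ?_)) ?_)
    · simp
    · simp
    · exact (totalDegree_mul _ _).trans (by simp)
  obtain ⟨s, b, c⟩ := q
  obtain ⟨s', b', c'⟩ := q'
  by_cases h1 : s = s' ∧ b = b'
  · obtain ⟨rfl, rfl⟩ := h1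
    refine ⟨X 2 - C (c' + s * b) - C (s ^ 2) * X 0, key _ _ _, by simp [res], ?_⟩
    have : c ≠ c' := by rintro rfl; exact h rfl
    have h2 : res (s, b, c) (X 2 - C (c' + s * b) - C (s ^ 2) * X 0) = Polynomial.C (c - c') := by
      simp [res]; ring
    rw [h2]
    simpa [sub_eq_zero] using this
  · refine ⟨X 1 - C b' - C s' * X 0, key _ _ _, by simp [res], fun h0 => h1 ?_⟩
    have h2 : res (s, b, c) (X 1 - C b' - C s' * X 0) =
        Polynomial.C (b - b') + Polynomial.C (s - s') * Polynomial.X := by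
      simp [res]; ring
    rw [h2] at h0
    have h3 := congrArg (fun p => Polynomial.coeff p 0) h0
    have h4 := congrArg (fun p => Polynomial.coeff p 1) h0
    simp [Polynomial.coeff_C] at h3 h4
    exact ⟨sub_eq_zero.1 h4, sub_eq_zero.1 h3⟩

lemma exists_isolating_polynomial (T : Finset (K × K × K)) (q : K × K × K) (hq : q ∈ T) :
    ∃ g : MvPolynomial (Fin 3) K, g.totalDegree ≤ T.card - 1 ∧ res q g ≠ 0 ∧
      ∀ q' ∈ T, q' ≠ q → res q' g = 0 := by
  classical
  choose! H hdeg hvan hne using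
    fun (q' : K × K × K) (h : q ≠ q') => exists_separating_form h
  refine ⟨∏ q' ∈ T.erase q, H q', ?_, ?_, fun q' hq' hne' => ?_⟩
  · refine (totalDegree_finsetProd _ _).trans ?_
    rw [← Finset.card_erase_of_mem hq, Finset.card_eq_sum_ones]
    exact Finset.sum_le_sum fun q' h => hdeg q' (Finset.ne_of_mem_erase h).symm
  · rw [map_prod, Finset.prod_ne_zero_iff]
    exact fun q' h => hne q' (Finset.ne_of_mem_erase h).symm
  · rw [map_prod]
    exact Finset.prod_eq_zero (Finset.mem_erase.2 ⟨hne', hq'⟩) (hvan q' hne'.symm)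

lemma totalDegree_aeval_X_le (h : Polynomial K) :
    (Polynomial.aeval (X 0 : MvPolynomial (Fin 3) K) h).totalDegree ≤ h.natDegree := by
  rw [Polynomial.aeval_eq_sum_range]
  refine totalDegree_finsetSum_le fun i hi => ?_
  refine (totalDegree_smul_le _ _).trans ?_
  rw [totalDegree_X_pow]
  exact Nat.lt_succ_iff.1 (Finset.mem_range.1 hi)

lemma res_aeval_X (q : K × K × K) (h : Polynomial K) :
    res q (Polynomial.aeval (X 0 : MvPolynomial (Fin 3) K) h) = h := by
  rw [← Polynomial.aeval_algHom_apply]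
  simp [res]

/-- Bézout for lines: a polynomial `g` not divisible by the prime `f` shares at most
`deg f * deg g` light rays with it. -/
lemma card_common_rays_le {f g : MvPolynomial (Fin 3) K} (hf : Prime f) (hg : ¬ f ∣ g)
    (S : Finset (K × K × K)) (hSf : ∀ q ∈ S, res q f = 0) (hSg : ∀ q ∈ S, res q g = 0) :
    S.card ≤ f.totalDegree * g.totalDegree := by
  classical
  by_contra! hlt
  obtain ⟨T, hTS, hT⟩ := Finset.exists_subset_card_eq (Nat.succ_le_of_lt hlt)
  set a := f.totalDegree with ha
  set b := g.totalDegree with hb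
  set k := (a * b).succ with hk
  set n := k ^ 2 with hn
  set L := a + b + n + 2 - k with hL
  have hkn : k ≤ n := by rw [hn]; nlinarith
  choose! P hPdeg hPne hPvan using fun q hq => exists_isolating_polynomial T q hq
  let V := fun m => restrictTotalDegree (Fin 3) K m
  let Ψ : (V (b + n) × V (a + n)) × (T → Polynomial.degreeLT K L) →ₗ[K]
      MvPolynomial (Fin 3) K :=
    ((LinearMap.mulRight K f).comp (V (b + n)).subtype).coprod
      ((LinearMap.mulRight K g).comp (V (a + n)).subtype) |>.coprod
      (∑ q : T, ((LinearMap.mulRight K (P q.1)).comp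
        ((Polynomial.aeval (X 0 : MvPolynomial (Fin 3) K)).toLinearMap.comp
          (Polynomial.degreeLT K L).subtype)).comp (LinearMap.proj q))
  have hΨ : ∀ u v h, Ψ ((u, v), h) = u.1 * f + v.1 * g +
      ∑ q : T, Polynomial.aeval (X 0 : MvPolynomial (Fin 3) K) (h q).1 * P q.1 := by
    intro u v h
    simp [Ψ, LinearMap.sum_apply]
  let Θ : V n →ₗ[K] (V (b + n) × V (a + n)) × (T → Polynomial.degreeLT K L) :=
    ((((LinearMap.mulRight K g).comp (V n).subtype).codRestrict (V (b + n)) (by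
      rintro ⟨w, hw⟩
      rw [mem_restrictTotalDegree] at hw ⊢
      refine (totalDegree_mul _ _).trans ?_
      simp only [Submodule.subtype_apply]
      omega)).prod
    (((LinearMap.mulRight K (-f)).comp (V n).subtype).codRestrict (V (a + n)) (by
      rintro ⟨w, hw⟩
      rw [mem_restrictTotalDegree] at hw ⊢
      refine (totalDegree_mul _ _).trans ?_
      simp only [Submodule.subtype_apply, totalDegree_neg]
      omega))).prod 0
  have : Module.Finite K (Polynomial.degreeLT K L) :=
    Module.Finite.equiv (Polynomial.degreeLTEquiv K L).symm
  have hrange : LinearMap.range Ψ ≤ V (a + b + n) := by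
    rintro _ ⟨⟨⟨u, v⟩, h⟩, rfl⟩
    rw [hΨ]
    have hu := (mem_restrictTotalDegree _ _ _).1 u.2
    have hv := (mem_restrictTotalDegree _ _ _).1 v.2
    refine Submodule.add_mem _ (Submodule.add_mem _ ?_ ?_) (Submodule.sum_mem _ fun q _ => ?_)
    · rw [mem_restrictTotalDegree]
      refine (totalDegree_mul _ _).trans ?_
      omega
    · rw [mem_restrictTotalDegree]
      refine (totalDegree_mul _ _).trans ?_
      omega
    · rw [mem_restrictTotalDegree]
      refine (totalDegree_mul _ _).trans ?_
      have h1 := totalDegree_aeval_X_le (h q).1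
      have h2 := hPdeg q.1 q.2
      have h3 : (h q).1.natDegree < L := by
        by_cases h0 : (h q).1 = 0
        · rw [h0]; simp; omega
        · exact (Polynomial.natDegree_lt_iff_degree_lt h0).2 (Polynomial.mem_degreeLT.1 (h q).2)
      rw [hT] at h2
      omega
  have hker : LinearMap.ker Ψ ≤ LinearMap.range Θ := by
    rintro ⟨⟨u, v⟩, h⟩ h0
    rw [LinearMap.mem_ker, hΨ] at h0
    have hh : h = 0 := by
      funext q
      have h1 := congrArg (res q.1) h0
      rw [map_add, map_add, map_mul, map_mul, hSf _ (hTS q.2), hSg _ (hTS q.2), map_sum,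
        Finset.sum_eq_single q] at h1
      · simp only [map_mul, res_aeval_X, mul_zero, zero_add, map_zero, mul_eq_zero] at h1
        exact Subtype.ext (h1.resolve_right (hPne _ q.2))
      · intro q' _ hne
        rw [map_mul, hPvan q'.1 q'.2 q.1 q.2 (fun h => hne (Subtype.ext h.symm)), mul_zero]
      · simp
    subst hh
    simp only [Pi.zero_apply, Submodule.coe_zero, map_zero, zero_mul, Finset.sum_const_zero,
      add_zero] at h0
    have hdvd : f ∣ v.1 * g := ⟨-u.1, by linear_combination h0⟩
    obtain ⟨w, hw⟩ := (hf.dvd_or_dvd hdvd).resolve_right hg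
    have hu : u.1 = -w * g := by
      apply mul_right_cancel₀ hf.ne_zero
      rw [hw] at h0
      linear_combination h0
    have hwn : w.totalDegree ≤ n := by
      by_cases hw0 : w = 0
      · simp [hw0]
      · have := (mem_restrictTotalDegree _ _ _).1 v.2
        rw [hw, totalDegree_mul_of_isDomain hf.ne_zero hw0] at this
        omega
    refine ⟨⟨-w, by rw [mem_restrictTotalDegree, totalDegree_neg]; exact hwn⟩, ?_⟩
    refine Prod.ext (Prod.ext (Subtype.ext ?_) (Subtype.ext ?_)) rfl
    · simp [Θ, hu]
    · simp [Θ, hw, mul_comm]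
  have e1 := LinearMap.finrank_range_add_finrank_ker Ψ
  have e2 := Submodule.finrank_mono hrange
  have e3 := Submodule.finrank_mono hker
  have e4 := LinearMap.finrank_range_le Θ
  have e5 : Module.finrank K (Polynomial.degreeLT K L) = L := by
    rw [(Polynomial.degreeLTEquiv K L).finrank_eq]; simp
  rw [Module.finrank_prod, Module.finrank_prod, Module.finrank_pi_fintype] at e1
  simp only [e5, Finset.sum_const, Finset.card_univ, Fintype.card_coe, smul_eq_mul, hT] at e1
  have d1 := six_mul_finrank_restrictTotalDegree K (b + n)
  have d2 := six_mul_finrank_restrictTotalDegree K (a + n)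
  have d3 := six_mul_finrank_restrictTotalDegree K (a + b + n)
  have d4 := six_mul_finrank_restrictTotalDegree K n
  have hL' : (L : ℤ) = a + b + n + 2 - k := by omega
  have hk' : (k : ℤ) = a * b + 1 := by rw [hk]; push_cast; ring
  have hn' : (n : ℤ) = k ^ 2 := by rw [hn]; push_cast; ring
  have hfin : 6 * Module.finrank K (V (b + n)) + 6 * Module.finrank K (V (a + n)) + 6 * (k * L) ≤
      6 * Module.finrank K (V (a + b + n)) + 6 * Module.finrank K (V n) := by
    omega
  rw [d1, d2, d3, d4] at hfin
  zify at hfin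
  rw [hL'] at hfin
  have ha0 : (0 : ℤ) ≤ a := by positivity
  have hb0 : (0 : ℤ) ≤ b := by positivity
  have hab : (0 : ℤ) ≤ (a : ℤ) * b * (a + b) := by positivity
  have id1 : ((a : ℤ) + b + n + 1) * (a + b + n + 2) * (a + b + n + 3) +
      (n + 1) * (n + 2) * (n + 3) = (b + n + 1) * (b + n + 2) * (b + n + 3) +
      (a + n + 1) * (a + n + 2) * (a + n + 3) + 3 * (a * b) * (2 * n + 4 + a + b) := by ring
  rw [id1] at hfin
  have hab' : (a : ℤ) * b = k - 1 := by omega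
  rw [hab'] at hfin hab
  nlinarith

lemma natDegree_eq_of_wronskian {p : ℕ} [CharP K p] {N M : Polynomial K} (hM : M ≠ 0) (hN : N ≠ 0)
    (hNp : p = 0 ∨ N.natDegree < p) (hMp : p = 0 ∨ M.natDegree < p)
    (h : Polynomial.derivative N * M = N * Polynomial.derivative M) :
    N.natDegree = M.natDegree := by
  have key : ∀ A B : Polynomial K, (Polynomial.derivative A * B).coeff
      (A.natDegree + B.natDegree - 1) = A.natDegree * A.leadingCoeff * B.leadingCoeff := by
    intro A B
    by_cases hA : A.natDegree = 0
    · rw [Polynomial.eq_C_of_natDegree_eq_zero hA]; simp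
    · obtain ⟨n, hn⟩ := Nat.exists_eq_succ_of_ne_zero hA
      have : A.natDegree + B.natDegree - 1 = n + B.natDegree := by omega
      rw [this, Polynomial.coeff_mul_add_eq_of_natDegree_le (df := n) (dg := B.natDegree)
        ((Polynomial.natDegree_derivative_le A).trans (by omega)) le_rfl,
        Polynomial.coeff_derivative, Polynomial.leadingCoeff, Polynomial.leadingCoeff, hn]
      push_cast
      ring
  have h1 := key N M
  have h2 := key M N
  rw [add_comm, mul_comm _ N, ← h, h1] at h2
  have h3 : ((N.natDegree : K)) = M.natDegree := by
    have hl := mul_ne_zero (Polynomial.leadingCoeff_ne_zero.2 hN)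
      (Polynomial.leadingCoeff_ne_zero.2 hM)
    apply mul_right_cancel₀ hl
    linear_combination h2
  rw [CharP.natCast_eq_natCast K p] at h3
  rcases hNp with rfl | hNp
  · exact Nat.modEq_zero_iff.1 h3
  · rcases hMp with rfl | hMp
    · exact Nat.modEq_zero_iff.1 h3
    · exact Nat.ModEq.eq_of_lt_of_lt h3 hNp hMp

lemma eq_const_mul_of_wronskian {p : ℕ} [CharP K p] {N M : Polynomial K} (hM : M ≠ 0)
    (hNp : p = 0 ∨ N.natDegree < p) (hMp : p = 0 ∨ M.natDegree < p)
    (h : Polynomial.derivative N * M = N * Polynomial.derivative M) :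
    ∃ c : K, N = Polynomial.C c * M := by
  by_cases hN : N = 0
  · exact ⟨0, by simp [hN]⟩
  have hd := natDegree_eq_of_wronskian hM hN hNp hMp h
  refine ⟨N.leadingCoeff / M.leadingCoeff, ?_⟩
  set c := N.leadingCoeff / M.leadingCoeff with hc
  by_contra hne
  have hne' : N - Polynomial.C c * M ≠ 0 := sub_ne_zero.2 hne
  have hle : (N - Polynomial.C c * M).natDegree ≤ M.natDegree := by
    refine (Polynomial.natDegree_sub_le _ _).trans (max_le hd.le ?_)
    exact Polynomial.natDegree_C_mul_le _ _
  have h1 := natDegree_eq_of_wronskian (p := p) hM hne'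
    (hMp.imp_right fun h => hle.trans_lt h) hMp (by
      rw [map_sub, Polynomial.derivative_mul, Polynomial.derivative_C]
      linear_combination h)
  have h2 : (N - Polynomial.C c * M).coeff M.natDegree = 0 := by
    rw [Polynomial.coeff_sub, Polynomial.coeff_C_mul, Polynomial.coeff_natDegree, ← hd,
      Polynomial.coeff_natDegree, hc]
    field_simp [Polynomial.leadingCoeff_ne_zero.2 hM]
    ring
  rw [← h1, Polynomial.coeff_natDegree, Polynomial.leadingCoeff_eq_zero] at h2
  exact hne' h2

lemma linear_ratio_of_wronskian {p : ℕ} [CharP K p] {u w : Polynomial K} {d : ℕ} (hw : w ≠ 0)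
    (hu' : u.natDegree ≤ d) (hw' : w.natDegree ≤ d) (hp : p = 0 ∨ 2 * d + 1 < p)
    (h : (Polynomial.derivative (Polynomial.derivative u) * w -
        u * Polynomial.derivative (Polynomial.derivative w)) * w =
      2 * Polynomial.derivative w * (Polynomial.derivative u * w - u * Polynomial.derivative w)) :
    ∃ α β : K, u = (Polynomial.C α * Polynomial.X + Polynomial.C β) * w := by
  have d1 := (Polynomial.natDegree_derivative_le u)
  have d2 := (Polynomial.natDegree_derivative_le w)
  obtain ⟨α, hα⟩ := eq_const_mul_of_wronskian (p := p)
    (N := Polynomial.derivative u * w - u * Polynomial.derivative w) (pow_ne_zero 2 hw)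
    (hp.imp_right fun h => lt_of_le_of_lt ((Polynomial.natDegree_sub_le _ _).trans (max_le
      (Polynomial.natDegree_mul_le.trans (by omega : _ ≤ 2 * d))
      (Polynomial.natDegree_mul_le.trans (by omega)))) (by omega))
    (hp.imp_right fun h => lt_of_le_of_lt Polynomial.natDegree_pow_le (by omega)) (by
      simp only [map_sub, Polynomial.derivative_mul, Polynomial.derivative_pow]
      simp only [Nat.cast_ofNat, Nat.add_one_sub_one, pow_one, map_ofNat]
      linear_combination w * h)
  obtain ⟨β, hβ⟩ := eq_const_mul_of_wronskian (p := p)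
    (N := u - Polynomial.C α * Polynomial.X * w) hw
    (hp.imp_right fun h => lt_of_le_of_lt ((Polynomial.natDegree_sub_le _ _).trans (max_le
      (by omega : _ ≤ 2 * d + 1)
      (Polynomial.natDegree_mul_le.trans (by
        have := Polynomial.natDegree_C_mul_le α (Polynomial.X : Polynomial K)
        rw [Polynomial.natDegree_X] at this
        omega)))) (by omega))
    (hp.imp_right fun h => by omega) (by
      simp only [map_sub, Polynomial.derivative_mul, Polynomial.derivative_C,
        Polynomial.derivative_X]
      linear_combination hα)
  exact ⟨α, β, by linear_combination hβ⟩

/-- The light rays `q`, `q'` meet above the abscissa `x`. -/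
def Meets (q q' : K × K × K) (x : K) : Prop :=
  q.2.1 + q.1 * x = q'.2.1 + q'.1 * x ∧
    q.2.2 + q.1 * q.2.1 + q.1 ^ 2 * x = q'.2.2 + q'.1 * q'.2.1 + q'.1 ^ 2 * x

noncomputable def hessYY (f : MvPolynomial (Fin 3) K) : MvPolynomial (Fin 3) K :=
  2 * (pderiv 1 (pderiv 2 f) * pderiv 1 f * pderiv 2 f) - pderiv 1 (pderiv 1 f) * pderiv 2 f ^ 2 -
    pderiv 2 (pderiv 2 f) * pderiv 1 f ^ 2

noncomputable def hessXX (f : MvPolynomial (Fin 3) K) : MvPolynomial (Fin 3) K :=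
  2 * (pderiv 0 (pderiv 2 f) * pderiv 0 f * pderiv 2 f) - pderiv 0 (pderiv 0 f) * pderiv 2 f ^ 2 -
    pderiv 2 (pderiv 2 f) * pderiv 0 f ^ 2

noncomputable def hessXY (f : MvPolynomial (Fin 3) K) : MvPolynomial (Fin 3) K :=
  pderiv 0 (pderiv 2 f) * pderiv 1 f * pderiv 2 f +
    pderiv 1 (pderiv 2 f) * pderiv 0 f * pderiv 2 f -
    pderiv 0 (pderiv 1 f) * pderiv 2 f ^ 2 - pderiv 2 (pderiv 2 f) * pderiv 0 f * pderiv 1 f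

/-- First resultant condition for the two tangent null directions to be asymptotic. -/
noncomputable def asym1 (f : MvPolynomial (Fin 3) K) : MvPolynomial (Fin 3) K :=
  2 * (pderiv 2 f * hessXY f) - pderiv 1 f * hessYY f

/-- Second resultant condition for the two tangent null directions to be asymptotic. -/
noncomputable def asym0 (f : MvPolynomial (Fin 3) K) : MvPolynomial (Fin 3) K :=
  hessXX f * pderiv 2 f - hessYY f * pderiv 0 f

noncomputable def nullDisc (f : MvPolynomial (Fin 3) K) : MvPolynomial (Fin 3) K :=
  pderiv 1 f ^ 2 - 4 * (pderiv 0 f * pderiv 2 f)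

lemma totalDegree_mul_le_of_le {a b : MvPolynomial (Fin 3) K} {m n : ℕ} (ha : a.totalDegree ≤ m)
    (hb : b.totalDegree ≤ n) : (a * b).totalDegree ≤ m + n :=
  (totalDegree_mul _ _).trans (add_le_add ha hb)

lemma totalDegree_pow_le_of_le {a : MvPolynomial (Fin 3) K} {m : ℕ} (k : ℕ)
    (ha : a.totalDegree ≤ m) :
    (a ^ k).totalDegree ≤ k * m :=
  (totalDegree_pow _ _).trans (Nat.mul_le_mul_left _ ha)

lemma totalDegree_sub_le_of_le {a b : MvPolynomial (Fin 3) K} {m : ℕ} (ha : a.totalDegree ≤ m)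
    (hb : b.totalDegree ≤ m) : (a - b).totalDegree ≤ m :=
  (totalDegree_sub _ _).trans (max_le ha hb)

lemma totalDegree_add_le_of_le {a b : MvPolynomial (Fin 3) K} {m : ℕ} (ha : a.totalDegree ≤ m)
    (hb : b.totalDegree ≤ m) : (a + b).totalDegree ≤ m :=
  (totalDegree_add _ _).trans (max_le ha hb)

lemma totalDegree_natCast_mul_le_of_le {a : MvPolynomial (Fin 3) K} {m : ℕ} (n : ℕ)
    (ha : a.totalDegree ≤ m) :
    ((n : MvPolynomial (Fin 3) K) * a).totalDegree ≤ m := by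
  refine (totalDegree_mul _ _).trans ?_
  have : (n : MvPolynomial (Fin 3) K) = C (n : K) := by simp
  rw [this, totalDegree_C, zero_add]
  exact ha

lemma totalDegree_pderiv_pderiv_le (f : MvPolynomial (Fin 3) K) (i j : Fin 3) :
    (pderiv i (pderiv j f)).totalDegree ≤ f.totalDegree :=
  (totalDegree_pderiv_le i _).trans (totalDegree_pderiv_le j f)

lemma totalDegree_pderiv_pderiv_mul_mul_le (f : MvPolynomial (Fin 3) K) (i j : Fin 3)
    (k l : Fin 3) :
    (pderiv i (pderiv j f) * pderiv k f * pderiv l f).totalDegree ≤ 3 * f.totalDegree :=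
  (totalDegree_mul_le_of_le (totalDegree_mul_le_of_le (totalDegree_pderiv_pderiv_le f i j)
    (totalDegree_pderiv_le k f)) (totalDegree_pderiv_le l f)).trans (by omega)

lemma totalDegree_pderiv_pderiv_mul_sq_le (f : MvPolynomial (Fin 3) K) (i j : Fin 3) (k : Fin 3) :
    (pderiv i (pderiv j f) * pderiv k f ^ 2).totalDegree ≤ 3 * f.totalDegree :=
  (totalDegree_mul_le_of_le (totalDegree_pderiv_pderiv_le f i j)
    (totalDegree_pow_le_of_le 2 (totalDegree_pderiv_le k f))).trans (by omega)

lemma totalDegree_hessYY_le (f : MvPolynomial (Fin 3) K) :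
    (hessYY f).totalDegree ≤ 3 * f.totalDegree := by
  refine totalDegree_sub_le_of_le (totalDegree_sub_le_of_le ?_
    (totalDegree_pderiv_pderiv_mul_sq_le f _ _ _)) (totalDegree_pderiv_pderiv_mul_sq_le f _ _ _)
  exact_mod_cast totalDegree_natCast_mul_le_of_le 2
    (totalDegree_pderiv_pderiv_mul_mul_le f _ _ _ _)

lemma totalDegree_hessXX_le (f : MvPolynomial (Fin 3) K) :
    (hessXX f).totalDegree ≤ 3 * f.totalDegree := by
  refine totalDegree_sub_le_of_le (totalDegree_sub_le_of_le ?_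
    (totalDegree_pderiv_pderiv_mul_sq_le f _ _ _)) (totalDegree_pderiv_pderiv_mul_sq_le f _ _ _)
  exact_mod_cast totalDegree_natCast_mul_le_of_le 2
    (totalDegree_pderiv_pderiv_mul_mul_le f _ _ _ _)

lemma totalDegree_hessXY_le (f : MvPolynomial (Fin 3) K) :
    (hessXY f).totalDegree ≤ 3 * f.totalDegree :=
  totalDegree_sub_le_of_le (totalDegree_sub_le_of_le (totalDegree_add_le_of_le
    (totalDegree_pderiv_pderiv_mul_mul_le f _ _ _ _)
    (totalDegree_pderiv_pderiv_mul_mul_le f _ _ _ _))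
    (totalDegree_pderiv_pderiv_mul_sq_le f _ _ _)) (totalDegree_pderiv_pderiv_mul_mul_le f _ _ _ _)

lemma totalDegree_asym1_le (f : MvPolynomial (Fin 3) K) :
    (asym1 f).totalDegree ≤ 4 * f.totalDegree := by
  have hx := totalDegree_mul_le_of_le (totalDegree_pderiv_le 2 f) (totalDegree_hessXY_le f)
  have hy := totalDegree_mul_le_of_le (totalDegree_pderiv_le 1 f) (totalDegree_hessYY_le f)
  refine totalDegree_sub_le_of_le ?_ (hy.trans (by omega))
  exact_mod_cast totalDegree_natCast_mul_le_of_le 2 (hx.trans (by omega))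

lemma totalDegree_asym0_le (f : MvPolynomial (Fin 3) K) :
    (asym0 f).totalDegree ≤ 4 * f.totalDegree := by
  have hx := totalDegree_mul_le_of_le (totalDegree_hessXX_le f) (totalDegree_pderiv_le 2 f)
  have hy := totalDegree_mul_le_of_le (totalDegree_hessYY_le f) (totalDegree_pderiv_le 0 f)
  exact totalDegree_sub_le_of_le (hx.trans (by omega)) (hy.trans (by omega))

lemma totalDegree_nullDisc_le (f : MvPolynomial (Fin 3) K) :
    (nullDisc f).totalDegree ≤ 2 * f.totalDegree := by
  refine totalDegree_sub_le_of_le (totalDegree_pow_le_of_le 2 (totalDegree_pderiv_le 1 f)) ?_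
  exact_mod_cast totalDegree_natCast_mul_le_of_le 4
    ((totalDegree_mul_le_of_le (totalDegree_pderiv_le 0 f) (totalDegree_pderiv_le 2 f)).trans
        (by omega))

lemma eval_res_eq_of_meets {q q' : K × K × K} {x : K} (h : Meets q q' x)
    (f : MvPolynomial (Fin 3) K) : (res q' f).eval x = (res q f).eval x := by
  rw [eval_res, eval_res, h.1, h.2]

lemma res_first_order {f : MvPolynomial (Fin 3) K} {q : K × K × K} (hq : res q f = 0) :
    res q (pderiv 0 f) + Polynomial.C q.1 * res q (pderiv 1 f) +
    Polynomial.C q.1 ^ 2 * res q (pderiv 2 f) = 0 := by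
  have h := derivative_res q f
  rw [hq] at h
  simpa using h.symm

lemma res_second_order {f : MvPolynomial (Fin 3) K} {q : K × K × K} (hq : res q f = 0) :
    res q (pderiv 0 (pderiv 0 f)) +
    2 * Polynomial.C q.1 * res q (pderiv 0 (pderiv 1 f)) +
    Polynomial.C q.1 ^ 2 * (res q (pderiv 1 (pderiv 1 f)) + 2 * res q (pderiv 0 (pderiv 2 f))) +
    2 * Polynomial.C q.1 ^ 3 * res q (pderiv 1 (pderiv 2 f)) +
    Polynomial.C q.1 ^ 4 * res q (pderiv 2 (pderiv 2 f)) = 0 := by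
  have h := congrArg Polynomial.derivative (res_first_order hq)
  simp only [Polynomial.derivative_mul, map_add, derivative_res, Polynomial.derivative_C,
    Polynomial.derivative_pow, map_zero, pderiv_comm' 1 0, pderiv_comm' 2 0, pderiv_comm' 2 1,
    map_pow] at h
  linear_combination h

lemma sum_slopes_of_meets {f : MvPolynomial (Fin 3) K} {q q' : K × K × K} {x : K}
    (hq : res q f = 0) (hq' : res q' f = 0) (hne : q'.1 ≠ q.1) (h : Meets q q' x) :
    (res q (pderiv 1 f)).eval x + (q.1 + q'.1) * (res q (pderiv 2 f)).eval x = 0 := by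
  have h1 := congrArg (Polynomial.eval x) (res_first_order hq)
  have h2 := congrArg (Polynomial.eval x) (res_first_order hq')
  simp only [Polynomial.eval_add, Polynomial.eval_mul, Polynomial.eval_pow, Polynomial.eval_C,
    eval_res_eq_of_meets h, Polynomial.eval_zero] at h1 h2
  apply mul_left_cancel₀ (sub_ne_zero.2 hne)
  linear_combination h2 - h1

lemma prod_slopes_of_meets {f : MvPolynomial (Fin 3) K} {q q' : K × K × K} {x : K}
    (hq : res q f = 0) (hq' : res q' f = 0) (hne : q'.1 ≠ q.1) (h : Meets q q' x) :
    (res q (pderiv 0 f)).eval x = q.1 * q'.1 * (res q (pderiv 2 f)).eval x := by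
  have h1 := congrArg (Polynomial.eval x) (res_first_order hq)
  simp only [Polynomial.eval_add, Polynomial.eval_mul, Polynomial.eval_pow, Polynomial.eval_C,
    Polynomial.eval_zero] at h1
  linear_combination h1 - q.1 * sum_slopes_of_meets hq hq' hne h

lemma asym_of_meets {f : MvPolynomial (Fin 3) K} {q q' : K × K × K} {x : K}
    (hq : res q f = 0) (hq' : res q' f = 0) (hne : q'.1 ≠ q.1) (h : Meets q q' x) :
    (res q (asym1 f)).eval x = 0 ∧ (res q (asym0 f)).eval x = 0 := by
  have e1 := sum_slopes_of_meets hq hq' hne h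
  have e0 := prod_slopes_of_meets hq hq' hne h
  have h1 := congrArg (Polynomial.eval x) (res_second_order hq)
  have h2 := congrArg (Polynomial.eval x) (res_second_order hq')
  simp only [Polynomial.eval_add, Polynomial.eval_mul, Polynomial.eval_pow, Polynomial.eval_C,
    eval_res_eq_of_meets h, Polynomial.eval_zero, Polynomial.eval_ofNat] at h1 h2
  simp only [asym1, asym0, hessXX, hessXY, hessYY, map_sub, map_mul, map_add, map_pow, map_ofNat,
    Polynomial.eval_sub, Polynomial.eval_add, Polynomial.eval_mul, Polynomial.eval_pow,
    Polynomial.eval_ofNat]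
  have e1' := eq_neg_of_add_eq_zero_left e1
  rw [e0, e1']
  constructor
  · apply mul_left_cancel₀ (sub_ne_zero.2 hne)
    linear_combination -(Polynomial.eval x (res q (pderiv 2 f)))^3 * (h2 - h1)
  · apply mul_left_cancel₀ (sub_ne_zero.2 hne)
    linear_combination (Polynomial.eval x (res q (pderiv 2 f)))^3 * (q.1 * h2 - q'.1 * h1)

lemma wronskian_of_asym {f : MvPolynomial (Fin 3) K} {q : K × K × K} (hq : res q f = 0)
    (h1 : f ∣ asym1 f) (h0 : f ∣ asym0 f) {u w : Polynomial K} (hu : u = res q (pderiv 2 f))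
    (hw : w = res q (pderiv 1 f) + 2 * Polynomial.C q.1 * u) (hu0 : u ≠ 0) :
    (Polynomial.derivative (Polynomial.derivative u) * w -
        u * Polynomial.derivative (Polynomial.derivative w)) * w =
      2 * Polynomial.derivative w *
        (Polynomial.derivative u * w - u * Polynomial.derivative w) := by
  obtain ⟨k, hk⟩ : f ∣ asym0 f + C q.1 * asym1 f := dvd_add h0 (Dvd.dvd.mul_left h1 _)
  obtain ⟨l, hl⟩ := h1
  have a1 : res q (asym1 f) = 0 := by rw [hl, map_mul, hq, zero_mul]
  have k1 := congrArg (fun g => res q (pderiv 1 g)) hk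
  have k2 := congrArg (fun g => res q (pderiv 2 g)) hk
  have d1 := res_first_order hq
  have d2 := res_second_order hq
  simp only [pderiv_mul, map_add, map_mul, hq, zero_mul, add_zero, pderiv_C] at k1 k2
  set κ := res q k
  set s := Polynomial.C q.1 with hs
  have rs : res q (C q.1) = s := by simp [res, hs]
  have key : (res q (pderiv 2 (asym0 f)) + s * res q (pderiv 2 (asym1 f))) * w =
      (res q (pderiv 1 (asym0 f)) + s * res q (pderiv 1 (asym1 f)) +
        2 * s * (res q (pderiv 2 (asym0 f)) + s * res q (pderiv 2 (asym1 f)))) * u := by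
    rw [rs] at k1 k2
    simp only [map_zero, zero_add] at k1 k2
    rw [k1, k2, hw, hu]
    ring
  have u1 : Polynomial.derivative u = res q (pderiv 0 (pderiv 2 f)) +
      s * res q (pderiv 1 (pderiv 2 f)) + s ^ 2 * res q (pderiv 2 (pderiv 2 f)) := by
    rw [hu, derivative_res, map_pow]
  have w1 : Polynomial.derivative w = res q (pderiv 0 (pderiv 1 f)) +
      s * res q (pderiv 1 (pderiv 1 f)) + s ^ 2 * res q (pderiv 1 (pderiv 2 f)) +
      2 * s * Polynomial.derivative u := by
    rw [hw]
    simp only [map_add, Polynomial.derivative_mul, derivative_res, map_pow, hs,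
      Polynomial.derivative_C, Polynomial.derivative_ofNat, pderiv_comm' 2 1]
    ring
  rw [w1, u1]
  simp only [map_add, Polynomial.derivative_mul, derivative_res, map_pow, hs,
    Polynomial.derivative_C, Polynomial.derivative_ofNat, pderiv_comm' 2 1,
    pderiv_comm' 1 0, pderiv_comm' 2 0, Polynomial.derivative_pow]
  simp only [asym1, asym0, hessXX, hessXY, hessYY, map_sub, map_mul, map_add, map_pow, map_ofNat,
    pderiv_mul, pderiv_pow, pderiv_comm' 2 1, pderiv_comm' 1 0, pderiv_comm' 2 0] at key a1
  have p2 : ∀ i, pderiv i (2 : MvPolynomial (Fin 3) K) = 0 := fun i => by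
    rw [← map_ofNat C 2, pderiv_C]
  simp only [← hs, ← hu, p2, map_zero, zero_mul, zero_add, Nat.cast_ofNat, map_ofNat,
    Nat.add_one_sub_one, pow_one] at key a1 d1 d2 hw ⊢
  generalize res q (pderiv 0 f) = f1 at *
  generalize res q (pderiv 1 f) = f2 at *
  obtain rfl : f1 = - s * f2 - s ^ 2 * u := by linear_combination d1
  generalize res q (pderiv 0 (pderiv 0 f)) = f11 at *
  generalize res q (pderiv 0 (pderiv 1 f)) = f12 at *
  generalize res q (pderiv 0 (pderiv 2 f)) = f13 at *
  generalize res q (pderiv 1 (pderiv 1 f)) = f22 at *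
  generalize res q (pderiv 1 (pderiv 2 f)) = f23 at *
  generalize res q (pderiv 2 (pderiv 2 f)) = f33 at *
  subst hw
  obtain rfl : f11 = -(2 * s * f12 + s ^ 2 * (f22 + 2 * f13) + 2 * s ^ 3 * f23 + s ^ 4 * f33) := by
    linear_combination d2
  apply mul_left_cancel₀ (pow_ne_zero 3 hu0)
  linear_combination (-(f2 + 2 * s * u)) * key + ((f13 + s * f23 + s ^ 2 * f33) * (f2 + 2 * s * u)
    - u * (f12 + s * f22 + s ^ 2 * f23 + 2 * s * (f13 + s * f23 + s ^ 2 * f33))) * a1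

lemma not_dvd_pderiv {f : MvPolynomial (Fin 3) K} {i : Fin 3} (h : pderiv i f ≠ 0) :
    ¬ f ∣ pderiv i f := fun hd =>
  absurd (totalDegree_le_of_dvd_of_isDomain hd h) (not_le.2 (totalDegree_pderiv_lt i f h))

/-- The rays on the surface `f = 0` that cross the ray `q` do so at few points, or form a line. -/
def Controlled (f : MvPolynomial (Fin 3) K) (m : ℕ) (q : K × K × K) : Prop :=
  ∃ (Z : Finset K) (q₀ v : K × K × K), Z.card ≤ m ∧ v ≠ 0 ∧
    ∀ q' x, res q' f = 0 → q'.1 ≠ q.1 → Meets q q' x → x ∈ Z ∨ ∃ t : K, q' = q₀ + t • v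

lemma controlled_of_eval {f g : MvPolynomial (Fin 3) K} {m : ℕ} {q : K × K × K}
    (hg : res q g ≠ 0) (hm : g.totalDegree ≤ m)
    (h : ∀ q' x, res q' f = 0 → q'.1 ≠ q.1 → Meets q q' x → (res q g).eval x = 0) :
    Controlled f m q := by
  classical
  refine ⟨(res q g).roots.toFinset, 0, (1, 0, 0), ?_, by simp, fun q' x h1 h2 h3 => Or.inl ?_⟩
  · exact (Multiset.toFinset_card_le _).trans ((Polynomial.card_roots' _).trans
      ((natDegree_res_le _ _).trans hm))
  · rw [Multiset.mem_toFinset, Polynomial.mem_roots hg]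
    exact h q' x h1 h2 h3

open scoped Classical in
lemma line_of_reciprocal {q q' : K × K × K} {x α β : K} (h : Meets q q' x)
    (hs : (α * x + β) * (q.1 - q'.1) = 1) :
    ∃ t : K, q' = (if α = 0 then q - β⁻¹ • (1, 0, -q.2.1) else q + (0, 1 / α, q.1 / α)) + t •
      (if α = 0 then (0, 1, q.1) else (-1, -(β / α), q.2.1 - q.1 * (β / α))) := by
  obtain ⟨s, b, c⟩ := q
  obtain ⟨s', b', c'⟩ := q'
  obtain ⟨h1, h2⟩ := h
  simp only at h1 h2 hs ⊢
  by_cases hα : α = 0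
  · subst hα
    have hβ : β ≠ 0 := by rintro rfl; simp at hs
    refine ⟨x / β, ?_⟩
    have e1 : s' = s - 1 / β := by field_simp; linear_combination -hs
    subst e1
    simp only [if_true, Prod.smul_mk, Prod.mk_sub_mk, Prod.mk_add_mk, Prod.mk.injEq, smul_eq_mul]
    refine ⟨by field_simp; ring, ?_, ?_⟩
    · field_simp at h1 ⊢
      linear_combination -h1
    · have e2 : b' = b + x / β := by field_simp at h1 ⊢; linear_combination -h1
      subst e2
      have e3 : c' = c + 1 / β * (s * x + b) := by linear_combination -h2
      rw [e3]
      field_simp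
      ring
  · refine ⟨s - s', ?_⟩
    have e2 : b' = b + (s - s') * x := by linear_combination -h1
    have e3 : c' = c + (s - s') * (s * x + b) := by subst e2; linear_combination -h2
    simp only [if_neg hα, Prod.smul_mk, Prod.mk_add_mk, Prod.mk.injEq, smul_eq_mul]
    refine ⟨by ring, ?_, ?_⟩
    · rw [e2]; field_simp; linear_combination hs
    · rw [e3]; field_simp; linear_combination s * hs

/-- On an irreducible surface all but few rays are controlled. -/
lemma exists_controlling {p : ℕ} [CharP K p] {f : MvPolynomial (Fin 3) K} (hf : Prime f)
    (hp : p = 0 ∨ 4 * f.totalDegree + 1 < p) :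
    ∃ g : MvPolynomial (Fin 3) K, ¬ f ∣ g ∧ g.totalDegree ≤ 4 * f.totalDegree ∧
      ∀ q, res q f = 0 → res q g ≠ 0 → Controlled f (4 * f.totalDegree) q := by
  have hp' : p = 0 ∨ f.totalDegree < p := hp.imp_right fun h => by omega
  by_cases h3 : pderiv 2 f = 0
  · by_cases h2 : pderiv 1 f = 0
    · refine ⟨1, fun h => hf.not_isUnit (isUnit_of_dvd_one h), by simp, fun q hq _ => ?_⟩
      exact absurd (eq_zero_of_res_of_vars (coeff_eq_zero_of_pderiv_eq_zero hp' h2)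
        (coeff_eq_zero_of_pderiv_eq_zero hp' h3) hq) hf.ne_zero
    · have hd : (pderiv 1 f).totalDegree ≤ 4 * f.totalDegree := (totalDegree_pderiv_le 1 f).trans
        (by omega)
      refine ⟨pderiv 1 f, not_dvd_pderiv h2, hd, fun q hq hg => controlled_of_eval hg hd ?_⟩
      intro q' x hq' hne hm
      have := sum_slopes_of_meets hq hq' hne hm
      simpa [h3] using this
  by_cases hΔ : f ∣ nullDisc f
  · have hd : (pderiv 2 f).totalDegree ≤ 4 * f.totalDegree := (totalDegree_pderiv_le 2 f).trans
      (by omega)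
    refine ⟨pderiv 2 f, not_dvd_pderiv h3, hd, fun q hq hg => controlled_of_eval hg hd ?_⟩
    intro q' x hq' hne hm
    have e1 := sum_slopes_of_meets hq hq' hne hm
    have e0 := prod_slopes_of_meets hq hq' hne hm
    obtain ⟨l, hl⟩ := hΔ
    have e := congrArg (fun g => (res q g).eval x) hl
    simp only [nullDisc, map_sub, map_mul, map_pow, hq, zero_mul, Polynomial.eval_sub,
      Polynomial.eval_pow, Polynomial.eval_mul, Polynomial.eval_zero, map_ofNat,
      Polynomial.eval_ofNat] at e
    rw [e0, eq_neg_of_add_eq_zero_left e1] at e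
    have : (q'.1 - q.1) ^ 2 * (Polynomial.eval x (res q (pderiv 2 f))) ^ 2 = 0 := by
      linear_combination e
    simpa [sub_ne_zero.2 hne] using this
  by_cases hr1 : f ∣ asym1 f
  swap
  · have hd := totalDegree_asym1_le f
    exact ⟨asym1 f, hr1, hd, fun q hq hg => controlled_of_eval hg hd fun q' x hq' hne hm =>
      (asym_of_meets hq hq' hne hm).1⟩
  by_cases hr0 : f ∣ asym0 f
  swap
  · have hd := totalDegree_asym0_le f
    exact ⟨asym0 f, hr0, hd, fun q hq hg => controlled_of_eval hg hd fun q' x hq' hne hm =>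
      (asym_of_meets hq hq' hne hm).2⟩
  have hd : (pderiv 2 f * nullDisc f).totalDegree ≤ 4 * f.totalDegree :=
    (totalDegree_mul_le_of_le (totalDegree_pderiv_le 2 f) (totalDegree_nullDisc_le f)).trans
        (by omega)
  refine ⟨pderiv 2 f * nullDisc f, fun h => (hf.dvd_or_dvd h).elim (not_dvd_pderiv h3) hΔ, hd,
    fun q hq hg => ?_⟩
  rw [map_mul] at hg
  have hu0 := left_ne_zero_of_mul hg
  have hΔ0 := right_ne_zero_of_mul hg
  set u := res q (pderiv 2 f) with hu
  set w := res q (pderiv 1 f) + 2 * Polynomial.C q.1 * u with hw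
  have hΔw : res q (nullDisc f) = w ^ 2 := by
    have := res_first_order hq
    simp only [nullDisc, map_sub, map_mul, map_pow, map_ofNat]
    rw [hw]
    linear_combination -4 * u * this
  have hw0 : w ≠ 0 := by
    intro h; rw [hΔw, h] at hΔ0; simp at hΔ0
  have hud : u.natDegree ≤ f.totalDegree := (natDegree_res_le _ _).trans (totalDegree_pderiv_le 2 f)
  have hwd : w.natDegree ≤ f.totalDegree := by
    refine (Polynomial.natDegree_add_le _ _).trans
      (max_le ((natDegree_res_le _ _).trans (totalDegree_pderiv_le 1 f)) ?_)
    have : (2 : Polynomial K) * Polynomial.C q.1 = Polynomial.C (2 * q.1) := by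
      rw [Polynomial.C_mul, map_ofNat]
    rw [this]
    exact (Polynomial.natDegree_C_mul_le _ _).trans hud
  obtain ⟨α, β, hαβ⟩ := linear_ratio_of_wronskian (p := p) hw0 hud hwd
    (hp.imp_right fun h => by omega) (wronskian_of_asym hq hr1 hr0 hu hw hu0)
  classical
  refine ⟨(u * w ^ 2).roots.toFinset, _, _, ?_, ?_, fun q' x hq' hne hm => or_iff_not_imp_left.2
    fun hx => line_of_reciprocal (α := α) (β := β) hm ?_⟩
  · refine (Multiset.toFinset_card_le _).trans ((Polynomial.card_roots' _).trans ?_)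
    rw [← hΔw, hu, ← map_mul]
    exact (natDegree_res_le _ _).trans hd
  · split_ifs <;> simp
  · have hx' : (u * w ^ 2).eval x ≠ 0 := by
      intro h0
      exact hx (Multiset.mem_toFinset.2 ((Polynomial.mem_roots
        (mul_ne_zero hu0 (pow_ne_zero 2 hw0))).2 h0))
    rw [Polynomial.eval_mul] at hx'
    have hux := left_ne_zero_of_mul hx'
    have e1 := sum_slopes_of_meets hq hq' hne hm
    have e2 := congrArg (Polynomial.eval x) hαβ
    have e3 := congrArg (Polynomial.eval x) hw
    simp only [Polynomial.eval_mul, Polynomial.eval_add, Polynomial.eval_C, Polynomial.eval_X,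
      Polynomial.eval_ofNat] at e2 e3
    rw [e3] at e2
    apply mul_right_cancel₀ hux
    rw [← hu] at e1
    linear_combination -(α * x + β) * e1 - e2

section Crossings
open scoped Classical

def Cross (q q' : K × K × K) : Prop := q'.1 ≠ q.1 ∧ ∃ x, Meets q q' x

lemma Meets.symm {q q' : K × K × K} {x : K} (h : Meets q q' x) : Meets q' q x :=
  ⟨h.1.symm, h.2.symm⟩

lemma Cross.symm {q q' : K × K × K} (h : Cross q q') : Cross q' q :=
  ⟨h.1.symm, h.2.imp fun _ h => h.symm⟩

lemma cross_comm {q q' : K × K × K} : Cross q q' ↔ Cross q' q := ⟨Cross.symm, Cross.symm⟩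

noncomputable def crossings (L₁ L₂ : Finset (K × K × K)) : ℕ :=
  ∑ q ∈ L₁, (L₂.filter (Cross q)).card

def Skew (L : Finset (K × K × K)) : Prop :=
  ∀ q ∈ L, ∀ q' ∈ L, q ≠ q' → ∀ x, ¬ Meets q q' x

def FewCollinear (k : ℕ) (L : Finset (K × K × K)) : Prop :=
  ∀ q₀ v : K × K × K, v ≠ 0 → (L.filter fun q => ∃ t : K, q = q₀ + t • v).card ≤ k

lemma Skew.mono {L L' : Finset (K × K × K)} (h : Skew L) (hs : L' ⊆ L) : Skew L' :=
  fun q hq q' hq' => h q (hs hq) q' (hs hq')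

lemma FewCollinear.mono {k : ℕ} {L L' : Finset (K × K × K)} (h : FewCollinear k L) (hs : L' ⊆ L) :
    FewCollinear k L' :=
  fun q v hv => (Finset.card_le_card (Finset.filter_subset_filter _ hs)).trans (h q v hv)

lemma crossings_eq (L₁ L₂ : Finset (K × K × K)) :
    crossings L₁ L₂ = ∑ q ∈ L₁, ∑ q' ∈ L₂, if Cross q q' then 1 else 0 := by
  simp only [crossings, Finset.card_filter]

lemma crossings_comm (L₁ L₂ : Finset (K × K × K)) : crossings L₁ L₂ = crossings L₂ L₁ := by
  rw [crossings_eq, crossings_eq, Finset.sum_comm]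
  simp only [cross_comm]

lemma Skew.card_meets_le {L : Finset (K × K × K)} (hL : Skew L) (q : K × K × K) (Z : Finset K) :
    (L.filter fun q' => ∃ x ∈ Z, Meets q q' x).card ≤ Z.card := by
  choose! ξ hξ using fun q' (h : ∃ x ∈ Z, Meets q q' x) => h
  refine Finset.card_le_card_of_injOn ξ (fun q' h => (hξ q' (Finset.mem_filter.1 h).2).1) ?_
  intro a ha b hb hab
  have ha' := Finset.mem_filter.1 ha
  have hb' := Finset.mem_filter.1 hb
  by_contra hne
  have h1 := (hξ a ha'.2).2
  have h2 := (hξ b hb'.2).2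
  rw [← hab] at h2
  exact hL a ha'.1 b hb'.1 hne (ξ a) ⟨h1.1.symm.trans h2.1, h1.2.symm.trans h2.2⟩

/-- A ray not contained in `f = 0` crosses few of the rays of `f = 0`. -/
lemma Skew.card_cross_le {L : Finset (K × K × K)} (hL : Skew L) {q : K × K × K}
    {f : MvPolynomial (Fin 3) K} (hq : res q f ≠ 0) :
    (L.filter fun q' => Cross q q' ∧ res q' f = 0).card ≤ f.totalDegree := by
  refine le_trans (Finset.card_le_card ?_) ((hL.card_meets_le q (res q f).roots.toFinset).trans
    ((Multiset.toFinset_card_le _).trans ((Polynomial.card_roots' _).trans (natDegree_res_le _ _))))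
  intro q' h
  simp only [Finset.mem_filter] at h ⊢
  obtain ⟨h1, ⟨-, x, hx⟩, h3⟩ := h
  refine ⟨h1, x, ?_, hx⟩
  rw [Multiset.mem_toFinset, Polynomial.mem_roots hq, Polynomial.IsRoot,
    ← eval_res_eq_of_meets hx, h3, Polynomial.eval_zero]

lemma Controlled.card_cross_le {f : MvPolynomial (Fin 3) K} {m k : ℕ} {q : K × K × K}
    (h : Controlled f m q) {L : Finset (K × K × K)} (hL : Skew L) (hk : FewCollinear k L) :
    (L.filter fun q' => Cross q q' ∧ res q' f = 0).card ≤ m + k := by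
  obtain ⟨Z, q₀, v, hZ, hv, hc⟩ := h
  refine le_trans (Finset.card_le_card (t := (L.filter fun q' => ∃ x ∈ Z, Meets q q' x) ∪
    L.filter fun q => ∃ t : K, q = q₀ + t • v) ?_) ((Finset.card_union_le _ _).trans
      (add_le_add ((hL.card_meets_le q Z).trans hZ) (hk q₀ v hv)))
  intro q' h
  simp only [Finset.mem_filter, Finset.mem_union] at h ⊢
  obtain ⟨h1, ⟨h2, x, hx⟩, h3⟩ := h
  rcases hc q' x h3 h2 hx with h4 | h4
  · exact Or.inl ⟨h1, x, h4, hx⟩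
  · exact Or.inr ⟨h1, h4⟩

lemma sum_totalDegree_le (s : Multiset (MvPolynomial (Fin 3) K)) (h0 : s.prod ≠ 0) :
    (s.map totalDegree).sum = s.prod.totalDegree := by
  induction s using Multiset.induction_on with
  | empty => simp
  | cons a s ih =>
    rw [Multiset.prod_cons] at h0 ⊢
    rw [Multiset.map_cons, Multiset.sum_cons, ih (right_ne_zero_of_mul h0),
      totalDegree_mul_of_isDomain (left_ne_zero_of_mul h0) (right_ne_zero_of_mul h0)]

lemma exists_prime_cover {f : MvPolynomial (Fin 3) K} (hf : f ≠ 0) :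
    ∃ H : Finset (MvPolynomial (Fin 3) K), (∀ h ∈ H, Prime h) ∧
      ∑ h ∈ H, h.totalDegree ≤ f.totalDegree ∧
      ∀ q, res q f = 0 → ∃ h ∈ H, res q h = 0 := by
  set s := UniqueFactorizationMonoid.factors f with hs
  have ha : Associated s.prod f := UniqueFactorizationMonoid.factors_prod hf
  have hp0 : s.prod ≠ 0 := fun h => hf
      (by rw [h] at ha; exact (associated_zero_iff_eq_zero f).1 ha.symm)
  refine ⟨s.toFinset, fun h hh => UniqueFactorizationMonoid.prime_of_factor h
    (Multiset.mem_toFinset.1 hh), ?_, fun q hq => ?_⟩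
  · have h1 : s.prod.totalDegree ≤ f.totalDegree :=
      totalDegree_le_of_dvd_of_isDomain ha.dvd hf
    refine le_trans ?_ h1
    rw [← sum_totalDegree_le s hp0]
    calc ∑ h ∈ s.toFinset, h.totalDegree = (s.dedup.map totalDegree).sum := rfl
      _ ≤ _ := by
        obtain ⟨t, ht⟩ := Multiset.le_iff_exists_add.1 (Multiset.map_le_map
          (f := totalDegree) (Multiset.dedup_le s))
        rw [ht, Multiset.sum_add]
        omega
  · have h1 : res q s.prod = 0 := by
      obtain ⟨c, hc⟩ := ha.symm.dvd
      rw [hc, map_mul, hq, zero_mul]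
    rw [map_multiset_prod, Multiset.prod_eq_zero_iff, Multiset.mem_map] at h1
    obtain ⟨h, hh, h0⟩ := h1
    exact ⟨h, Multiset.mem_toFinset.2 hh, h0⟩

/-- Crossings between two families of rays on a surface of low degree. -/
lemma crossings_on_surface {p : ℕ} [CharP K p] {f : MvPolynomial (Fin 3) K} (hf : f ≠ 0) {D k : ℕ}
    (hD : f.totalDegree ≤ D) (hp : p = 0 ∨ 4 * D + 1 < p) {L₁ L₂ : Finset (K × K × K)}
    (h₁ : ∀ q ∈ L₁, res q f = 0) (h₂ : ∀ q ∈ L₂, res q f = 0) (s₁ : Skew L₁) (s₂ : Skew L₂)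
    (k₁ : FewCollinear k L₁) (k₂ : FewCollinear k L₂) :
    ∃ B₁ ⊆ L₁, ∃ B₂ ⊆ L₂, B₁.card ≤ 4 * D ^ 2 ∧ B₂.card ≤ 4 * D ^ 2 ∧
      crossings L₁ L₂ ≤ crossings B₁ B₂ + (L₁.card + L₂.card) * (5 * D + k) := by
  obtain ⟨H, hprime, hsum, hcover⟩ := exists_prime_cover hf
  choose! φ hφH hφ using hcover
  have hdeg : ∀ h ∈ H, h.totalDegree ≤ D := fun h hh =>
    (Finset.single_le_sum (f := totalDegree) (fun _ _ => Nat.zero_le _) hh).trans (hsum.trans hD)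
  choose! g hg hgd hgc using fun h (hh : h ∈ H) => exists_controlling (p := p) (hprime h hh)
    (hp.imp_right fun h' => by have := hdeg h hh; omega)
  have cross_le_of_skew : ∀ L : Finset (K × K × K), Skew L → (∀ q ∈ L, res q f = 0) → ∀ q,
      (L.filter fun q' => Cross q q' ∧ res q (φ q') ≠ 0).card ≤ D := by
    intro L hL hLf q
    refine le_trans ?_ (hsum.trans hD)
    refine le_trans (Finset.card_le_card (t := (H.filter fun h => res q h ≠ 0).biUnion fun h =>
      L.filter fun q' => Cross q q' ∧ res q' h = 0) ?_) (Finset.card_biUnion_le.trans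
        ((Finset.sum_le_sum fun h hh => hL.card_cross_le (Finset.mem_filter.1 hh).2).trans
          (Finset.sum_le_sum_of_subset (Finset.filter_subset _ _))))
    intro q' h
    simp only [Finset.mem_filter, Finset.mem_biUnion] at h ⊢
    exact ⟨φ q', ⟨hφH q' (hLf q' h.1), h.2.2⟩, h.1, h.2.1, hφ q' (hLf q' h.1)⟩
  have cross_le_of_controlled : ∀ L : Finset (K × K × K), Skew L → FewCollinear k L → ∀ q,
      res q f = 0 →
      res q (g (φ q)) ≠ 0 →
      (L.filter fun q' => Cross q q' ∧ res q' (φ q) = 0).card ≤ 4 * D + k := by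
    intro L hL hk q hq hbad
    refine ((hgc _ (hφH q hq) q (hφ q hq) hbad).card_cross_le hL hk).trans ?_
    have := hdeg _ (hφH q hq)
    omega
  have card_exceptional_le : ∀ L : Finset (K × K × K), (∀ q ∈ L, res q f = 0) →
      (L.filter fun q => res q (g (φ q)) = 0).card ≤ 4 * D ^ 2 := by
    intro L hL
    calc (L.filter fun q => res q (g (φ q)) = 0).card
        ≤ (H.biUnion fun h => L.filter fun q => res q h = 0 ∧ res q (g h) = 0).card := by
          refine Finset.card_le_card fun q hq => ?_
          simp only [Finset.mem_filter, Finset.mem_biUnion] at hq ⊢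
          exact ⟨φ q, hφH q (hL q hq.1), hq.1, hφ q (hL q hq.1), hq.2⟩
      _ ≤ ∑ h ∈ H, (L.filter fun q => res q h = 0 ∧ res q (g h) = 0).card :=
          Finset.card_biUnion_le
      _ ≤ ∑ h ∈ H, h.totalDegree * (4 * D) := by
          refine Finset.sum_le_sum fun h hh => ?_
          refine (card_common_rays_le (hprime h hh) (hg h hh) _
            (fun q hq => (Finset.mem_filter.1 hq).2.1)
            (fun q hq => (Finset.mem_filter.1 hq).2.2)).trans (Nat.mul_le_mul_left _ ?_)
          have := hgd h hh
          have := hdeg h hh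
          omega
      _ ≤ D * (4 * D) := by
          rw [← Finset.sum_mul]
          exact Nat.mul_le_mul_right _ (hsum.trans hD)
      _ = 4 * D ^ 2 := by ring
  refine ⟨_, Finset.filter_subset (fun q => res q (g (φ q)) = 0) _, _,
    Finset.filter_subset (fun q => res q (g (φ q)) = 0) _, card_exceptional_le L₁ h₁,
        card_exceptional_le L₂ h₂, ?_⟩
  have e1 : ∑ q ∈ L₁, ∑ q' ∈ L₂, (if Cross q q' ∧ res q (φ q') ≠ 0 then 1 else 0) ≤
      L₁.card * D := by
    simp only [← Finset.card_filter]
    exact Finset.sum_le_card_nsmul _ _ _ fun q _ => cross_le_of_skew L₂ s₂ h₂ q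
  have e2 : ∑ q ∈ L₁, ∑ q' ∈ L₂, (if Cross q' q ∧ res q' (φ q) ≠ 0 then 1 else 0) ≤
      L₂.card * D := by
    rw [Finset.sum_comm]
    simp only [← Finset.card_filter]
    exact Finset.sum_le_card_nsmul _ _ _ fun q _ => cross_le_of_skew L₁ s₁ h₁ q
  have e3 : ∑ q ∈ L₁, ∑ q' ∈ L₂, (if res q (g (φ q)) ≠ 0 ∧ Cross q q' ∧ res q' (φ q) = 0 then 1
      else 0) ≤ L₁.card * (4 * D + k) := by
    simp only [← Finset.card_filter]
    refine Finset.sum_le_card_nsmul _ _ _ fun q hq => ?_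
    by_cases hb : res q (g (φ q)) = 0
    · simp [hb]
    · simpa [hb] using cross_le_of_controlled L₂ s₂ k₂ q (h₁ q hq) hb
  have e4 : ∑ q ∈ L₁, ∑ q' ∈ L₂, (if res q' (g (φ q')) ≠ 0 ∧ Cross q' q ∧ res q (φ q') = 0 then 1
      else 0) ≤ L₂.card * (4 * D + k) := by
    rw [Finset.sum_comm]
    simp only [← Finset.card_filter]
    refine Finset.sum_le_card_nsmul _ _ _ fun q hq => ?_
    by_cases hb : res q (g (φ q)) = 0
    · simp [hb]
    · simpa [hb] using cross_le_of_controlled L₁ s₁ k₁ q (h₂ q hq) hb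
  have e5 : crossings (L₁.filter fun q => res q (g (φ q)) = 0)
      (L₂.filter fun q => res q (g (φ q)) = 0) = ∑ q ∈ L₁, ∑ q' ∈ L₂,
        (if res q (g (φ q)) = 0 ∧ res q' (g (φ q')) = 0 ∧ Cross q q' then 1 else 0) := by
    rw [crossings_eq, Finset.sum_filter]
    refine Finset.sum_congr rfl fun q _ => ?_
    rw [Finset.sum_filter]
    split_ifs with h <;> simp [h, ite_and]
  have e6 : crossings L₁ L₂ ≤ ∑ q ∈ L₁, ∑ q' ∈ L₂,
      ((if res q (g (φ q)) = 0 ∧ res q' (g (φ q')) = 0 ∧ Cross q q' then 1 else 0) +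
        (if Cross q q' ∧ res q (φ q') ≠ 0 then 1 else 0) +
        (if Cross q' q ∧ res q' (φ q) ≠ 0 then 1 else 0) +
        (if res q (g (φ q)) ≠ 0 ∧ Cross q q' ∧ res q' (φ q) = 0 then 1 else 0) +
        (if res q' (g (φ q')) ≠ 0 ∧ Cross q' q ∧ res q (φ q') = 0 then 1 else 0)) := by
    rw [crossings_eq]
    refine Finset.sum_le_sum fun q _ => Finset.sum_le_sum fun q' _ => ?_
    by_cases hc : Cross q q'
    · have hc' := hc.symm
      by_cases b1 : res q (g (φ q)) = 0 <;> by_cases b2 : res q' (g (φ q')) = 0 <;>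
        by_cases b3 : res q (φ q') = 0 <;> by_cases b4 : res q' (φ q) = 0 <;>
          simp [hc, hc', b1, b2, b3, b4]
    · simp [hc]
  simp only [Finset.sum_add_distrib] at e6
  rw [e5]
  nlinarith
end Crossings

section Counting
open scoped Classical

/-- Greedy selection: if every `b ∈ B` has many neighbours in `A`, then a small `S ⊆ A` meets
more than `D` neighbours of most of the elements of `B`, by weight. -/
lemma exists_greedy_sample {α β : Type*} (A : Finset α) (B : Finset β) (r : α → β → Prop)
    (w : β → ℕ) (hA : A.Nonempty) {D T s : ℕ}
    (hT : ∀ b ∈ B, D + T ≤ (A.filter fun a => r a b).card) (hs : 2 * A.card * (D + 1) < s * T) :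
    ∃ S ⊆ A, S.card ≤ s ∧
      2 * ∑ b ∈ B with (S.filter fun a => r a b).card ≤ D, w b ≤ ∑ b ∈ B, w b := by
  have key : ∀ t : ℕ, ∃ S ⊆ A, S.card ≤ t ∧
      (2 * ∑ b ∈ B with (S.filter fun a => r a b).card ≤ D, w b ≤ ∑ b ∈ B, w b ∨
        2 * A.card * ∑ b ∈ B, w b * (D + 1 - (S.filter fun a => r a b).card) +
          t * T * ∑ b ∈ B, w b ≤ 2 * A.card * ((D + 1) * ∑ b ∈ B, w b)) := by
    intro t
    induction t with
    | zero =>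
      refine ⟨∅, by simp, by simp, Or.inr ?_⟩
      simp only [Finset.filter_empty, Finset.card_empty, Nat.sub_zero, zero_mul, add_zero,
        ← Finset.sum_mul]
      rw [mul_comm (∑ b ∈ B, w b)]
    | succ t ih =>
      obtain ⟨S, hSA, hSt, h | h⟩ := ih
      · exact ⟨S, hSA, hSt.trans (by omega), Or.inl h⟩
      set U := B.filter fun b => (S.filter fun a => r a b).card ≤ D with hU
      by_cases hhalf : 2 * ∑ b ∈ U, w b ≤ ∑ b ∈ B, w b
      · exact ⟨S, hSA, hSt.trans (by omega), Or.inl hhalf⟩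
      push Not at hhalf
      let dec : α → ℕ := fun a => ∑ b ∈ B, if b ∈ U ∧ r a b ∧ a ∉ S then w b else 0
      have hdec : T * ∑ b ∈ U, w b ≤ ∑ a ∈ A, dec a := by
        rw [Finset.sum_comm, Finset.mul_sum, Finset.sum_filter]
        refine Finset.sum_le_sum fun b hb => ?_
        split_ifs with hbU
        · have hbU' : b ∈ U := Finset.mem_filter.2 ⟨hb, hbU⟩
          have h1 : ∑ a ∈ A, (if b ∈ U ∧ r a b ∧ a ∉ S then w b else 0) =
              (A.filter fun a => r a b ∧ a ∉ S).card * w b := by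
            rw [← Finset.sum_filter, Finset.sum_const, smul_eq_mul]
            simp [hbU']
          rw [h1]
          refine Nat.mul_le_mul_right _ ?_
          have h2 : (A.filter fun a => r a b).card ≤ (A.filter fun a => r a b ∧ a ∉ S).card +
              (S.filter fun a => r a b).card := by
            refine (Finset.card_le_card ?_).trans (Finset.card_union_le _ _)
            intro a ha
            simp only [Finset.mem_filter, Finset.mem_union] at ha ⊢
            tauto
          have := hT b hb
          omega
        · exact Nat.zero_le _
      obtain ⟨a, haA, ha⟩ : ∃ a ∈ A, T * ∑ b ∈ U, w b ≤ A.card * dec a := by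
        by_contra! hcon
        have h1 := Finset.sum_lt_sum_of_nonempty hA hcon
        rw [← Finset.mul_sum, Finset.sum_const, smul_eq_mul] at h1
        exact absurd (Nat.lt_of_mul_lt_mul_left h1) (not_lt.2 hdec)
      refine ⟨insert a S, Finset.insert_subset haA hSA, (Finset.card_insert_le _ _).trans
          (by omega),
        Or.inr ?_⟩
      have hΦ : ∑ b ∈ B, w b * (D + 1 - ((insert a S).filter fun a => r a b).card) + dec a ≤
          ∑ b ∈ B, w b * (D + 1 - (S.filter fun a => r a b).card) := by
        rw [← Finset.sum_add_distrib]
        refine Finset.sum_le_sum fun b hb => ?_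
        have hmono : (S.filter fun a => r a b).card ≤ ((insert a S).filter fun a => r a b).card :=
          Finset.card_le_card (Finset.filter_subset_filter _ (Finset.subset_insert _ _))
        split_ifs with hc
        · have h1 : ((insert a S).filter fun a => r a b).card =
              (S.filter fun a => r a b).card + 1 := by
            rw [Finset.filter_insert, if_pos hc.2.1, Finset.card_insert_of_notMem]
            exact fun h => hc.2.2 (Finset.mem_filter.1 h).1
          have h2 := (Finset.mem_filter.1 hc.1).2
          rw [h1]
          have h3 : D + 1 - (S.filter fun a => r a b).card =
            (D + 1 - ((S.filter fun a => r a b).card + 1)) + 1 := by omega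
          rw [h3]
          nlinarith
        · rw [add_zero]
          exact Nat.mul_le_mul_left _ (by omega)
      have h2 : T * ∑ b ∈ B, w b ≤ 2 * (A.card * dec a) := by nlinarith
      nlinarith
  obtain ⟨S, hSA, hS, h | h⟩ := key s
  · exact ⟨S, hSA, hS, h⟩
  · rcases Nat.eq_zero_or_pos (∑ b ∈ B, w b) with h0 | h0
    · exact ⟨∅, by simp, by simp, le_of_le_of_eq (b := 2 * ∑ b ∈ B, w b) (Nat.mul_le_mul_left _
        (Finset.sum_le_sum_of_subset (Finset.filter_subset _ _))) (by rw [h0])⟩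
    · exfalso
      have h1 : s * T * ∑ b ∈ B, w b ≤ 2 * A.card * (D + 1) * ∑ b ∈ B, w b := by
        rw [mul_assoc (2 * A.card)]
        exact (Nat.le_add_left _ _).trans h
      exact absurd (Nat.le_of_mul_le_mul_right h1 h0) (not_le.2 hs)

lemma crossings_le_mul (L₁ L₂ : Finset (K × K × K)) : crossings L₁ L₂ ≤ L₁.card * L₂.card :=
  Finset.sum_le_card_nsmul _ _ _ fun _ _ => Finset.card_filter_le _ _

/-- One step of the recursion for the number of crossings. -/
lemma crossings_step {p : ℕ} [CharP K p] {D k N : ℕ} (hp : p = 0 ∨ 4 * D + 1 < p) (hD : 1 ≤ D)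
    (hN : N ≤ 400 * (D + 1) ^ 2) {L₁ L₂ : Finset (K × K × K)} (c₁ : L₁.card ≤ N)
    (c₂ : L₂.card ≤ N) (s₁ : Skew L₁) (s₂ : Skew L₂)
    (k₁ : FewCollinear k L₁) (k₂ : FewCollinear k L₂) :
    ∃ B₁ ⊆ L₁, ∃ B₂ ⊆ L₂, B₁.card ≤ 4 * D ^ 2 ∧ B₂.card ≤ 4 * D ^ 2 ∧
      crossings L₁ L₂ ≤ 2 * crossings B₁ B₂ + N * (9625 * D + 4 * k) := by
  rcases L₁.eq_empty_or_nonempty with rfl | hne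
  · exact ⟨∅, by simp, ∅, by simp, by simp, by simp, by simp [crossings]⟩
  set T := 4801 * (D + 1) with hT
  set R := L₂.filter fun q => D + T ≤ (L₁.filter (Cross q)).card with hR
  obtain ⟨S, hS, hSc, hw⟩ := exists_greedy_sample (D := D) (T := T) (s := (D ^ 2 + 5 * D + 5) / 6)
    L₁ R (fun a b => Cross b a) (fun b => (L₁.filter (Cross b)).card) hne
    (fun b hb => (Finset.mem_filter.1 hb).2) (by
      have h1 : (D + 1) ^ 2 ≤ 6 * ((D ^ 2 + 5 * D + 5) / 6) := by
        have : D ^ 2 + 5 * D ≤ 6 * ((D ^ 2 + 5 * D + 5) / 6) := by omega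
        nlinarith
      have h2 : 2 * L₁.card * (D + 1) ≤ 2 * (400 * (D + 1) ^ 2) * (D + 1) := by
        gcongr; exact c₁.trans hN
      have h3 : (D + 1) ^ 2 * (4801 * (D + 1)) ≤ 6 * ((D ^ 2 + 5 * D + 5) / 6) * (4801 * (D + 1)) :=
        Nat.mul_le_mul_right _ h1
      have h4 : 0 < (D + 1) ^ 2 * (D + 1) := by positivity
      nlinarith)
  obtain ⟨f, hf, hfD, hfS⟩ := exists_vanishing S D (by
    have : 6 * ((D ^ 2 + 5 * D + 5) / 6) ≤ D ^ 2 + 5 * D + 5 := by omega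
    nlinarith)
  set M₂ := R.filter fun q => ¬ (S.filter fun a => Cross q a).card ≤ D with hM₂
  have hM₂L : M₂ ⊆ L₂ := (Finset.filter_subset _ _).trans (Finset.filter_subset _ _)
  have hM₂f : ∀ q ∈ M₂, res q f = 0 := by
    intro q hq
    by_contra h0
    refine (Finset.mem_filter.1 hq).2 (le_trans (Finset.card_le_card ?_)
      (((s₁.mono hS).card_cross_le h0).trans hfD))
    intro a ha
    rw [Finset.mem_filter] at ha ⊢
    exact ⟨ha.1, ha.2, hfS a ha.1⟩
  set M₁ := L₁.filter fun q => res q f = 0 with hM₁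
  have hM₁L : M₁ ⊆ L₁ := Finset.filter_subset _ _
  obtain ⟨B₁, hB₁, B₂, hB₂, b₁, b₂, hB⟩ := crossings_on_surface hf hfD hp (L₁ := M₁) (L₂ := M₂)
    (fun q hq => (Finset.mem_filter.1 hq).2) hM₂f (s₁.mono hM₁L) (s₂.mono hM₂L)
    (k₁.mono hM₁L) (k₂.mono hM₂L)
  refine ⟨B₁, hB₁.trans hM₁L, B₂, hB₂.trans hM₂L, b₁, b₂, ?_⟩
  have e1 : crossings L₂ L₁ ≤ N * (D + T) + ∑ q ∈ R, (L₁.filter (Cross q)).card := by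
    rw [crossings, ← Finset.sum_filter_add_sum_filter_not L₂
      (fun q => D + T ≤ (L₁.filter (Cross q)).card), add_comm]
    refine Nat.add_le_add_right ((Finset.sum_le_card_nsmul _ _ (D + T) fun q hq =>
      (not_le.1 (Finset.mem_filter.1 hq).2).le).trans ?_) _
    rw [smul_eq_mul]
    exact Nat.mul_le_mul_right _ ((Finset.card_filter_le _ _).trans c₂)
  have e2 : ∑ q ∈ R, (L₁.filter (Cross q)).card ≤ 2 * crossings M₂ L₁ := by
    have := Finset.sum_filter_add_sum_filter_not R
      (fun q => (S.filter fun a => Cross q a).card ≤ D) (fun q => (L₁.filter (Cross q)).card)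
    rw [← hM₂] at this
    rw [crossings]
    omega
  have e3 : crossings M₂ L₁ ≤ crossings M₁ M₂ + N * D := by
    rw [crossings_comm M₂ L₁, crossings, crossings,
      ← Finset.sum_filter_add_sum_filter_not L₁ (fun q => res q f = 0)]
    refine Nat.add_le_add_left ((Finset.sum_le_card_nsmul _ _ D fun q hq => ?_).trans ?_) _
    · refine le_trans (Finset.card_le_card ?_)
        (((s₂.mono hM₂L).card_cross_le (Finset.mem_filter.1 hq).2).trans hfD)
      intro a ha
      rw [Finset.mem_filter] at ha ⊢
      exact ⟨ha.1, ha.2, hM₂f a ha.1⟩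
    · rw [smul_eq_mul]
      exact Nat.mul_le_mul_right _ ((Finset.card_filter_le _ _).trans c₁)
  have e4 : (M₁.card + M₂.card) * (5 * D + k) ≤ (2 * N) * (5 * D + k) := by
    refine Nat.mul_le_mul_right _ ?_
    have := (Finset.card_le_card hM₁L).trans c₁
    have := (Finset.card_le_card hM₂L).trans c₂
    omega
  have e5 : N * (D + T) ≤ N * (9603 * D) := Nat.mul_le_mul_left _ (by omega)
  rw [crossings_comm L₁ L₂]
  nlinarith

/-- The number of crossings between two skew families of rays. -/
theorem crossings_le {p : ℕ} [CharP K p] {k : ℕ} (N : ℕ) (hp : p = 0 ∨ N ≤ 2 * p ^ 2)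
    (L₁ L₂ : Finset (K × K × K)) (c₁ : L₁.card ≤ N) (c₂ : L₂.card ≤ N) (s₁ : Skew L₁)
    (s₂ : Skew L₂) (k₁ : FewCollinear k L₁) (k₂ : FewCollinear k L₂) :
    (crossings L₁ L₂ : ℝ) ≤ 500 * (N * √N) + 5 * (k * N) := by
  induction N using Nat.strong_induction_on generalizing L₁ L₂ with
  | _ N ih =>
  set D := Nat.sqrt (N / 400) with hDdef
  have hDl : 400 * (D * D) ≤ N := by
    have : D * D ≤ N / 400 := Nat.sqrt_le (N / 400)
    omega
  have hDu : N ≤ 400 * (D + 1) ^ 2 := by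
    have : N / 400 < (D + 1) * (D + 1) := Nat.lt_succ_sqrt (N / 400)
    have h2 : N ≤ 400 * (N / 400 + 1) := by omega
    rw [sq]
    exact h2.trans (Nat.mul_le_mul_left _ this)
  have hsq : √(N : ℝ) * √(N : ℝ) = N := Real.mul_self_sqrt (Nat.cast_nonneg _)
  have hs0 : 0 ≤ √(N : ℝ) := Real.sqrt_nonneg _
  have hk0 : (0 : ℝ) ≤ k * N := by positivity
  rcases Nat.eq_zero_or_pos D with hD0 | hD
  · have hN : N ≤ 400 := by rw [hD0] at hDu; omega
    have h1 : crossings L₁ L₂ ≤ N * N := (crossings_le_mul _ _).trans (Nat.mul_le_mul c₁ c₂)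
    have h2 : (crossings L₁ L₂ : ℝ) ≤ N * N := by exact_mod_cast h1
    have h3 : √(N : ℝ) ≤ 20 := by
      rw [Real.sqrt_le_left (by norm_num)]
      have : (N : ℝ) ≤ 400 := by exact_mod_cast hN
      linarith
    have h4 : (0 : ℝ) ≤ N * √(N : ℝ) := by positivity
    nlinarith
  · have hp' : p = 0 ∨ 4 * D + 1 < p := by
      refine hp.imp_right fun h => ?_
      by_contra! hcon
      nlinarith
    obtain ⟨B₁, hB₁, B₂, hB₂, b₁, b₂, hB⟩ := crossings_step (k := k) hp' hD hDu c₁ c₂ s₁ s₂ k₁ k₂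
    have h1 := ih (4 * D ^ 2) (by nlinarith) (hp.imp_right fun h => by nlinarith) B₁ B₂ b₁ b₂
      (s₁.mono hB₁) (s₂.mono hB₂) (k₁.mono hB₁) (k₂.mono hB₂)
    have h2 : √((4 * D ^ 2 : ℕ) : ℝ) = 2 * D := by
      push_cast
      rw [show (4 : ℝ) * (D : ℝ) ^ 2 = (2 * D) ^ 2 by ring, Real.sqrt_sq (by positivity)]
    rw [h2] at h1
    push_cast at h1
    have h3 : (crossings L₁ L₂ : ℝ) ≤ 2 * crossings B₁ B₂ + N * (9625 * D + 4 * k) := by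
      exact_mod_cast hB
    have hDl' : (400 : ℝ) * (D * D) ≤ N := by exact_mod_cast hDl
    have h4 : (20 : ℝ) * D ≤ √(N : ℝ) := Real.le_sqrt_of_sq_le (by linarith)
    have hN0 : (0 : ℝ) ≤ N := Nat.cast_nonneg _
    have h5 : (N : ℝ) * (20 * D) ≤ N * √(N : ℝ) := mul_le_mul_of_nonneg_left h4 hN0
    have hD0' : (0 : ℝ) ≤ D := Nat.cast_nonneg _
    have h6 : (400 : ℝ) * (D * D) * D ≤ N * D := mul_le_mul_of_nonneg_right hDl' hD0'
    have h7 : (k : ℝ) * (400 * (D * D)) ≤ k * N := mul_le_mul_of_nonneg_left hDl'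
        (Nat.cast_nonneg _)
    nlinarith
end Counting

section Generic
open scoped Classical

/-- The incidence form on the space of light rays. -/
def raysForm (q q' : K × K × K) : K := q.2.2 - q'.2.2 + q.1 * q'.2.1 - q'.1 * q.2.1

lemma Meets.raysForm_eq_zero {q q' : K × K × K} {x : K} (h : Meets q q' x) :
    raysForm q q' = 0 := by
  obtain ⟨h1, h2⟩ := h
  unfold raysForm
  linear_combination h2 - (q.1 + q'.1) * h1

lemma cross_of_raysForm_eq_zero {q q' : K × K × K} (hs : q'.1 ≠ q.1) (h : raysForm q q' = 0) :
    Cross q q' := by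
  have hs' := sub_ne_zero.2 hs
  have e : (q'.1 - q.1) * ((q.2.1 - q'.2.1) / (q'.1 - q.1)) = q.2.1 - q'.2.1 := by field_simp
  refine ⟨hs, (q.2.1 - q'.2.1) / (q'.1 - q.1), ?_, ?_⟩
  · linear_combination -e
  · unfold raysForm at h
    linear_combination h - (q.1 + q'.1) * e

lemma exists_avoiding [Infinite K] (P : Finset (K × K)) (h : ∀ a ∈ P, a ≠ 0) :
    ∃ t : K, ∀ a ∈ P, a.1 + a.2 * t ≠ 0 := by
  obtain ⟨t, ht⟩ := Infinite.exists_notMem_finset (P.image fun a => -a.1 / a.2)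
  refine ⟨t, fun a ha h0 => ?_⟩
  by_cases h2 : a.2 = 0
  · rw [h2, zero_mul, add_zero] at h0
    exact h a ha (Prod.ext h0 h2)
  · refine ht (Finset.mem_image.2 ⟨a, ha, ?_⟩)
    field_simp
    linear_combination -h0

lemma FewCollinear.image {k : ℕ} {L : Finset (K × K × K)} (h : FewCollinear k L)
    {T U V : K × K × K → K × K × K} (hU : ∀ q v, ∀ t : K, U (q + t • v) = U q + t • V v)
    (hV : ∀ v, V v = 0 → v = 0) (hT : ∀ q, U (T q) = q) : FewCollinear k (L.image T) := by
  intro q₀ v hv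
  refine le_trans ?_ (h (U q₀) (V v) (fun h0 => hv (hV v h0)))
  refine Finset.card_le_card_of_injOn U ?_ ?_
  · intro q hq
    simp only [Finset.coe_filter, Finset.mem_image, Set.mem_ofPred_eq] at hq ⊢
    obtain ⟨⟨a, ha, rfl⟩, t, ht⟩ := hq
    refine ⟨by rwa [hT], t, ?_⟩
    rw [ht, hU]
  · intro q hq q' hq' hqq
    simp only [Finset.coe_filter, Finset.mem_image, Set.mem_ofPred_eq] at hq hq'
    obtain ⟨⟨a, ha, rfl⟩, -⟩ := hq
    obtain ⟨⟨a', ha', rfl⟩, -⟩ := hq'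
    rw [hT, hT] at hqq
    rw [hqq]

/-- The number of incident pairs in a set of light rays. -/
theorem card_incident_le [Infinite K] {p : ℕ} [CharP K p] {k : ℕ} (Q : Finset (K × K × K))
    (hp : p = 0 ∨ Q.card ≤ 2 * p ^ 2) (hk : FewCollinear k Q) :
    (((Q ×ˢ Q).filter fun z => raysForm z.1 z.2 = 0).card : ℝ) ≤
      500 * (Q.card * √Q.card) + 5 * (k * Q.card) := by
  obtain ⟨ξ, hξ⟩ := exists_avoiding (((Q ×ˢ Q).filter fun z => z.1.2.2 = z.2.2.2 ∧ z.1 ≠ z.2).image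
      fun z => (z.1.2.1 - z.2.2.1, -(z.1.1 - z.2.1))) (by
    intro a ha h0
    simp only [Finset.mem_image, Finset.mem_filter, Finset.mem_product] at ha
    obtain ⟨z, ⟨-, h1, h2⟩, rfl⟩ := ha
    simp only [Prod.mk_eq_zero, neg_eq_zero, sub_eq_zero] at h0
    exact h2 (Prod.ext h0.2 (Prod.ext h0.1 h1)))
  have hξ' : ∀ q ∈ Q, ∀ q' ∈ Q, q ≠ q' → q.2.2 = q'.2.2 →
      q.2.1 - q.1 * ξ ≠ q'.2.1 - q'.1 * ξ := by
    intro q hq q' hq' hne h1 h2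
    refine hξ _ (Finset.mem_image.2 ⟨(q, q'), Finset.mem_filter.2
      ⟨Finset.mk_mem_product hq hq', h1, hne⟩, rfl⟩) ?_
    simp only
    linear_combination h2
  obtain ⟨σ, hσ⟩ := exists_avoiding ((((Q ×ˢ Q).filter fun z => z.1 ≠ z.2).image
      fun z => (z.1.2.2 - z.2.2.2, z.1.2.1 - z.1.1 * ξ - (z.2.2.1 - z.2.1 * ξ))) ∪
        Q.image fun q => (q.1, 1)) (by
    intro a ha h0
    simp only [Finset.mem_union, Finset.mem_image, Finset.mem_filter, Finset.mem_product] at ha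
    obtain ⟨z, ⟨⟨hz1, hz2⟩, h1⟩, rfl⟩ | ⟨q, -, rfl⟩ := ha
    · simp only [Prod.mk_eq_zero, sub_eq_zero] at h0
      exact hξ' _ hz1 _ hz2 h1 h0.1 (by linear_combination h0.2)
    · simp at h0)
  have hσ1 : ∀ q ∈ Q, q.1 + σ ≠ 0 := by
    intro q hq h
    refine hσ (q.1, 1) (Finset.mem_union_right _ (Finset.mem_image_of_mem _ hq)) ?_
    simpa using h
  have hσ2 : ∀ q ∈ Q, ∀ q' ∈ Q, q ≠ q' →
      q.2.2 + σ * (q.2.1 - q.1 * ξ) - (q'.2.2 + σ * (q'.2.1 - q'.1 * ξ)) ≠ 0 := by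
    intro q hq q' hq' hne h
    refine hσ _ (Finset.mem_union_left _ (Finset.mem_image.2 ⟨(q, q'), Finset.mem_filter.2
      ⟨Finset.mk_mem_product hq hq', hne⟩, rfl⟩)) ?_
    simp only
    linear_combination h
  set S : K × K × K → K := fun q => q.1 + σ with hS
  set β : K × K × K → K := fun q => q.2.1 - q.1 * ξ with hβ
  set Γ : K × K × K → K := fun q => q.2.2 + σ * β q with hΓ
  have hform : ∀ q q', Γ q - Γ q' + S q * β q' - S q' * β q = raysForm q q' := by
    intro q q'; simp only [hΓ, hS, hβ, raysForm]; ring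
  obtain ⟨l, hl⟩ := exists_avoiding ((((Q ×ˢ Q).filter fun z => z.1 ≠ z.2).image
      fun z => (S z.1 * β z.2 - S z.2 * β z.1, Γ z.1 - Γ z.2)) ∪
      (((Q ×ˢ Q).filter fun z => z.1 ≠ z.2).image
      fun z => (Γ z.1 - Γ z.2, S z.1 * β z.2 - S z.2 * β z.1)) ∪
      ((Q ×ˢ Q).image fun z => (S z.1, - S z.2)) ∪ {(0, 1)}) (by
    intro a ha h0
    simp only [Finset.mem_union, Finset.mem_image, Finset.mem_filter, Finset.mem_product,
      Finset.mem_singleton] at ha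
    obtain ((⟨z, ⟨⟨hz1, hz2⟩, h1⟩, rfl⟩ | ⟨z, ⟨⟨hz1, hz2⟩, h1⟩, rfl⟩) | ⟨z, hz, rfl⟩) | rfl := ha
    · exact hσ2 _ hz1 _ hz2 h1 (Prod.mk_eq_zero.1 h0).2
    · exact hσ2 _ hz1 _ hz2 h1 (Prod.mk_eq_zero.1 h0).1
    · exact hσ1 _ hz.1 (Prod.mk_eq_zero.1 h0).1
    · simp at h0)
  simp only [Finset.mem_union, Finset.mem_image, Finset.mem_filter, Finset.mem_product,
      Finset.mem_singleton] at hl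
  have hl0 : l ≠ 0 := by simpa using hl (0, 1) (Or.inr rfl)
  have hlS : ∀ q ∈ Q, ∀ q' ∈ Q, l * S q' ≠ S q := by
    intro q hq q' hq' h
    refine hl (S q, -S q') (Or.inl (Or.inr ⟨(q, q'), ⟨hq, hq'⟩, rfl⟩)) ?_
    linear_combination -h
  set T₁ : K × K × K → K × K × K := fun q => (S q, β q, l * Γ q) with hT₁
  set T₂ : K × K × K → K × K × K := fun q => (l * S q, l * β q, l * Γ q) with hT₂
  have hk₁ : FewCollinear k (Q.image T₁) := by
    refine hk.image (U := fun q => (q.1 - σ, q.2.1 + (q.1 - σ) * ξ, q.2.2 / l - σ * q.2.1))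
      (V := fun q => (q.1, q.2.1 + q.1 * ξ, q.2.2 / l - σ * q.2.1)) ?_ ?_ ?_
    · intro q v t
      simp only [Prod.fst_add, Prod.snd_add, Prod.smul_fst, Prod.smul_snd, smul_eq_mul,
        Prod.smul_mk, Prod.mk_add_mk, Prod.mk.injEq]
      exact ⟨by ring, by ring, by ring⟩
    · rintro ⟨a, b, c⟩ h
      simp only [Prod.mk_eq_zero] at h ⊢
      obtain ⟨rfl, h2, h3⟩ := h
      have h2' : b = 0 := by simpa using h2
      subst h2'
      exact ⟨rfl, rfl, by simpa [hl0] using h3⟩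
    · rintro ⟨a, b, c⟩
      simp only [hT₁, hS, hβ, hΓ, Prod.mk.injEq]
      exact ⟨by ring, by ring, by field_simp; ring⟩
  have hk₂ : FewCollinear k (Q.image T₂) := by
    refine hk.image (U := fun q => (q.1 / l - σ, q.2.1 / l + (q.1 / l - σ) * ξ,
      q.2.2 / l - σ * (q.2.1 / l)))
      (V := fun q => (q.1 / l, q.2.1 / l + q.1 / l * ξ, q.2.2 / l - σ * (q.2.1 / l))) ?_ ?_ ?_
    · intro q v t
      simp only [Prod.fst_add, Prod.snd_add, Prod.smul_fst, Prod.smul_snd, smul_eq_mul,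
        Prod.smul_mk, Prod.mk_add_mk, Prod.mk.injEq]
      exact ⟨by ring, by ring, by ring⟩
    · rintro ⟨a, b, c⟩ h
      simp only [Prod.mk_eq_zero] at h ⊢
      obtain ⟨h1, h2, h3⟩ := h
      have h1' : a = 0 := by simpa [hl0] using h1
      subst h1'
      have h2' : b = 0 := by simpa [hl0] using h2
      subst h2'
      exact ⟨rfl, rfl, by simpa [hl0] using h3⟩
    · rintro ⟨a, b, c⟩
      simp only [hT₂, hS, hβ, hΓ, Prod.mk.injEq]
      exact ⟨by field_simp; ring, by field_simp; ring, by field_simp; ring⟩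
  have hs₁ : Skew (Q.image T₁) := by
    intro q hq q' hq' hne x hx
    obtain ⟨a, ha, rfl⟩ := Finset.mem_image.1 hq
    obtain ⟨a', ha', rfl⟩ := Finset.mem_image.1 hq'
    have hne' : a ≠ a' := fun h => hne (by rw [h])
    refine hl _ (Or.inl (Or.inl (Or.inl ⟨(a, a'), ⟨⟨ha, ha'⟩, hne'⟩, rfl⟩))) ?_
    have := hx.raysForm_eq_zero
    simp only [raysForm, hT₁] at this
    linear_combination this
  have hs₂ : Skew (Q.image T₂) := by
    intro q hq q' hq' hne x hx
    obtain ⟨a, ha, rfl⟩ := Finset.mem_image.1 hq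
    obtain ⟨a', ha', rfl⟩ := Finset.mem_image.1 hq'
    have hne' : a ≠ a' := fun h => hne (by rw [h])
    refine hl _ (Or.inl (Or.inl (Or.inr ⟨(a, a'), ⟨⟨ha, ha'⟩, hne'⟩, rfl⟩))) ?_
    have := hx.raysForm_eq_zero
    simp only [raysForm, hT₂] at this
    apply mul_left_cancel₀ hl0
    linear_combination this
  have hinj₁ : Set.InjOn T₁ Q := by
    intro q hq q' hq' h
    by_contra hne
    refine hσ2 q hq q' hq' hne ?_
    simp only [hT₁, Prod.mk.injEq] at h
    apply mul_left_cancel₀ hl0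
    linear_combination h.2.2
  have hinj₂ : Set.InjOn T₂ Q := by
    intro q hq q' hq' h
    by_contra hne
    refine hσ2 q hq q' hq' hne ?_
    simp only [hT₂, Prod.mk.injEq] at h
    apply mul_left_cancel₀ hl0
    linear_combination h.2.2
  have hmain := crossings_le (p := p) (k := k) Q.card hp (Q.image T₁) (Q.image T₂)
    Finset.card_image_le Finset.card_image_le hs₁ hs₂ hk₁ hk₂
  refine le_trans ?_ hmain
  rw [Nat.cast_le, crossings, Finset.sum_image hinj₁, Finset.card_filter, Finset.sum_product]
  refine Finset.sum_le_sum fun q hq => ?_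
  rw [← Finset.card_filter]
  refine Finset.card_le_card_of_injOn T₂ ?_ (hinj₂.mono (Finset.filter_subset _ _))
  intro q' hq'
  simp only [Finset.coe_filter, Set.mem_ofPred_eq] at hq' ⊢
  refine ⟨Finset.mem_image_of_mem _ hq'.1, cross_of_raysForm_eq_zero (hlS q hq q' hq'.1) ?_⟩
  have := hform q q'
  rw [hq'.2] at this
  simp only [raysForm, hT₁, hT₂]
  linear_combination l * this

end Generic

end LightRays

section PlanePoints
open scoped Classical
variable {F : Type*} [Field F]

/-- At most `M` points of `A` lie on a common line or circle. -/
def FewOnCurves (M : ℕ) (A : Finset (F × F)) : Prop :=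
  ∀ L : Set (F × F), IsLine L ∨ IsCircle L → ((A : Set (F × F)) ∩ L).ncard ≤ M

lemma FewOnCurves.card_le {M : ℕ} {A T : Finset (F × F)} (h : FewOnCurves M A) {L : Set (F × F)}
    (hL : IsLine L ∨ IsCircle L) (hT : T ⊆ A) (hTL : ∀ x ∈ T, x ∈ L) : T.card ≤ M := by
  refine le_trans ?_ (h L hL)
  rw [← Set.ncard_coe_finset T]
  exact Set.ncard_le_ncard (fun x hx => ⟨hT hx, hTL x hx⟩) (A.finite_toSet.inter_of_left L)

lemma FewOnCurves.card_line_le {M : ℕ} {A T : Finset (F × F)} (h : FewOnCurves M A) (x v : F × F)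
    (hv : v ≠ 0) (hT : T ⊆ A) (hTL : ∀ y ∈ T, ∃ t : F, y = x + t • v) : T.card ≤ M :=
  h.card_le (L := {y | ∃ t : F, y = x + t • v}) (Or.inl ⟨x, v, hv, rfl⟩) hT hTL

lemma FewOnCurves.card_circle_le {M : ℕ} {A T : Finset (F × F)} (h : FewOnCurves M A) (c : F × F)
    {r : F} (hr : r ≠ 0) (hT : T ⊆ A) (hTL : ∀ y ∈ T, dist2 y c = r) : T.card ≤ M :=
  h.card_le (L := {x | dist2 x c = r}) (Or.inr ⟨c, r, hr, rfl⟩) hT hTL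

lemma FewOnCurves.card_linear_le {M : ℕ} {A T : Finset (F × F)} (h : FewOnCurves M A)
    {f g e : F} (hfg : f ≠ 0 ∨ g ≠ 0) (hT : T ⊆ A)
    (hTL : ∀ y ∈ T, f * y.1 + g * y.2 = e) : T.card ≤ M := by
  rcases hfg with hf | hg
  · refine h.card_line_le (e / f, 0) (-g / f, 1) (fun h0 => ?_) hT fun y hy => ⟨y.2, ?_⟩
    · exact one_ne_zero (congrArg Prod.snd h0)
    · refine Prod.ext ?_ ?_
      · have := hTL y hy
        simp only [Prod.fst_add, Prod.smul_fst, smul_eq_mul]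
        field_simp
        linear_combination this
      · simp
  · refine h.card_line_le (0, e / g) (1, -f / g) (fun h0 => ?_) hT fun y hy => ⟨y.1, ?_⟩
    · exact one_ne_zero (congrArg Prod.fst h0)
    · refine Prod.ext ?_ ?_
      · simp
      · have := hTL y hy
        simp only [Prod.snd_add, Prod.smul_snd, smul_eq_mul]
        field_simp
        linear_combination this

lemma FewOnCurves.card_null_circle_le {M : ℕ} {A T : Finset (F × F)} (h : FewOnCurves M A)
    (c : F × F) (hT : T ⊆ A) (hTL : ∀ y ∈ T, dist2 y c = 0) : T.card ≤ 2 * M := by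
  by_cases hj : ∃ j : F, j ^ 2 = -1
  · obtain ⟨j, hj⟩ := hj
    rw [← Finset.card_filter_add_card_filter_not (s := T)
      fun y => 1 * y.1 + (-j) * y.2 = c.1 - j * c.2, two_mul]
    refine add_le_add (h.card_linear_le (Or.inl one_ne_zero)
      ((Finset.filter_subset _ _).trans hT) fun y hy => (Finset.mem_filter.1 hy).2) ?_
    refine h.card_linear_le (f := 1) (g := j) (e := c.1 + j * c.2) (Or.inl one_ne_zero)
      ((Finset.filter_subset _ _).trans hT) fun y hy => ?_
    obtain ⟨hy, hn⟩ := Finset.mem_filter.1 hy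
    have h0 := hTL y hy
    unfold dist2 at h0
    have : (1 * y.1 + (-j) * y.2 - (c.1 - j * c.2)) *
        (1 * y.1 + j * y.2 - (c.1 + j * c.2)) = 0 := by
      linear_combination h0 - (y.2 - c.2) ^ 2 * hj
    exact sub_eq_zero.1 ((mul_eq_zero.1 this).resolve_left (sub_ne_zero.2 hn))
  · refine le_trans (h.card_linear_le (f := 0) (g := 1) (e := c.2) (Or.inr one_ne_zero) hT
      fun y hy => ?_) (Nat.le_mul_of_pos_left M two_pos)
    by_contra hne
    have hne' : y.2 - c.2 ≠ 0 := fun h0 => hne (by linear_combination h0)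
    refine hj ⟨(y.1 - c.1) / (y.2 - c.2), ?_⟩
    have h0 := hTL y hy
    unfold dist2 at h0
    field_simp
    linear_combination h0

lemma FewOnCurves.card_quadric_le {M : ℕ} {A T : Finset (F × F)} (h : FewOnCurves M A)
    (h2 : (2 : F) ≠ 0) {f g e : F} (hT : T ⊆ A)
    (hTL : ∀ y ∈ T, y.1 ^ 2 + y.2 ^ 2 = f * y.1 + g * y.2 + e) : T.card ≤ 2 * M := by
  have key : ∀ y ∈ T, dist2 y (f / 2, g / 2) = e + (f ^ 2 + g ^ 2) / 4 := by
    intro y hy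
    have h4 : (4 : F) ≠ 0 := by
      rw [show (4 : F) = 2 * 2 by norm_num]
      exact mul_ne_zero h2 h2
    have h0 := hTL y hy
    unfold dist2
    field_simp
    linear_combination 16 * h0
  by_cases hρ : e + (f ^ 2 + g ^ 2) / 4 = 0
  · exact h.card_null_circle_le _ hT fun y hy => (key y hy).trans hρ
  · exact (h.card_circle_le _ hρ hT key).trans (Nat.le_mul_of_pos_left M two_pos)

variable {K : Type*} [Field K] [Algebra F K]

lemma FewOnCurves.card_linear_le_of_algebra {M : ℕ} {A T : Finset (F × F)} (h : FewOnCurves M A)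
    {f g e : K} (hfg : f ≠ 0 ∨ g ≠ 0) (hT : T ⊆ A)
    (hTL : ∀ y ∈ T, f * algebraMap F K y.1 + g * algebraMap F K y.2 = e) : T.card ≤ M := by
  have hφ : ∃ φ : K →ₗ[F] F, φ f ≠ 0 ∨ φ g ≠ 0 := by
    by_contra! hcon
    rcases hfg with h0 | h0
    · exact h0 ((Module.forall_dual_apply_eq_zero_iff F f).1 fun φ => (hcon φ).1)
    · exact h0 ((Module.forall_dual_apply_eq_zero_iff F g).1 fun φ => (hcon φ).2)
  obtain ⟨φ, hφ⟩ := hφ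
  refine h.card_linear_le (e := φ e) hφ hT fun y hy => ?_
  rw [← hTL y hy, mul_comm f, mul_comm g, ← Algebra.smul_def, ← Algebra.smul_def, map_add,
    map_smul, map_smul, smul_eq_mul, smul_eq_mul, mul_comm (φ f), mul_comm (φ g)]

lemma FewOnCurves.card_quadric_le_of_algebra {M : ℕ} {A T : Finset (F × F)} (h : FewOnCurves M A)
    (h2 : (2 : F) ≠ 0) {f g e : K} (hT : T ⊆ A)
    (hTL : ∀ y ∈ T, algebraMap F K y.1 ^ 2 + algebraMap F K y.2 ^ 2 =
      f * algebraMap F K y.1 + g * algebraMap F K y.2 + e) : T.card ≤ 2 * M := by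
  obtain ⟨φ, hφ⟩ : ∃ φ : K →ₗ[F] F, φ 1 ≠ 0 := by
    by_contra! hcon
    exact one_ne_zero ((Module.forall_dual_apply_eq_zero_iff F (1 : K)).1 hcon)
  refine h.card_quadric_le h2 (f := φ f / φ 1) (g := φ g / φ 1) (e := φ e / φ 1) hT fun y hy => ?_
  have h0 := congrArg φ (hTL y hy)
  rw [mul_comm f, mul_comm g, ← map_pow, ← map_pow, ← map_add, Algebra.algebraMap_eq_smul_one,
    ← Algebra.smul_def, ← Algebra.smul_def, map_add, map_add,
    map_smul, map_smul, map_smul] at h0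
  simp only [smul_eq_mul] at h0
  field_simp
  linear_combination h0

lemma card_circle_inter_le {r : F} (hr : r ≠ 0) (h2 : (2 : F) ≠ 0) {b c : F × F} (hbc : b ≠ c)
    (T : Finset (F × F)) (hT : ∀ a ∈ T, dist2 a b = r ∧ dist2 a c = r) : T.card ≤ 2 := by
  by_contra! hcon
  obtain ⟨a, ha, a', ha', a'', ha'', h1, h3, h4⟩ := Finset.two_lt_card.1 hcon
  have key : ∀ z ∈ T, ∃ t : F, z = a + t • (-(b.2 - c.2), b.1 - c.1) := by
    intro z hz
    obtain ⟨e1, e2⟩ := hT z hz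
    obtain ⟨e3, e4⟩ := hT a ha
    unfold dist2 at e1 e2 e3 e4
    have e5 : 2 * ((z.1 - a.1) * (b.1 - c.1) + (z.2 - a.2) * (b.2 - c.2)) = 0 := by
      linear_combination e2 - e1 - e4 + e3
    have e6 := (mul_eq_zero.1 e5).resolve_left h2
    by_cases h0 : b.1 - c.1 = 0
    · have h0' : b.2 - c.2 ≠ 0 := fun h0' =>
        hbc (Prod.ext (sub_eq_zero.1 h0) (sub_eq_zero.1 h0'))
      refine ⟨-(z.1 - a.1) / (b.2 - c.2), Prod.ext ?_ ?_⟩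
      · simp only [Prod.fst_add, Prod.smul_fst, smul_eq_mul]
        field_simp
        ring
      · simp only [Prod.snd_add, Prod.smul_snd, smul_eq_mul]
        field_simp
        linear_combination e6
    · refine ⟨(z.2 - a.2) / (b.1 - c.1), Prod.ext ?_ ?_⟩
      · simp only [Prod.fst_add, Prod.smul_fst, smul_eq_mul]
        field_simp
        linear_combination e6
      · simp only [Prod.snd_add, Prod.smul_snd, smul_eq_mul]
        field_simp
        ring
  obtain ⟨t, rfl⟩ := key a' ha'
  obtain ⟨u, rfl⟩ := key a'' ha''
  have ht : t ≠ 0 := by rintro rfl; simp at h1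
  have hu : u ≠ 0 := by rintro rfl; simp at h3
  have htu : t - u ≠ 0 := by
    intro h0
    rw [sub_eq_zero.1 h0] at h4
    exact h4 rfl
  obtain ⟨e1, -⟩ := hT a ha
  obtain ⟨e2, -⟩ := hT _ ha'
  obtain ⟨e3, -⟩ := hT _ ha''
  have hw : b.1 - c.1 ≠ 0 ∨ b.2 - c.2 ≠ 0 := by
    by_contra! h0
    exact hbc (Prod.ext (sub_eq_zero.1 h0.1) (sub_eq_zero.1 h0.2))
  simp only [dist2, Prod.fst_add, Prod.smul_fst, smul_eq_mul, Prod.snd_add, Prod.smul_snd]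
    at e1 e2 e3
  generalize b.1 - c.1 = w at *
  generalize b.2 - c.2 = v at *
  have f1 : t * (v ^ 2 + w ^ 2) + 2 * (w * (a.2 - b.2) - v * (a.1 - b.1)) = 0 :=
    (mul_eq_zero.1 (show t * _ = 0 by linear_combination e2 - e1)).resolve_left ht
  have f2 : u * (v ^ 2 + w ^ 2) + 2 * (w * (a.2 - b.2) - v * (a.1 - b.1)) = 0 :=
    (mul_eq_zero.1 (show u * _ = 0 by linear_combination e3 - e1)).resolve_left hu
  have f3 : v ^ 2 + w ^ 2 = 0 :=
    (mul_eq_zero.1 (show (t - u) * _ = 0 by linear_combination f1 - f2)).resolve_left htu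
  have f4 : w * (a.2 - b.2) - v * (a.1 - b.1) = 0 :=
    (mul_eq_zero.1 (show (2 : F) * _ = 0 by linear_combination f1 - t * f3)).resolve_left h2
  have hw' : w ≠ 0 := by
    rintro rfl
    refine hw.elim (fun h => h rfl) fun h => h ?_
    exact pow_eq_zero_iff two_ne_zero |>.1 (by linear_combination f3)
  have f5 : w ^ 2 * ((a.1 - b.1) ^ 2 + (a.2 - b.2) ^ 2) = 0 := by
    linear_combination (w * (a.2 - b.2) + v * (a.1 - b.1)) * f4 + (a.1 - b.1) ^ 2 * f3
  rw [e1] at f5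
  exact mul_ne_zero (pow_ne_zero 2 hw') hr f5

/-- The finset of segments of squared length `r`. -/
noncomputable def segments (A : Finset (F × F)) (r : F) : Finset ((F × F) × (F × F)) :=
  (A ×ˢ A).filter fun q => dist2 q.1 q.2 = r

lemma coe_segments (A : Finset (F × F)) {r : F} (hr : r ≠ 0) : (segments A r : Set _) = Sr A r := by
  ext q
  simp only [segments, Sr, Finset.coe_filter, Finset.mem_product, Set.mem_ofPred_eq]
  refine ⟨fun h => ⟨h.1.1, h.1.2, fun he => hr ?_, h.2⟩, fun h => ⟨⟨h.1, h.2.1⟩, h.2.2.2⟩⟩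
  rw [← h.2, he]
  simp [dist2]

lemma card_segments_sq_le (A : Finset (F × F)) {r : F} (hr : r ≠ 0) (h2 : (2 : F) ≠ 0) :
    (segments A r).card ^ 2 ≤ 3 * A.card ^ 3 := by
  have h1 : (segments A r).card = ∑ a ∈ A, (A.filter fun b => dist2 a b = r).card := by
    rw [segments, Finset.card_filter, Finset.sum_product]
    simp only [Finset.card_filter]
  have h3 : ∑ a ∈ A, (A.filter fun b => dist2 a b = r).card ^ 2 =
      ∑ z ∈ A ×ˢ A, (A.filter fun a => dist2 a z.1 = r ∧ dist2 a z.2 = r).card := by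
    simp only [sq, ← Finset.card_product, ← Finset.filter_product]
    simp only [Finset.card_filter]
    exact Finset.sum_comm
  have h4 : ∑ z ∈ A ×ˢ A, (A.filter fun a => dist2 a z.1 = r ∧ dist2 a z.2 = r).card ≤
      ∑ z ∈ A ×ˢ A, (2 + if z.1 = z.2 then A.card else 0) := by
    refine Finset.sum_le_sum fun z _ => ?_
    split_ifs with hz
    · exact (Finset.card_filter_le _ _).trans (Nat.le_add_left _ _)
    · exact card_circle_inter_le hr h2 hz _ fun a ha => (Finset.mem_filter.1 ha).2
  have h5 : ∑ z ∈ A ×ˢ A, (2 + if z.1 = z.2 then A.card else 0) = 3 * A.card ^ 2 := by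
    rw [Finset.sum_add_distrib, Finset.sum_product (f := fun z => if z.1 = z.2 then A.card else 0)]
    simp
    ring
  rw [h1]
  refine (sq_sum_le_card_mul_sum_sq (s := A)).trans ?_
  calc _ ≤ A.card * (3 * A.card ^ 2) := Nat.mul_le_mul_left _ (by rw [h3, ← h5]; exact h4)
    _ = _ := by ring

end PlanePoints

section Rays
open scoped Classical
variable {F K : Type*} [Field F] [Field K] [Algebra F K]

/-- The isotropic coordinate `x₁ + i x₂`. -/
def isoCoord (i : K) (x : F × F) : K := algebraMap F K x.1 + i * algebraMap F K x.2

/-- The light ray of a segment of squared length `r`. -/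
noncomputable def toRay (i : K) (r : F) (s : (F × F) × (F × F)) : K × K × K :=
  ((isoCoord i s.2 - isoCoord i s.1)⁻¹,
    -isoCoord i s.1 * (isoCoord i s.2 - isoCoord i s.1)⁻¹,
    isoCoord (-i) s.1 / algebraMap F K r)

lemma isoCoord_sub_mul {i : K} (hi : i ^ 2 = -1) {r : F} {s : (F × F) × (F × F)}
    (hs : dist2 s.1 s.2 = r) :
    (isoCoord i s.2 - isoCoord i s.1) * (isoCoord (-i) s.2 - isoCoord (-i) s.1) =
      algebraMap F K r := by
  rw [← hs]
  simp only [isoCoord, dist2, map_add, map_sub, map_pow]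
  linear_combination -(algebraMap F K s.2.2 - algebraMap F K s.1.2) ^ 2 * hi

lemma isoCoord_injective {i : K} (hi : i ^ 2 = -1) (h2 : (2 : K) ≠ 0) {x y : F × F}
    (h : isoCoord i x = isoCoord i y) (h' : isoCoord (-i) x = isoCoord (-i) y) : x = y := by
  unfold isoCoord at h h'
  have hi0 : i ≠ 0 := by rintro rfl; norm_num at hi
  refine Prod.ext ((algebraMap F K).injective ?_) ((algebraMap F K).injective ?_)
  · exact mul_left_cancel₀ h2 (by linear_combination h + h')
  · exact mul_left_cancel₀ (mul_ne_zero h2 hi0) (by linear_combination h - h')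

lemma segment_eq {i : K} (hi : i ^ 2 = -1) (h2 : (2 : K) ≠ 0) {r : F} (hr : r ≠ 0)
    {s s' : (F × F) × (F × F)} (hs : dist2 s.1 s.2 = r) (hs' : dist2 s'.1 s'.2 = r)
    (h1 : s.1 = s'.1) (h : isoCoord i s.2 - isoCoord i s.1 = isoCoord i s'.2 - isoCoord i s'.1) :
    s = s' := by
  have e1 := isoCoord_sub_mul hi hs
  have e2 := isoCoord_sub_mul hi hs'
  have hr' : algebraMap F K r ≠ 0 := by simpa using hr
  have hU : isoCoord i s'.2 - isoCoord i s'.1 ≠ 0 := left_ne_zero_of_mul (e2.trans_ne hr')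
  rw [← e2, h] at e1
  have e3 := mul_left_cancel₀ hU e1
  rw [h1] at h e3
  exact Prod.ext h1 (isoCoord_injective hi h2 (sub_left_inj.1 h) (sub_left_inj.1 e3))

lemma toRay_injOn {i : K} (hi : i ^ 2 = -1) (h2 : (2 : K) ≠ 0) {r : F} (hr : r ≠ 0)
    (A : Finset (F × F)) : Set.InjOn (toRay i r) (segments A r : Set ((F × F) × (F × F))) := by
  intro s hs s' hs' h
  have hs := (Finset.mem_filter.1 hs).2
  have hs' := (Finset.mem_filter.1 hs').2
  have hr' : algebraMap F K r ≠ 0 := by simpa using hr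
  have hU : isoCoord i s.2 - isoCoord i s.1 ≠ 0 :=
    left_ne_zero_of_mul ((isoCoord_sub_mul hi hs).trans_ne hr')
  simp only [toRay, Prod.mk.injEq, inv_inj] at h
  obtain ⟨e1, e2, e3⟩ := h
  rw [← e1] at e2
  refine segment_eq hi h2 hr hs hs' (isoCoord_injective hi h2 ?_ ?_) e1
  · exact neg_injective (mul_right_cancel₀ (inv_ne_zero hU) e2)
  · exact (div_left_inj' hr').1 e3

lemma raysForm_toRay {i : K} (hi : i ^ 2 = -1) {r : F} (hr : r ≠ 0) {s s' : (F × F) × (F × F)}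
    (hs : dist2 s.1 s.2 = r) (hs' : dist2 s'.1 s'.2 = r)
    (h : AxiallySymmetric s.1 s.2 s'.1 s'.2) : raysForm (toRay i r s) (toRay i r s') = 0 := by
  obtain ⟨n, e, hn, h1, h3⟩ := h
  have hr' : algebraMap F K r ≠ 0 := by simpa using hr
  have e1 := isoCoord_sub_mul hi hs
  have e2 := isoCoord_sub_mul hi hs'
  have hU : isoCoord i s.2 - isoCoord i s.1 ≠ 0 := left_ne_zero_of_mul (e1.trans_ne hr')
  have hU' : isoCoord i s'.2 - isoCoord i s'.1 ≠ 0 := left_ne_zero_of_mul (e2.trans_ne hr')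
  have hnn : algebraMap F K (dot n n) = isoCoord i n * isoCoord (-i) n := by
    simp only [isoCoord, dot, map_add, map_mul]
    linear_combination algebraMap F K n.2 ^ 2 * hi
  have hn' : isoCoord i n * isoCoord (-i) n ≠ 0 := by
    rw [← hnn]
    simpa using hn
  have hν := left_ne_zero_of_mul hn'
  have hμ := right_ne_zero_of_mul hn'
  have key : ∀ x : F × F,
      isoCoord (-i) n * isoCoord i (reflct n e x) =
        2 * algebraMap F K e - isoCoord i n * isoCoord (-i) x ∧
      isoCoord i n * isoCoord (-i) (reflct n e x) =
        2 * algebraMap F K e - isoCoord (-i) n * isoCoord i x := by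
    intro x
    have hd : 2 * algebraMap F K (dot n x) =
        isoCoord i n * isoCoord (-i) x + isoCoord (-i) n * isoCoord i x := by
      simp only [isoCoord, dot, map_add, map_mul]
      linear_combination 2 * algebraMap F K n.2 * algebraMap F K x.2 * hi
    have hc : ∀ j : K, isoCoord j (reflct n e x) = isoCoord j x -
        2 * (algebraMap F K (dot n x) - algebraMap F K e) / (isoCoord i n * isoCoord (-i) n) *
          isoCoord j n := by
      intro j
      rw [← hnn]
      simp only [isoCoord, reflct, Prod.fst_sub, Prod.snd_sub, Prod.smul_fst, Prod.smul_snd,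
        smul_eq_mul, map_sub, map_mul, map_div₀, map_ofNat]
      ring
    rw [hc, hc]
    constructor
    · field_simp
      linear_combination -hd
    · field_simp
      linear_combination -hd
  obtain ⟨a1, a2⟩ := key s.1
  obtain ⟨b1, b2⟩ := key s.2
  rw [h1] at a1 a2
  rw [h3] at b1 b2
  simp only [raysForm, toRay]
  generalize isoCoord i s.1 = X at *
  generalize isoCoord (-i) s.1 = Y at *
  generalize isoCoord i s.2 = X₁ at *
  generalize isoCoord (-i) s.2 = Y₁ at *
  generalize isoCoord i s'.1 = X' at *
  generalize isoCoord (-i) s'.1 = Y' at *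
  generalize isoCoord i s'.2 = X₁' at *
  generalize isoCoord (-i) s'.2 = Y₁' at *
  generalize isoCoord i n = ν at *
  generalize isoCoord (-i) n = μ at *
  rw [← e1] at hr' ⊢
  have hV := right_ne_zero_of_mul hr'
  field_simp
  have b3 : μ * (X₁' - X') = -ν * (Y₁ - Y) := by linear_combination b1 - a1
  have : μ * ν * ((Y - Y') * (X₁' - X') + (Y₁ - Y) * (X - X')) = 0 := by
    linear_combination (ν * (Y - Y')) * b3 + ν * (Y₁ - Y) * (a2 - a1)
  linear_combination (mul_eq_zero.1 this).resolve_left (mul_ne_zero hμ hν)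

end Rays

section RayFamily
open scoped Classical
variable {F K : Type*} [Field F] [Field K] [Algebra F K]

lemma card_eq_card_image_fst {i : K} (hi : i ^ 2 = -1) (h2 : (2 : K) ≠ 0) {r : F} (hr : r ≠ 0)
    {A : Finset (F × F)} {T : Finset ((F × F) × (F × F))} (hT : T ⊆ segments A r)
    (h : ∀ s ∈ T, ∀ s' ∈ T, s.1 = s'.1 →
      isoCoord i s.2 - isoCoord i s.1 = isoCoord i s'.2 - isoCoord i s'.1) :
    T.card = (T.image Prod.fst).card := by
  refine (Finset.card_image_of_injOn fun s hs s' hs' he => ?_).symm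
  exact segment_eq hi h2 hr (Finset.mem_filter.1 (hT hs)).2 (Finset.mem_filter.1 (hT hs')).2 he
    (h s hs s' hs' he)

lemma FewOnCurves.fewCollinear {M : ℕ} {A : Finset (F × F)} (h : FewOnCurves M A) {i : K}
    (hi : i ^ 2 = -1) (h2 : (2 : K) ≠ 0) {r : F} (hr : r ≠ 0) :
    FewCollinear (2 * M) ((segments A r).image (toRay i r)) := by
  intro q₀ v hv
  have h2F : (2 : F) ≠ 0 := fun h0 => h2 (by rw [← map_ofNat (algebraMap F K) 2, h0, map_zero])
  have hi0 : i ≠ 0 := by rintro rfl; norm_num at hi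
  have hr' : algebraMap F K r ≠ 0 := by simpa using hr
  rw [Finset.filter_image]
  refine Finset.card_image_le.trans ?_
  set T := (segments A r).filter fun s => ∃ t : K, toRay i r s = q₀ + t • v with hTdef
  have hT : T ⊆ segments A r := Finset.filter_subset _ _
  have hA : T.image Prod.fst ⊆ A := by
    intro a ha
    obtain ⟨s, hs, rfl⟩ := Finset.mem_image.1 ha
    exact (Finset.mem_product.1 (Finset.mem_filter.1 (hT hs)).1).1
  have hUV : ∀ s ∈ T, (isoCoord i s.2 - isoCoord i s.1) *
      (isoCoord (-i) s.2 - isoCoord (-i) s.1) = algebraMap F K r := fun s hs =>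
    isoCoord_sub_mul hi (Finset.mem_filter.1 (hT hs)).2
  have hU0 : ∀ s ∈ T, isoCoord i s.2 - isoCoord i s.1 ≠ 0 := fun s hs =>
    left_ne_zero_of_mul ((hUV s hs).trans_ne hr')
  have hline : ∀ s ∈ T, ∃ t : K, (isoCoord i s.2 - isoCoord i s.1)⁻¹ = q₀.1 + t * v.1 ∧
      -isoCoord i s.1 * (isoCoord i s.2 - isoCoord i s.1)⁻¹ = q₀.2.1 + t * v.2.1 ∧
      isoCoord (-i) s.1 / algebraMap F K r = q₀.2.2 + t * v.2.2 := by
    intro s hs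
    obtain ⟨t, ht⟩ := (Finset.mem_filter.1 hs).2
    simp only [toRay, Prod.ext_iff, Prod.fst_add, Prod.snd_add, Prod.smul_fst, Prod.smul_snd,
      smul_eq_mul] at ht
    exact ⟨t, ht⟩
  by_cases hv1 : v.1 = 0
  · have hU : ∀ s ∈ T, q₀.1 * (isoCoord i s.2 - isoCoord i s.1) = 1 := by
      intro s hs
      obtain ⟨t, ht, -⟩ := hline s hs
      rw [hv1, mul_zero, add_zero] at ht
      rw [← ht, inv_mul_cancel₀ (hU0 s hs)]
    rw [card_eq_card_image_fst hi h2 hr hT fun s hs s' hs' _ =>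
      mul_left_cancel₀ (left_ne_zero_of_mul_eq_one (hU s hs)) ((hU s hs).trans (hU s' hs').symm)]
    refine le_trans ?_ (Nat.le_mul_of_pos_left M two_pos)
    rcases T.eq_empty_or_nonempty with hTe | ⟨s₀, hs₀⟩
    · rw [hTe]; simp
    have hq := left_ne_zero_of_mul_eq_one (hU s₀ hs₀)
    refine h.card_linear_le_of_algebra
      (f := -(v.2.2 * q₀.1 * algebraMap F K r) - v.2.1)
      (g := i * (v.2.1 - v.2.2 * q₀.1 * algebraMap F K r))
      (e := (v.2.2 * q₀.2.1 - v.2.1 * q₀.2.2) * algebraMap F K r) ?_ hA ?_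
    · by_contra! hcon
      obtain ⟨c1, c2⟩ := hcon
      have c2 := (mul_eq_zero.1 c2).resolve_left hi0
      have d1 : v.2.1 = 0 :=
        (mul_eq_zero.1 (show (2 : K) * _ = 0 by linear_combination c2 - c1)).resolve_left h2
      have d2 : v.2.2 = 0 := by
        rw [d1] at c2
        exact (mul_eq_zero.1 (show v.2.2 * (q₀.1 * algebraMap F K r) = 0 by
          linear_combination -c2)).resolve_right (mul_ne_zero hq hr')
      exact hv (Prod.ext hv1 (Prod.ext d1 d2))
    · intro y hy
      obtain ⟨s, hs, rfl⟩ := Finset.mem_image.1 hy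
      obtain ⟨t, t1, t2, t3⟩ := hline s hs
      rw [t1, hv1, mul_zero, add_zero] at t2
      rw [div_eq_iff hr'] at t3
      simp only [isoCoord] at t2 t3
      linear_combination (v.2.2 * algebraMap F K r) * t2 - v.2.1 * t3
  · obtain ⟨α, β, γ, δ, hXY⟩ : ∃ α β γ δ : K, ∀ s ∈ T,
        isoCoord i s.1 = α + β * (isoCoord i s.2 - isoCoord i s.1) ∧
          isoCoord (-i) s.1 = γ + δ * (isoCoord (-i) s.2 - isoCoord (-i) s.1) := by
      refine ⟨-(v.2.1 / v.1), -(q₀.2.1 - q₀.1 * v.2.1 / v.1),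
        algebraMap F K r * (q₀.2.2 - q₀.1 * v.2.2 / v.1), v.2.2 / v.1, fun s hs => ?_⟩
      obtain ⟨t, t1, t2, t3⟩ := hline s hs
      have hU := hU0 s hs
      have hV := hUV s hs
      rw [div_eq_iff hr'] at t3
      generalize isoCoord i s.2 - isoCoord i s.1 = U at *
      generalize isoCoord (-i) s.2 - isoCoord (-i) s.1 = V at *
      have ht : t = (U⁻¹ - q₀.1) / v.1 := by rw [t1]; field_simp; ring
      subst ht
      constructor
      · field_simp at t2 ⊢
        linear_combination -t2
      · rw [t3, ← hV]
        field_simp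
        ring
    by_cases hβδ : β = 0 ∧ δ = 0
    · obtain ⟨rfl, rfl⟩ := hβδ
      simp only [zero_mul, add_zero] at hXY
      refine le_trans ?_ (Nat.le_mul_of_pos_left M two_pos)
      rcases T.eq_empty_or_nonempty with hTe | ⟨s₀, hs₀⟩
      · rw [hTe]; simp
      have hfst : ∀ s ∈ T, s.1 = s₀.1 := fun s hs =>
        isoCoord_injective hi h2 ((hXY s hs).1.trans (hXY s₀ hs₀).1.symm)
          ((hXY s hs).2.trans (hXY s₀ hs₀).2.symm)
      rw [← Finset.card_image_of_injOn (s := T) (f := Prod.snd) fun s hs s' hs' he =>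
        Prod.ext ((hfst s hs).trans (hfst s' hs').symm) he]
      refine h.card_circle_le s₀.1 hr ?_ ?_
      · intro a ha
        obtain ⟨s, hs, rfl⟩ := Finset.mem_image.1 ha
        exact (Finset.mem_product.1 (Finset.mem_filter.1 (hT hs)).1).2
      · intro a ha
        obtain ⟨s, hs, rfl⟩ := Finset.mem_image.1 ha
        rw [← hfst s hs, ← (Finset.mem_filter.1 (hT hs)).2]
        simp only [dist2]
        ring
    · rw [card_eq_card_image_fst hi h2 hr hT ?_]
      · refine h.card_quadric_le_of_algebra h2F (f := γ + α) (g := i * (γ - α))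
          (e := β * δ * algebraMap F K r - α * γ) hA fun y hy => ?_
        obtain ⟨s, hs, rfl⟩ := Finset.mem_image.1 hy
        have hV := hUV s hs
        obtain ⟨e1, e2⟩ := hXY s hs
        have e3 : (isoCoord i s.1 - α) * (isoCoord (-i) s.1 - γ) = β * δ * algebraMap F K r := by
          rw [← hV]
          linear_combination (isoCoord (-i) s.1 - γ) * e1 +
            β * (isoCoord i s.2 - isoCoord i s.1) * e2
        simp only [isoCoord] at e3
        linear_combination e3 + algebraMap F K s.1.2 ^ 2 * hi
      · intro s hs s' hs' he
        have hV := hUV s hs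
        have hV' := hUV s' hs'
        obtain ⟨e1, e2⟩ := hXY s hs
        obtain ⟨e1', e2'⟩ := hXY s' hs'
        by_cases hβ : β = 0
        · have hδ : δ ≠ 0 := fun h0 => hβδ ⟨hβ, h0⟩
          have e3 : isoCoord (-i) s.2 - isoCoord (-i) s.1 =
              isoCoord (-i) s'.2 - isoCoord (-i) s'.1 := by
            refine mul_left_cancel₀ hδ ?_
            rw [← sub_eq_iff_eq_add'.2 e2, ← sub_eq_iff_eq_add'.2 e2', he]
          rw [← hV', ← e3] at hV
          exact mul_right_cancel₀
              (right_ne_zero_of_mul (hV.trans_ne (by rw [e3, hV']; exact hr'))) hV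
        · refine mul_left_cancel₀ hβ ?_
          rw [← sub_eq_iff_eq_add'.2 e1, ← sub_eq_iff_eq_add'.2 e1', he]

end RayFamily

section SegmentPairs
open scoped Classical
variable {F : Type*} [Field F]

/-- The axially symmetric pairs of segments. -/
noncomputable def axialPairs (A : Finset (F × F)) (r : F) :
    Finset (((F × F) × (F × F)) × ((F × F) × (F × F))) :=
  (segments A r ×ˢ segments A r).filter fun q => AxiallySymmetric q.1.1 q.1.2 q.2.1 q.2.2

lemma card_axialPairs_le_sq (A : Finset (F × F)) (r : F) :
    (axialPairs A r).card ≤ (segments A r).card ^ 2 := by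
  rw [sq, ← Finset.card_product]
  exact Finset.card_filter_le _ _

lemma card_axialPairs_le {p M : ℕ} [CharP F p] (hp2 : p ≠ 2) {A : Finset (F × F)}
    (hp : p = 0 ∨ (A.card : ℝ) ≤ (p : ℝ) ^ ((4 : ℝ) / 3)) (hM : FewOnCurves M A) {r : F}
    (hr : r ≠ 0) :
    ((axialPairs A r).card : ℝ) ≤ 500 * ((segments A r).card * √(segments A r).card) +
      10 * (M * (segments A r).card) := by
  have : CharP (AlgebraicClosure F) p :=
    charP_of_injective_algebraMap (algebraMap F (AlgebraicClosure F)).injective p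
  have h2F : (2 : F) ≠ 0 := Ring.two_ne_zero (by rwa [ringChar.eq F p])
  have h2 : (2 : AlgebraicClosure F) ≠ 0 := by
    rw [← map_ofNat (algebraMap F (AlgebraicClosure F)) 2]
    simpa using h2F
  obtain ⟨i, hi⟩ := IsAlgClosed.exists_pow_nat_eq (-1 : AlgebraicClosure F) two_pos
  have hinj := toRay_injOn hi h2 hr A
  have hcard : ((segments A r).image (toRay i r)).card = (segments A r).card :=
    Finset.card_image_of_injOn hinj
  have hp' : p = 0 ∨ ((segments A r).image (toRay i r)).card ≤ 2 * p ^ 2 := by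
    refine hp.imp_right fun hA => ?_
    rw [hcard]
    have h1 : (A.card : ℝ) ^ 3 ≤ (p : ℝ) ^ 4 := by
      calc (A.card : ℝ) ^ 3 ≤ ((p : ℝ) ^ ((4 : ℝ) / 3)) ^ 3 := by gcongr
        _ = (p : ℝ) ^ 4 := by
          rw [← Real.rpow_natCast, ← Real.rpow_mul (Nat.cast_nonneg p), ← Real.rpow_natCast]
          norm_num
    have h3 : A.card ^ 3 ≤ p ^ 4 := by exact_mod_cast h1
    have h4 := card_segments_sq_le A hr h2F
    by_contra! hcon
    nlinarith
  refine le_trans (Nat.cast_le.2 (?_ : _ ≤ ((((segments A r).image (toRay i r)) ×ˢ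
    ((segments A r).image (toRay i r))).filter fun z => raysForm z.1 z.2 = 0).card)) ?_
  · refine Finset.card_le_card_of_injOn (fun q => (toRay i r q.1, toRay i r q.2)) ?_ ?_
    · intro q hq
      obtain ⟨hq, hax⟩ := Finset.mem_filter.1 hq
      obtain ⟨h1, h3⟩ := Finset.mem_product.1 hq
      exact Finset.mem_coe.2 (Finset.mem_filter.2 ⟨Finset.mem_product.2
        ⟨Finset.mem_image_of_mem _ h1, Finset.mem_image_of_mem _ h3⟩,
        raysForm_toRay hi hr (Finset.mem_filter.1 h1).2 (Finset.mem_filter.1 h3).2 hax⟩)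
    · intro q hq q' hq' he
      obtain ⟨h1, h3⟩ := Finset.mem_product.1 (Finset.mem_filter.1 hq).1
      obtain ⟨h1', h3'⟩ := Finset.mem_product.1 (Finset.mem_filter.1 hq').1
      exact Prod.ext (hinj h1 h1' (congrArg Prod.fst he)) (hinj h3 h3' (congrArg Prod.snd he))
  · refine (card_incident_le (p := p) _ hp' (hM.fewCollinear hi h2 hr)).trans_eq ?_
    rw [hcard]
    push_cast
    ring

lemma card_segments_le_four {A : Finset (F × F)} (hA : (A.card : ℝ) ≤ (2 : ℝ) ^ ((4 : ℝ) / 3))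
    (r : F) : (segments A r).card ≤ 4 := by
  have h1 : (A.card : ℝ) ^ 3 ≤ 16 := by
    calc (A.card : ℝ) ^ 3 ≤ ((2 : ℝ) ^ ((4 : ℝ) / 3)) ^ 3 := by gcongr
      _ = 16 := by
        rw [← Real.rpow_natCast, ← Real.rpow_mul (by norm_num)]
        norm_num
  have h2 : A.card ^ 3 ≤ 16 := by exact_mod_cast h1
  have h3 : A.card ≤ 2 := by
    by_contra! hcon
    have h4 : 3 ^ 3 ≤ A.card ^ 3 := Nat.pow_le_pow_left hcon 3
    omega
  calc (segments A r).card ≤ A.card * A.card := by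
        rw [← Finset.card_product]
        exact Finset.card_filter_le _ _
    _ ≤ 2 * 2 := Nat.mul_le_mul h3 h3

lemma card_axialPairs_le_rpow {M : ℕ} {A : Finset (F × F)}
    (hA : ∀ p : ℕ, p ≠ 0 → CharP F p → (A.card : ℝ) ≤ (p : ℝ) ^ ((4 : ℝ) / 3))
    (hM : FewOnCurves M A) {r : F} (hr : r ≠ 0) :
    ((axialPairs A r).card : ℝ) ≤
      500 * (M * (segments A r).card + ((segments A r).card : ℝ) ^ ((3 : ℝ) / 2)) := by
  have hrpow : ((segments A r).card : ℝ) ^ ((3 : ℝ) / 2) =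
      (segments A r).card * √(segments A r).card := by
    rw [Real.sqrt_eq_rpow, show (3 : ℝ) / 2 = 1 + 1 / 2 by norm_num,
      Real.rpow_add_of_nonneg (Nat.cast_nonneg _) zero_le_one (by norm_num), Real.rpow_one]
  rw [hrpow]
  obtain ⟨p, _⟩ := CharP.exists F
  have h0 : (0 : ℝ) ≤ M * (segments A r).card := by positivity
  by_cases hp2 : p = 2
  · subst hp2
    have h1 : (axialPairs A r).card ≤ (segments A r).card * (segments A r).card :=
      (card_axialPairs_le_sq A r).trans_eq (sq _)
    have h2 : ((segments A r).card : ℝ) ≤ 4 := by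
      exact_mod_cast card_segments_le_four (by simpa using hA 2 two_ne_zero inferInstance) r
    have h3 : ((axialPairs A r).card : ℝ) ≤ (segments A r).card * (segments A r).card := by
      exact_mod_cast h1
    have h4 : √((segments A r).card : ℝ) ≤ 2 := by
      rw [Real.sqrt_le_left (by norm_num)]
      linarith
    have h5 := Real.mul_self_sqrt (Nat.cast_nonneg (α := ℝ) (segments A r).card)
    have h6 : (0 : ℝ) ≤ (segments A r).card * √((segments A r).card : ℝ) := by positivity
    have h7 := Real.sqrt_nonneg ((segments A r).card : ℝ)
    nlinarith [mul_nonneg h6 (sub_nonneg.2 h4)]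
  · have h1 := card_axialPairs_le hp2
      (Classical.or_iff_not_imp_left.2 fun h => hA p h inferInstance)
      hM hr
    linarith

end SegmentPairs

/-- There is an absolute constant `C > 0` such that for every field `F`, every finite `A ⊆ F²`
(with `|A| ≤ p^(4/3)` if `char F = p > 0`) having at most `M` points on a common line or
circle, and every `r ≠ 0`, the number of axially symmetric pairs of segments in `S_r(A)²` is at
most `C·(M|S_r(A)| + |S_r(A)|^(3/2))`. -/
theorem axially_symmetric_pairs_bound :
    ∃ C : ℝ, 0 < C ∧
      ∀ (F : Type) [inst : Field F],
        ∀ (A : Finset (F × F)) (M : ℕ),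
          (∀ p : ℕ, p ≠ 0 → CharP F p → (A.card : ℝ) ≤ (p : ℝ) ^ ((4 : ℝ) / 3)) →
          (∀ L : Set (F × F), IsLine L ∨ IsCircle L → ((A : Set (F × F)) ∩ L).ncard ≤ M) →
          ∀ r : F, r ≠ 0 →
            (Set.ncard {q : ((F × F) × (F × F)) × ((F × F) × (F × F)) |
                q.1 ∈ Sr A r ∧ q.2 ∈ Sr A r ∧
                AxiallySymmetric q.1.1 q.1.2 q.2.1 q.2.2} : ℝ) ≤
              C * ((M : ℝ) * ((Sr A r).ncard : ℝ) + ((Sr A r).ncard : ℝ) ^ ((3 : ℝ) / 2)) := by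
  refine ⟨500, by norm_num, fun F _ A M hA hM r hr => ?_⟩
  have h1 : {q : ((F × F) × (F × F)) × ((F × F) × (F × F)) | q.1 ∈ Sr A r ∧ q.2 ∈ Sr A r ∧
      AxiallySymmetric q.1.1 q.1.2 q.2.1 q.2.2} = (axialPairs A r : Set _) := by
    ext q
    simp only [← coe_segments A hr, axialPairs, Finset.coe_filter, Finset.mem_product,
      Finset.mem_coe, Set.mem_ofPred_eq, and_assoc]
  rw [h1, ← coe_segments A hr, Set.ncard_coe_finset, Set.ncard_coe_finset]
  exact card_axialPairs_le_rpow hA hM hr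

end Stmt8
end

section
/- Let F be a field and let A ⊆ F² be a finite set. Then T*(A) ≤ 2·|A|·B*(A)^{1/2}, i.e. T*(A)² ≤ 4·|A|²·B*(A). -/
namespace Stmt10

/-- The (algebraic) squared distance in the plane `F²`. -/
def dist2 {F : Type*} [CommRing F] (x y : F × F) : F :=
  (x.1 - y.1) ^ 2 + (x.2 - y.2) ^ 2

/-- The dot product on `F²`. -/
def dot {F : Type*} [CommRing F] (x y : F × F) : F :=
  x.1 * y.1 + x.2 * y.2

/-- A line in `F²`. -/
def IsLine {F : Type*} [CommRing F] (L : Set (F × F)) : Prop :=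
  ∃ x v : F × F, v ≠ 0 ∧ L = {y | ∃ t : F, y = x + t • v}

/-- The perpendicular bisector `B(a,b) = {x | d(a,x) = d(b,x)}`. -/
def bisector {F : Type*} [CommRing F] (a b : F × F) : Set (F × F) :=
  {x | dist2 a x = dist2 b x}

/-- `b*_A(ℓ)`: pairs `(b,c) ∈ A²`, `b ≠ c`, `(b-c)·(b-c) ≠ 0`, with bisector `ℓ`. -/
noncomputable def bstarL {F : Type*} [CommRing F] (A : Finset (F × F)) (ℓ : Set (F × F)) : ℕ :=
  Set.ncard {q : (F × F) × (F × F) |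
    q.1 ∈ A ∧ q.2 ∈ A ∧ q.1 ≠ q.2 ∧
    dot (q.1 - q.2) (q.1 - q.2) ≠ 0 ∧ bisector q.1 q.2 = ℓ}

/-- The modified bisector energy `B*(A) = Σ_ℓ b*_A(ℓ)²`, summed over all lines `ℓ`. -/
noncomputable def Bstar {F : Type*} [CommRing F] (A : Finset (F × F)) : ℕ :=
  ∑ᶠ ℓ ∈ {L : Set (F × F) | IsLine L}, (bstarL A ℓ) ^ 2

/-- `T*(A)`: the number of non-degenerate isosceles triangles. -/
noncomputable def Tstar {F : Type*} [CommRing F] (A : Finset (F × F)) : ℕ :=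
  Set.ncard {t : (F × F) × (F × F) × (F × F) |
    t.1 ∈ A ∧ t.2.1 ∈ A ∧ t.2.2 ∈ A ∧
    dist2 t.1 t.2.1 = dist2 t.1 t.2.2 ∧
    dot (t.2.1 - t.2.2) (t.2.1 - t.2.2) ≠ 0}

theorem dist2_comm {F : Type*} [CommRing F] (x y : F × F) : dist2 x y = dist2 y x := by
  simp only [dist2]; ring

/-- A nondegenerate bisector which contains a point is a line. -/
theorem isLine_bisector {F : Type*} [Field F] {a b c : F × F} (ha : a ∈ bisector b c)
    (hbc : dot (b - c) (b - c) ≠ 0) : IsLine (bisector b c) := by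
  obtain ⟨a₁, a₂⟩ := a
  obtain ⟨b₁, b₂⟩ := b
  obtain ⟨c₁, c₂⟩ := c
  simp only [bisector, Set.mem_ofPred_eq, dist2] at ha
  simp only [dot, Prod.mk_sub_mk] at hbc
  have h2 : (2 : F) ≠ 0 := by
    intro h2
    apply hbc
    have hsq : (b₁ - c₁ + (b₂ - c₂)) ^ 2 = 0 := by
      linear_combination ha + (a₁ * (b₁ - c₁) + a₂ * (b₂ - c₂) + c₁ ^ 2 + c₂ ^ 2 - b₁ * c₁
        - b₂ * c₂ + (b₁ - c₁) * (b₂ - c₂)) * h2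
    linear_combination hsq - (b₁ - c₁) * (b₂ - c₂) * h2
  refine ⟨(a₁, a₂), (-(b₂ - c₂), b₁ - c₁), ?_, ?_⟩
  · intro h
    simp only [Prod.mk_eq_zero, neg_eq_zero] at h
    apply hbc
    rw [h.1, h.2]
    ring
  · ext ⟨x₁, x₂⟩
    simp only [bisector, Set.mem_ofPred_eq, dist2, Prod.smul_mk, smul_eq_mul, Prod.mk_add_mk,
      Prod.mk.injEq]
    constructor
    · intro hx
      have h0 : (b₁ - c₁) * (x₁ - a₁) + (b₂ - c₂) * (x₂ - a₂) = 0 := by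
        apply mul_left_cancel₀ h2
        linear_combination ha - hx
      refine ⟨((b₁ - c₁) * (x₂ - a₂) - (b₂ - c₂) * (x₁ - a₁)) /
        ((b₁ - c₁) * (b₁ - c₁) + (b₂ - c₂) * (b₂ - c₂)), ?_, ?_⟩
      · rw [div_mul_eq_mul_div, ← sub_eq_iff_eq_add', eq_div_iff hbc]
        linear_combination (b₁ - c₁) * h0
      · rw [div_mul_eq_mul_div, ← sub_eq_iff_eq_add', eq_div_iff hbc]
        linear_combination (b₂ - c₂) * h0
    · rintro ⟨t, rfl, rfl⟩
      linear_combination ha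

theorem IsLine.eq_of_mem {F : Type*} [Field F] {L : Set (F × F)} (hL : IsLine L)
    {p q : F × F} (hp : p ∈ L) (hq : q ∈ L) (hpq : p ≠ q) :
    L = {y | ∃ t : F, y = p + t • (q - p)} := by
  obtain ⟨x, v, -, rfl⟩ := hL
  obtain ⟨s, rfl⟩ := hp
  obtain ⟨r, rfl⟩ := hq
  have hrs : r - s ≠ 0 := fun h => hpq (by rw [sub_eq_zero.1 h])
  have hd : x + r • v - (x + s • v) = (r - s) • v := by module
  ext y
  simp only [Set.mem_ofPred_eq, hd, smul_smul]
  constructor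
  · rintro ⟨t, rfl⟩
    refine ⟨(t - s) / (r - s), ?_⟩
    rw [div_mul_cancel₀ _ hrs]
    module
  · rintro ⟨t, rfl⟩
    exact ⟨s + t * (r - s), by module⟩

open scoped Classical in
/-- The ordered nondegenerate pairs in `A` whose bisector is a line. -/
noncomputable def linePairs {F : Type*} [CommRing F] (A : Finset (F × F)) :
    Finset ((F × F) × (F × F)) :=
  (A ×ˢ A).filter fun q : (F × F) × (F × F) => q.1 ≠ q.2 ∧ dot (q.1 - q.2) (q.1 - q.2) ≠ 0 ∧
    IsLine (bisector q.1 q.2)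

open scoped Classical in
/-- The lines which are bisectors of nondegenerate pairs in `A`. -/
noncomputable def bisectorLines {F : Type*} [CommRing F] (A : Finset (F × F)) :
    Finset (Set (F × F)) :=
  (linePairs A).image fun q => bisector q.1 q.2

theorem isLine_of_mem_bisectorLines {F : Type*} [CommRing F] {A : Finset (F × F)}
    {L : Set (F × F)} (h : L ∈ bisectorLines A) : IsLine L := by
  classical
  obtain ⟨q, hq, rfl⟩ := Finset.mem_image.1 h
  exact (Finset.mem_filter.1 hq).2.2.2

open scoped Classical in
theorem bstarL_eq_card {F : Type*} [CommRing F] (A : Finset (F × F)) {L : Set (F × F)}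
    (hL : IsLine L) :
    bstarL A L = ((linePairs A).filter fun q => bisector q.1 q.2 = L).card := by
  rw [bstarL, ← Set.ncard_coe_finset]
  congr 1
  ext q
  simp only [linePairs, Set.mem_ofPred_eq, Finset.coe_filter, Finset.mem_filter,
    Finset.mem_product]
  constructor
  · rintro ⟨h1, h2, h3, h4, h5⟩
    exact ⟨⟨⟨h1, h2⟩, h3, h4, h5 ▸ hL⟩, h5⟩
  · rintro ⟨⟨⟨h1, h2⟩, h3, h4, -⟩, h5⟩
    exact ⟨h1, h2, h3, h4, h5⟩

theorem Bstar_eq_sum {F : Type*} [CommRing F] (A : Finset (F × F)) :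
    Bstar A = ∑ L ∈ bisectorLines A, bstarL A L ^ 2 := by
  classical
  apply finsum_mem_eq_sum_of_inter_support_eq
  ext L
  simp only [Set.mem_inter_iff, Set.mem_ofPred_eq, Function.mem_support, Finset.mem_coe]
  refine and_congr_left fun h => ⟨fun hL => ?_, isLine_of_mem_bisectorLines⟩
  rw [bstarL_eq_card A hL] at h
  obtain ⟨q, hq⟩ := Finset.card_ne_zero.1 (ne_zero_pow two_ne_zero h)
  rw [Finset.mem_filter] at hq
  exact Finset.mem_image.2 ⟨q, hq.1, hq.2⟩

theorem sum_bstarL_le {F : Type*} [CommRing F] (A : Finset (F × F)) :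
    ∑ L ∈ bisectorLines A, bstarL A L ≤ A.card ^ 2 := by
  classical
  rw [Finset.sum_congr rfl fun L hL => bstarL_eq_card A (isLine_of_mem_bisectorLines hL),
    bisectorLines, ← Finset.card_eq_sum_card_image, sq,
    ← Finset.card_product]
  exact Finset.card_filter_le _ _

open scoped Classical in
theorem sum_pred_card_sq_le {F : Type*} [Field F] (A : Finset (F × F))
    {S : Finset (Set (F × F))} (hS : ∀ L ∈ S, IsLine L) :
    ∑ L ∈ S, ((A.filter (· ∈ L)).card - 1) ^ 2 ≤ A.card ^ 2 := by
  calc ∑ L ∈ S, ((A.filter (· ∈ L)).card - 1) ^ 2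
      ≤ ∑ L ∈ S, (A.filter (· ∈ L)).offDiag.card := by
        refine Finset.sum_le_sum fun L _ => ?_
        rw [Finset.offDiag_card, ← Nat.mul_sub_one, sq]
        exact Nat.mul_le_mul_right _ (Nat.sub_le _ _)
    _ = (S.biUnion fun L => (A.filter (· ∈ L)).offDiag).card := by
        refine (Finset.card_biUnion fun L hL M hM hLM => ?_).symm
        refine Finset.disjoint_left.2 ?_
        rintro ⟨p, q⟩ h h'
        simp only [Finset.mem_offDiag, Finset.mem_filter] at h h'
        exact hLM (((hS L hL).eq_of_mem h.1.2 h.2.1.2 h.2.2).trans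
          ((hS M hM).eq_of_mem h'.1.2 h'.2.1.2 h'.2.2).symm)
    _ ≤ (A ×ˢ A).card := by
        refine Finset.card_le_card fun p hp => ?_
        simp only [Finset.mem_biUnion, Finset.mem_offDiag, Finset.mem_filter] at hp
        obtain ⟨L, -, h1, h2, -⟩ := hp
        exact Finset.mem_product.2 ⟨h1.1, h2.1⟩
    _ = A.card ^ 2 := by rw [Finset.card_product, sq]

open scoped Classical in
theorem Tstar_le_sum {F : Type*} [Field F] (A : Finset (F × F)) :
    Tstar A ≤ ∑ L ∈ bisectorLines A, (A.filter (· ∈ L)).card * bstarL A L := by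
  calc Tstar A
      ≤ ((bisectorLines A).biUnion fun L => (A.filter (· ∈ L)) ×ˢ
          ((linePairs A).filter fun q => bisector q.1 q.2 = L)).card := by
        rw [Tstar, ← Set.ncard_coe_finset]
        refine Set.ncard_le_ncard ?_ (Finset.finite_toSet _)
        rintro ⟨a, b, c⟩ ⟨ha, hb, hc, hd, hbc⟩
        have hmem : a ∈ bisector b c := by
          simpa only [bisector, Set.mem_ofPred_eq, dist2_comm _ a] using hd
        have hq : (b, c) ∈ linePairs A := by
          refine Finset.mem_filter.2 ⟨Finset.mem_product.2 ⟨hb, hc⟩, ?_, hbc,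
            isLine_bisector hmem hbc⟩
          rintro (h : b = c)
          simp [h, dot] at hbc
        simp only [Finset.mem_coe, Finset.mem_biUnion, Finset.mem_product, Finset.mem_filter]
        exact ⟨bisector b c, Finset.mem_image.2 ⟨_, hq, rfl⟩, ⟨ha, hmem⟩, hq, rfl⟩
    _ ≤ ∑ L ∈ bisectorLines A, ((A.filter (· ∈ L)) ×ˢ
          ((linePairs A).filter fun q => bisector q.1 q.2 = L)).card := Finset.card_biUnion_le
    _ = ∑ L ∈ bisectorLines A, (A.filter (· ∈ L)).card * bstarL A L :=
        Finset.sum_congr rfl fun L hL => by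
          rw [Finset.card_product, bstarL_eq_card A (isLine_of_mem_bisectorLines hL)]

/-- `T*(A) ≤ 2|A|·B*(A)^(1/2)`, i.e. `T*(A)² ≤ 4|A|²·B*(A)`. -/
theorem isosceles_le_bisector_energy (F : Type) [Field F] (A : Finset (F × F)) :
    (Tstar A) ^ 2 ≤ 4 * A.card ^ 2 * Bstar A := by
  classical
  set X := ∑ L ∈ bisectorLines A, ((A.filter (· ∈ L)).card - 1) * bstarL A L
  set Y := ∑ L ∈ bisectorLines A, bstarL A L
  have hT : Tstar A ≤ X + Y := by
    refine (Tstar_le_sum A).trans ?_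
    rw [← Finset.sum_add_distrib]
    refine Finset.sum_le_sum fun L _ => ?_
    rw [← Nat.succ_mul]
    exact Nat.mul_le_mul_right _ (by omega)
  have hX : X ^ 2 ≤ A.card ^ 2 * Bstar A := by
    rw [Bstar_eq_sum]
    exact (Finset.sum_mul_sq_le_sq_mul_sq _ _ _).trans (Nat.mul_le_mul_right _
      (sum_pred_card_sq_le A fun _ => isLine_of_mem_bisectorLines))
  have hY : Y ^ 2 ≤ A.card ^ 2 * Bstar A := by
    rw [Bstar_eq_sum, sq]
    exact Nat.mul_le_mul (sum_bstarL_le A)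
      (Finset.sum_le_sum fun L _ => Nat.le_self_pow two_ne_zero _)
  calc Tstar A ^ 2 ≤ (X + Y) ^ 2 := Nat.pow_le_pow_left hT 2
    _ ≤ 2 * (X ^ 2 + Y ^ 2) := add_sq_le
    _ ≤ 4 * A.card ^ 2 * Bstar A := by linarith

end Stmt10
end

section
/- Let F be a field and let A ⊆ F² be a finite set that is the disjoint union of B and C. If all points of C are contained in a single line or in a single circle of non-zero radius, then T*(A) ≤ T*(B) + 8|A|². -/
namespace Stmt11

/-- The (algebraic) squared distance in the plane `F²`. -/
def dist2 {F : Type*} [CommRing F] (x y : F × F) : F :=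
  (x.1 - y.1) ^ 2 + (x.2 - y.2) ^ 2

/-- The dot product on `F²`. -/
def dot {F : Type*} [CommRing F] (x y : F × F) : F :=
  x.1 * y.1 + x.2 * y.2

/-- A line in `F²`. -/
def IsLine {F : Type*} [CommRing F] (L : Set (F × F)) : Prop :=
  ∃ x v : F × F, v ≠ 0 ∧ L = {y | ∃ t : F, y = x + t • v}

/-- A circle of non-zero radius in `F²`. -/
def IsCircle {F : Type*} [CommRing F] (S : Set (F × F)) : Prop :=
  ∃ (c : F × F) (r : F), r ≠ 0 ∧ S = {x | dist2 x c = r}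

/-- `T*(A)`: the number of non-degenerate isosceles triangles. -/
noncomputable def Tstar {F : Type*} [CommRing F] (A : Finset (F × F)) : ℕ :=
  Set.ncard {t : (F × F) × (F × F) × (F × F) |
    t.1 ∈ A ∧ t.2.1 ∈ A ∧ t.2.2 ∈ A ∧
    dist2 t.1 t.2.1 = dist2 t.1 t.2.2 ∧
    dot (t.2.1 - t.2.2) (t.2.1 - t.2.2) ≠ 0}

/-- The non-degenerate isosceles triangles with apex in `X` and base points in `Y` and `Z`. -/
def isosceles {F : Type*} [CommRing F] [DecidableEq F] (X Y Z : Finset (F × F)) :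
    Finset ((F × F) × (F × F) × (F × F)) :=
  (X ×ˢ Y ×ˢ Z).filter fun t =>
    dist2 t.1 t.2.1 = dist2 t.1 t.2.2 ∧ dot (t.2.1 - t.2.2) (t.2.1 - t.2.2) ≠ 0

section CommRing

variable {F : Type*} [CommRing F] [DecidableEq F]

theorem mem_isosceles {X Y Z : Finset (F × F)} {a b c : F × F} :
    (a, b, c) ∈ isosceles X Y Z ↔ (a ∈ X ∧ b ∈ Y ∧ c ∈ Z) ∧
      dist2 a b = dist2 a c ∧ dot (b - c) (b - c) ≠ 0 := by
  simp [isosceles]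

theorem Tstar_eq_card_isosceles (A : Finset (F × F)) : Tstar A = (isosceles A A A).card := by
  rw [Tstar, ← Set.ncard_coe_finset]
  congr 1
  ext ⟨a, b, c⟩
  rw [Finset.mem_coe, mem_isosceles]
  simp only [Set.mem_ofPred_eq, and_assoc]

theorem card_isosceles_swap_le (X Y Z : Finset (F × F)) :
    (isosceles X Y Z).card ≤ (isosceles X Z Y).card := by
  refine Finset.card_le_card_of_injOn (fun t => (t.1, t.2.2, t.2.1)) ?_ ?_
  · rintro ⟨a, b, c⟩ h
    rw [Finset.mem_coe, mem_isosceles] at h ⊢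
    obtain ⟨⟨ha, hb, hc⟩, hd, hn⟩ := h
    refine ⟨⟨ha, hc, hb⟩, hd.symm, ?_⟩
    convert hn using 1
    simp only [dot, Prod.fst_sub, Prod.snd_sub]
    ring
  · rintro ⟨a, b, c⟩ _ ⟨a', b', c'⟩ _ h
    simp only [Prod.mk.injEq] at h ⊢
    tauto

theorem Tstar_union_le (B C : Finset (F × F)) :
    Tstar (B ∪ C) ≤ Tstar B + (isosceles C (B ∪ C) (B ∪ C)).card +
      2 * (isosceles (B ∪ C) C (B ∪ C)).card := by
  have hsub : isosceles (B ∪ C) (B ∪ C) (B ∪ C) ⊆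
      isosceles B B B ∪ isosceles C (B ∪ C) (B ∪ C) ∪
        (isosceles (B ∪ C) C (B ∪ C) ∪ isosceles (B ∪ C) (B ∪ C) C) := by
    rintro ⟨a, b, c⟩ h
    simp only [Finset.mem_union, mem_isosceles] at h ⊢
    tauto
  have h := Finset.card_le_card hsub
  have h₁ := Finset.card_union_le (isosceles B B B ∪ isosceles C (B ∪ C) (B ∪ C))
    (isosceles (B ∪ C) C (B ∪ C) ∪ isosceles (B ∪ C) (B ∪ C) C)
  have h₂ := Finset.card_union_le (isosceles B B B) (isosceles C (B ∪ C) (B ∪ C))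
  have h₃ := Finset.card_union_le (isosceles (B ∪ C) C (B ∪ C)) (isosceles (B ∪ C) (B ∪ C) C)
  have h₄ := card_isosceles_swap_le (B ∪ C) (B ∪ C) C
  rw [Tstar_eq_card_isosceles, Tstar_eq_card_isosceles]
  omega

end CommRing

/-- Splitting a finite set by a predicate and bounding the fibres of a map on each part. -/
theorem card_le_add_mul_card_of_fibers {α β : Type*} [DecidableEq β] (S : Finset α)
    (P : Finset β) (Q : α → Prop) (f g : α → β) (k l : ℕ)
    (hf : ∀ x ∈ S, f x ∈ P) (hg : ∀ x ∈ S, g x ∈ P)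
    (hk : ∀ U ⊆ S, ∀ p, (∀ x ∈ U, ¬ Q x ∧ f x = p) → U.card ≤ k)
    (hl : ∀ U ⊆ S, ∀ p, (∀ x ∈ U, Q x ∧ g x = p) → U.card ≤ l) :
    S.card ≤ (k + l) * P.card := by
  classical
  have h₁ : (S.filter fun x => ¬ Q x).card ≤ k * P.card := by
    refine Finset.card_le_mul_card_image_of_maps_to (f := f)
      (fun x hx => hf x (Finset.mem_filter.1 hx).1) k ?_
    intro p _
    refine hk _ ((Finset.filter_subset _ _).trans (Finset.filter_subset _ _)) p ?_
    intro x hx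
    simp only [Finset.mem_filter] at hx
    exact ⟨hx.1.2, hx.2⟩
  have h₂ : (S.filter fun x => Q x).card ≤ l * P.card := by
    refine Finset.card_le_mul_card_image_of_maps_to (f := g)
      (fun x hx => hg x (Finset.mem_filter.1 hx).1) l ?_
    intro p _
    refine hl _ ((Finset.filter_subset _ _).trans (Finset.filter_subset _ _)) p ?_
    intro x hx
    simp only [Finset.mem_filter] at hx
    exact ⟨hx.1.2, hx.2⟩
  have h₃ := Finset.card_filter_add_card_filter_not (s := S) (fun x => Q x)
  rw [add_mul]
  omega

theorem card_le_two_of_forall {α : Type*} {U : Finset α}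
    (h : ∀ x ∈ U, ∀ y ∈ U, ∀ z ∈ U, x ≠ y → x ≠ z → y ≠ z → False) : U.card ≤ 2 := by
  by_contra! hU
  obtain ⟨x, y, z, hx, hy, hz, hxy, hxz, hyz⟩ := Finset.two_lt_card_iff.1 hU
  exact h x hx y hy z hz hxy hxz hyz

section Field

variable {F : Type*} [Field F]

theorem exists_eq_smul_of_dot_eq_zero {u x : F × F} (hu : u ≠ 0) (h : dot u x = 0) :
    ∃ s : F, x = s • (-u.2, u.1) := by
  obtain ⟨u₁, u₂⟩ := u
  obtain ⟨x₁, x₂⟩ := x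
  simp only [dot] at h
  by_cases h₁ : u₁ = 0
  · have h₂ : u₂ ≠ 0 := by
      rintro rfl
      exact hu (by simp [h₁])
    have hx : x₂ = 0 := by simpa [h₁, h₂] using h
    refine ⟨-(x₁ / u₂), ?_⟩
    ext <;> simp [h₁, hx, h₂]
  · refine ⟨x₂ / u₁, ?_⟩
    ext
    · simp
      field_simp
      linear_combination h
    · simp [h₁]

/-- A point orthogonal to a non-zero isotropic vector is itself isotropic. -/
theorem dot_self_eq_zero_of_isotropic {w e : F × F} (hw : w ≠ 0) (hww : dot w w = 0)
    (hwe : dot w e = 0) : dot e e = 0 := by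
  obtain ⟨s, rfl⟩ := exists_eq_smul_of_dot_eq_zero hw hwe
  simp only [dot, Prod.smul_fst, Prod.smul_snd, smul_eq_mul] at hww ⊢
  linear_combination s ^ 2 * hww

theorem exists_eq_smul_of_isotropic {v x : F × F} (hv : v ≠ 0) (hvv : dot v v = 0)
    (hvx : dot v x = 0) : ∃ s : F, x = s • v := by
  obtain ⟨v₁, v₂⟩ := v
  obtain ⟨x₁, x₂⟩ := x
  simp only [dot] at hvv hvx
  have h₁ : v₁ ≠ 0 := by
    rintro rfl
    exact hv (by simpa using hvv)
  refine ⟨x₁ / v₁, ?_⟩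
  have h₂ : v₂ ≠ 0 := by
    rintro rfl
    exact h₁ (by simpa using hvv)
  ext
  · simp [h₁]
  · simp only [Prod.smul_snd, smul_eq_mul]
    field_simp
    refine mul_left_cancel₀ h₂ ?_
    linear_combination v₁ * hvx - x₁ * hvv

/-- If three distinct points of the line `p + F v` are equidistant from `a`, then the line is
isotropic and orthogonal to `p - a`. -/
theorem isotropic_of_three_equidistant (h2 : (2 : F) ≠ 0) {a p v : F × F} {r s t ρ : F}
    (hr : dist2 a (p + r • v) = ρ) (hs : dist2 a (p + s • v) = ρ) (ht : dist2 a (p + t • v) = ρ)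
    (hrs : r ≠ s) (hrt : r ≠ t) (hst : s ≠ t) : dot v v = 0 ∧ dot v (p - a) = 0 := by
  simp only [dist2, dot, Prod.fst_add, Prod.snd_add, Prod.smul_fst, Prod.smul_snd, Prod.fst_sub,
    Prod.snd_sub, smul_eq_mul] at *
  have hrs' := sub_ne_zero.2 hrs
  have hrt' := sub_ne_zero.2 hrt
  have hst' := sub_ne_zero.2 hst
  have e₁ : (r + s) * (v.1 * v.1 + v.2 * v.2) +
      2 * (v.1 * (p.1 - a.1) + v.2 * (p.2 - a.2)) = 0 := by
    refine mul_left_cancel₀ hrs' ?_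
    linear_combination hr - hs
  have e₂ : (r + t) * (v.1 * v.1 + v.2 * v.2) +
      2 * (v.1 * (p.1 - a.1) + v.2 * (p.2 - a.2)) = 0 := by
    refine mul_left_cancel₀ hrt' ?_
    linear_combination hr - ht
  have e₃ : v.1 * v.1 + v.2 * v.2 = 0 := by
    refine mul_left_cancel₀ hst' ?_
    linear_combination e₁ - e₂
  refine ⟨e₃, mul_left_cancel₀ h2 ?_⟩
  linear_combination e₁ - (r + s) * e₃

/-- A line contains at most two points of a circle of non-zero radius. -/
theorem false_of_three_mem_line_circle (h2 : (2 : F) ≠ 0) {u o x y z : F × F} {k r : F}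
    (hu : u ≠ 0) (hr : r ≠ 0) (hx : dot u x = k) (hy : dot u y = k) (hz : dot u z = k)
    (hxo : dist2 x o = r) (hyo : dist2 y o = r) (hzo : dist2 z o = r)
    (hxy : x ≠ y) (hxz : x ≠ z) (hyz : y ≠ z) : False := by
  have key : ∀ q, dot u q = k → ∃ s : F, q = x + s • (-u.2, u.1) := by
    intro q hq
    obtain ⟨s, hs⟩ := exists_eq_smul_of_dot_eq_zero (x := q - x) hu (by
      simp only [dot, Prod.fst_sub, Prod.snd_sub] at *
      linear_combination hq - hx)
    exact ⟨s, by rw [← hs, add_sub_cancel]⟩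
  have comm : ∀ p q : F × F, dist2 p q = dist2 q p := fun p q => by
    simp only [dist2]
    ring
  obtain ⟨s, rfl⟩ := key y hy
  obtain ⟨t, rfl⟩ := key z hz
  rw [comm] at hxo hyo hzo
  obtain ⟨hww, hwx⟩ := isotropic_of_three_equidistant h2 (r := 0) (by simpa using hxo) hyo hzo
    (by rintro rfl; simp at hxy) (by rintro rfl; simp at hxz) (by rintro rfl; simp at hyz)
  have hw : ((-u.2, u.1) : F × F) ≠ 0 := by
    intro h
    simp only [Prod.mk_eq_zero, neg_eq_zero] at h
    exact hu (Prod.ext h.2 h.1)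
  refine hr ?_
  rw [← hxo, ← dot_self_eq_zero_of_isotropic hw hww hwx]
  simp only [dist2, dot, Prod.fst_sub, Prod.snd_sub]
  ring

theorem eq_of_isosceles_of_dot_eq_zero (h2 : (2 : F) ≠ 0) {v a b c c' : F × F} (hv : v ≠ 0)
    (hc : dot v (b - c) = 0) (hc' : dot v (b - c') = 0)
    (hd : dist2 a b = dist2 a c) (hd' : dist2 a b = dist2 a c')
    (hn : dot (b - c) (b - c) ≠ 0) (hn' : dot (b - c') (b - c') ≠ 0) : c = c' := by
  obtain ⟨s, hs⟩ := exists_eq_smul_of_dot_eq_zero hv hc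
  obtain ⟨t, ht⟩ := exists_eq_smul_of_dot_eq_zero hv hc'
  by_contra hne
  have hst : s ≠ t := by
    rintro rfl
    exact hne (sub_right_injective (hs.trans ht.symm))
  have hs0 : s ≠ 0 := by
    rintro rfl
    exact hn (by simp [hs, dot])
  have ht0 : t ≠ 0 := by
    rintro rfl
    exact hn' (by simp [ht, dot])
  obtain ⟨hww, -⟩ := isotropic_of_three_equidistant h2 (a := a) (p := b) (v := (-v.2, v.1))
    (r := 0) (s := -s) (t := -t) (ρ := dist2 a b) (by simp)
    (by rw [neg_smul, ← hs, hd]; congr 1; abel) (by rw [neg_smul, ← ht, hd']; congr 1; abel)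
    (by simpa using hs0) (by simpa using ht0) (by simpa using hst)
  apply hn
  rw [hs]
  simp only [dot, Prod.smul_fst, Prod.smul_snd, smul_eq_mul] at hww ⊢
  linear_combination s ^ 2 * hww

theorem eq_of_isosceles_of_isotropic (h2 : (2 : F) ≠ 0) {v a a' b c : F × F} (hv : v ≠ 0)
    (hvv : dot v v = 0) (ha : dot v (a - b) = 0) (ha' : dot v (a' - b) = 0)
    (hd : dist2 a b = dist2 a c) (hd' : dist2 a' b = dist2 a' c)
    (hn : dot (b - c) (b - c) ≠ 0) : a = a' := by
  obtain ⟨s, hs⟩ := exists_eq_smul_of_isotropic hv hvv ha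
  obtain ⟨t, ht⟩ := exists_eq_smul_of_isotropic hv hvv ha'
  obtain rfl := eq_add_of_sub_eq hs
  obtain rfl := eq_add_of_sub_eq ht
  by_contra hne
  have hst : s - t ≠ 0 := by
    intro h
    exact hne (by rw [sub_eq_zero.1 h])
  simp only [dist2, dot, Prod.fst_add, Prod.snd_add, Prod.smul_fst, Prod.smul_snd, Prod.fst_sub,
    Prod.snd_sub, smul_eq_mul] at *
  have h : v.1 * (b.1 - c.1) + v.2 * (b.2 - c.2) = 0 := by
    refine mul_left_cancel₀ (mul_ne_zero h2 hst) ?_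
    linear_combination hd' - hd
  apply hn
  linear_combination -hd - 2 * s * h

variable [DecidableEq F]

theorem isosceles_eq_empty_of_two_eq_zero (h2 : (2 : F) = 0) (X Y Z : Finset (F × F)) :
    isosceles X Y Z = ∅ := by
  rw [Finset.eq_empty_iff_forall_notMem]
  rintro ⟨a, b, c⟩ h
  obtain ⟨-, hd, hn⟩ := mem_isosceles.1 h
  apply hn
  simp only [dist2, dot, Prod.fst_sub, Prod.snd_sub] at *
  linear_combination hd + (a.1 * b.1 + a.2 * b.2 - a.1 * c.1 - a.2 * c.2 + c.1 ^ 2 + c.2 ^ 2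
    - b.1 * c.1 - b.2 * c.2) * h2

theorem card_isosceles_apex_line_le (h2 : (2 : F) ≠ 0) {A C : Finset (F × F)} (hCA : C ⊆ A)
    {p v : F × F} (hv : v ≠ 0) (hC : ∀ x ∈ C, ∃ t : F, x = p + t • v) :
    (isosceles C A A).card ≤ 2 * (A ×ˢ A).card := by
  refine card_le_add_mul_card_of_fibers (isosceles C A A) (A ×ˢ A)
    (fun t => dot v (t.2.1 - t.2.2) = 0) (fun t => t.2) (fun t => (t.1, t.2.1)) 1 1 ?_ ?_ ?_ ?_
  · rintro ⟨a, b, c⟩ h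
    obtain ⟨⟨ha, hb, hc⟩, -⟩ := mem_isosceles.1 h
    exact Finset.mk_mem_product hb hc
  · rintro ⟨a, b, c⟩ h
    obtain ⟨⟨ha, hb, hc⟩, -⟩ := mem_isosceles.1 h
    exact Finset.mk_mem_product (hCA ha) hb
  · rintro U hU ⟨b, c⟩ h
    refine Finset.card_le_one.2 ?_
    rintro ⟨a, _, _⟩ hx ⟨a', _, _⟩ hy
    obtain ⟨hQ, hxp⟩ := h _ hx
    obtain ⟨-, hyp⟩ := h _ hy
    cases hxp.symm
    cases hyp.symm
    obtain ⟨⟨ha, -⟩, hd, -⟩ := mem_isosceles.1 (hU hx)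
    obtain ⟨⟨ha', -⟩, hd', -⟩ := mem_isosceles.1 (hU hy)
    obtain ⟨s, rfl⟩ := hC a ha
    obtain ⟨t, rfl⟩ := hC a' ha'
    suffices s = t by rw [this]
    rw [← sub_eq_zero]
    refine (mul_eq_zero.1 ?_).resolve_right (mul_ne_zero h2 hQ)
    simp only [dist2, dot, Prod.fst_add, Prod.snd_add, Prod.smul_fst, Prod.smul_snd,
      Prod.fst_sub, Prod.snd_sub, smul_eq_mul] at *
    linear_combination hd' - hd
  · rintro U hU ⟨a, b⟩ h
    refine Finset.card_le_one.2 ?_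
    rintro ⟨_, _, c⟩ hx ⟨_, _, c'⟩ hy
    obtain ⟨hQ, hxp⟩ := h _ hx
    obtain ⟨hQ', hyp⟩ := h _ hy
    cases hxp.symm
    cases hyp.symm
    obtain ⟨-, hd, hn⟩ := mem_isosceles.1 (hU hx)
    obtain ⟨-, hd', hn'⟩ := mem_isosceles.1 (hU hy)
    obtain rfl : c = c' := eq_of_isosceles_of_dot_eq_zero h2 hv hQ hQ' hd hd' hn hn'
    rfl

theorem card_isosceles_apex_circle_le (h2 : (2 : F) ≠ 0) {A C : Finset (F × F)}
    {o : F × F} {r : F} (hr : r ≠ 0) (hC : ∀ x ∈ C, dist2 x o = r) :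
    (isosceles C A A).card ≤ 2 * (A ×ˢ A).card := by
  have maps : ∀ x ∈ isosceles C A A, x.2 ∈ A ×ˢ A := by
    rintro ⟨a, b, c⟩ h
    obtain ⟨⟨ha, hb, hc⟩, -⟩ := mem_isosceles.1 h
    exact Finset.mk_mem_product hb hc
  refine Finset.card_le_mul_card_image_of_maps_to maps 2 ?_
  rintro ⟨b, c⟩ -
  refine card_le_two_of_forall ?_
  rintro ⟨x, _, _⟩ hx ⟨y, _, _⟩ hy ⟨z, _, _⟩ hz hxy hxz hyz
  obtain ⟨hx, hxp⟩ := Finset.mem_filter.1 hx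
  obtain ⟨hy, hyp⟩ := Finset.mem_filter.1 hy
  obtain ⟨hz, hzp⟩ := Finset.mem_filter.1 hz
  cases hxp.symm
  cases hyp.symm
  cases hzp.symm
  obtain ⟨⟨hxC, -⟩, hxd, hn⟩ := mem_isosceles.1 hx
  obtain ⟨⟨hyC, -⟩, hyd, -⟩ := mem_isosceles.1 hy
  obtain ⟨⟨hzC, -⟩, hzd, -⟩ := mem_isosceles.1 hz
  have key : ∀ q : F × F, dist2 q b = dist2 q c →
      dot ((2 : F) • (b - c)) q = dot b b - dot c c := by
    intro q hq
    simp only [dist2, dot, Prod.smul_fst, Prod.smul_snd, Prod.fst_sub, Prod.snd_sub,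
      smul_eq_mul] at *
    linear_combination -hq
  have hu : (2 : F) • (b - c) ≠ 0 := by
    refine smul_ne_zero h2 fun h => hn ?_
    simp [h, dot]
  exact false_of_three_mem_line_circle h2 hu hr (key x hxd) (key y hyd) (key z hzd)
    (hC x hxC) (hC y hyC) (hC z hzC) (by rintro rfl; exact hxy rfl) (by rintro rfl; exact hxz rfl)
    (by rintro rfl; exact hyz rfl)

theorem card_isosceles_base_line_le (h2 : (2 : F) ≠ 0) {A C : Finset (F × F)} (hCA : C ⊆ A)
    {p v : F × F} (hv : v ≠ 0) (hC : ∀ x ∈ C, ∃ t : F, x = p + t • v) :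
    (isosceles A C A).card ≤ 3 * (A ×ˢ A).card := by
  refine card_le_add_mul_card_of_fibers (isosceles A C A) (A ×ˢ A)
    (fun t => dot v v = 0 ∧ dot v (p - t.1) = 0) (fun t => (t.1, t.2.2)) (fun t => t.2) 2 1
    ?_ ?_ ?_ ?_
  · rintro ⟨a, b, c⟩ h
    obtain ⟨⟨ha, hb, hc⟩, -⟩ := mem_isosceles.1 h
    exact Finset.mk_mem_product ha hc
  · rintro ⟨a, b, c⟩ h
    obtain ⟨⟨ha, hb, hc⟩, -⟩ := mem_isosceles.1 h
    exact Finset.mk_mem_product (hCA hb) hc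
  · rintro U hU ⟨a, c⟩ h
    refine card_le_two_of_forall ?_
    rintro ⟨_, x, _⟩ hx ⟨_, y, _⟩ hy ⟨_, z, _⟩ hz hxy hxz hyz
    obtain ⟨hQ, hxp⟩ := h _ hx
    obtain ⟨-, hyp⟩ := h _ hy
    obtain ⟨-, hzp⟩ := h _ hz
    cases hxp.symm
    cases hyp.symm
    cases hzp.symm
    obtain ⟨⟨-, hxC, -⟩, hxd, -⟩ := mem_isosceles.1 (hU hx)
    obtain ⟨⟨-, hyC, -⟩, hyd, -⟩ := mem_isosceles.1 (hU hy)
    obtain ⟨⟨-, hzC, -⟩, hzd, -⟩ := mem_isosceles.1 (hU hz)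
    obtain ⟨r, rfl⟩ := hC x hxC
    obtain ⟨s, rfl⟩ := hC y hyC
    obtain ⟨t, rfl⟩ := hC z hzC
    exact hQ (isotropic_of_three_equidistant h2 hxd hyd hzd (by rintro rfl; exact hxy rfl)
      (by rintro rfl; exact hxz rfl) (by rintro rfl; exact hyz rfl))
  · rintro U hU ⟨b, c⟩ h
    refine Finset.card_le_one.2 ?_
    rintro ⟨a, _, _⟩ hx ⟨a', _, _⟩ hy
    obtain ⟨⟨hvv, hQ⟩, hxp⟩ := h _ hx
    obtain ⟨⟨-, hQ'⟩, hyp⟩ := h _ hy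
    cases hxp.symm
    cases hyp.symm
    obtain ⟨⟨-, hb, -⟩, hd, hn⟩ := mem_isosceles.1 (hU hx)
    obtain ⟨-, hd', -⟩ := mem_isosceles.1 (hU hy)
    obtain ⟨s, rfl⟩ := hC b hb
    have key : ∀ q : F × F, dot v (p - q) = 0 → dot v (q - (p + s • v)) = 0 := by
      intro q hq
      simp only [dot, Prod.fst_add, Prod.snd_add, Prod.smul_fst, Prod.smul_snd, Prod.fst_sub,
        Prod.snd_sub, smul_eq_mul] at *
      linear_combination -hq - s * hvv
    obtain rfl : a = a' :=
      eq_of_isosceles_of_isotropic h2 hv hvv (key a hQ) (key a' hQ') hd hd' hn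
    rfl

theorem card_isosceles_base_circle_le (h2 : (2 : F) ≠ 0) {A C : Finset (F × F)} (hCA : C ⊆ A)
    {o : F × F} {r : F} (hr : r ≠ 0) (hC : ∀ x ∈ C, dist2 x o = r) :
    (isosceles A C A).card ≤ 3 * (A ×ˢ A).card := by
  refine card_le_add_mul_card_of_fibers (isosceles A C A) (A ×ˢ A)
    (fun t => t.1 = o) (fun t => (t.1, t.2.2)) (fun t => t.2) 2 1 ?_ ?_ ?_ ?_
  · rintro ⟨a, b, c⟩ h
    obtain ⟨⟨ha, hb, hc⟩, -⟩ := mem_isosceles.1 h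
    exact Finset.mk_mem_product ha hc
  · rintro ⟨a, b, c⟩ h
    obtain ⟨⟨ha, hb, hc⟩, -⟩ := mem_isosceles.1 h
    exact Finset.mk_mem_product (hCA hb) hc
  · rintro U hU p h
    refine card_le_two_of_forall ?_
    rintro ⟨a, x, c⟩ hx ⟨_, y, _⟩ hy ⟨_, z, _⟩ hz hxy hxz hyz
    obtain ⟨hQ, hxp⟩ := h _ hx
    obtain ⟨-, hyp⟩ := h _ hy
    obtain ⟨-, hzp⟩ := h _ hz
    cases hxp
    cases hyp
    cases hzp
    obtain ⟨⟨-, hxC, -⟩, hxd, -⟩ := mem_isosceles.1 (hU hx)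
    obtain ⟨⟨-, hyC, -⟩, hyd, -⟩ := mem_isosceles.1 (hU hy)
    obtain ⟨⟨-, hzC, -⟩, hzd, -⟩ := mem_isosceles.1 (hU hz)
    have key : ∀ q : F × F, q ∈ C → dist2 a q = dist2 a c →
        dot ((2 : F) • (a - o)) q = r - dist2 a c + dot a a - dot o o := by
      intro q hqC hq
      have hqo := hC q hqC
      simp only [dist2, dot, Prod.smul_fst, Prod.smul_snd, Prod.fst_sub, Prod.snd_sub,
        smul_eq_mul] at *
      linear_combination hqo - hq
    exact false_of_three_mem_line_circle h2 (smul_ne_zero h2 (sub_ne_zero.2 hQ)) hr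
      (key x hxC hxd) (key y hyC hyd) (key z hzC hzd) (hC x hxC) (hC y hyC) (hC z hzC)
      (by rintro rfl; exact hxy rfl) (by rintro rfl; exact hxz rfl) (by rintro rfl; exact hyz rfl)
  · rintro U - p h
    refine Finset.card_le_one.2 fun x hx y hy => ?_
    obtain ⟨hQ, hxp⟩ := h _ hx
    obtain ⟨hQ', hyp⟩ := h _ hy
    exact Prod.ext (hQ.trans hQ'.symm) (hxp.trans hyp.symm)

end Field

/-- Pruning a heavy line or circle: if `A` is the disjoint union of `B` and `C` and all points
of `C` lie on a single line or on a single circle of non-zero radius, then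
`T*(A) ≤ T*(B) + 8|A|²`. -/
theorem prune_heavy_line_or_circle (F : Type) [Field F] [DecidableEq F] (A B C : Finset (F × F))
    (hdisj : Disjoint B C) (hunion : A = B ∪ C)
    (hC : ∃ γ : Set (F × F), (IsLine γ ∨ IsCircle γ) ∧ (C : Set (F × F)) ⊆ γ) :
    Tstar A ≤ Tstar B + 8 * A.card ^ 2 := by
  subst hunion
  by_cases h2 : (2 : F) = 0
  · rw [Tstar_eq_card_isosceles, isosceles_eq_empty_of_two_eq_zero h2, Finset.card_empty]
    exact Nat.zero_le _
  have hCA : C ⊆ B ∪ C := Finset.subset_union_right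
  have hT := Tstar_union_le B C
  obtain ⟨γ, ⟨p, v, hv, rfl⟩ | ⟨o, r, hr, rfl⟩, hγ⟩ := hC
  · have h₁ := card_isosceles_apex_line_le h2 hCA hv fun x hx => hγ hx
    have h₂ := card_isosceles_base_line_le h2 hCA hv fun x hx => hγ hx
    rw [Finset.card_product, ← sq] at h₁ h₂
    omega
  · have h₁ := card_isosceles_apex_circle_le (A := B ∪ C) h2 hr fun x hx => hγ hx
    have h₂ := card_isosceles_base_circle_le h2 hCA hr fun x hx => hγ hx
    rw [Finset.card_product, ← sq] at h₁ h₂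
    omega

end Stmt11
end

section
/- Let F be a field and let A ⊆ F² be a finite set. Then there is a subset A' ⊆ A such that at most |A|^{2/3} points of A' lie on any single line or on any single circle of non-zero radius, and T*(A) ≤ T*(A') + 8·|A|^{7/3}. -/
namespace Stmt12

/-- The (algebraic) squared distance in the plane `F²`. -/
def dist2 {F : Type*} [CommRing F] (x y : F × F) : F :=
  (x.1 - y.1) ^ 2 + (x.2 - y.2) ^ 2

/-- The dot product on `F²`. -/
def dot {F : Type*} [CommRing F] (x y : F × F) : F :=
  x.1 * y.1 + x.2 * y.2

/-- A line in `F²`. -/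
def IsLine {F : Type*} [CommRing F] (L : Set (F × F)) : Prop :=
  ∃ x v : F × F, v ≠ 0 ∧ L = {y | ∃ t : F, y = x + t • v}

/-- A circle of non-zero radius in `F²`. -/
def IsCircle {F : Type*} [CommRing F] (S : Set (F × F)) : Prop :=
  ∃ (c : F × F) (r : F), r ≠ 0 ∧ S = {x | dist2 x c = r}

/-- `T*(A)`: the number of non-degenerate isosceles triangles. -/
noncomputable def Tstar {F : Type*} [CommRing F] (A : Finset (F × F)) : ℕ :=
  Set.ncard {t : (F × F) × (F × F) × (F × F) |
    t.1 ∈ A ∧ t.2.1 ∈ A ∧ t.2.2 ∈ A ∧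
    dist2 t.1 t.2.1 = dist2 t.1 t.2.2 ∧
    dot (t.2.1 - t.2.2) (t.2.1 - t.2.2) ≠ 0}

open Classical in
/-- The non-degenerate isosceles triangles `(a, b, c)` of `B`, with apex `a`. -/
noncomputable def isoscelesTriangles {F : Type*} [CommRing F] (B : Finset (F × F)) :
    Finset ((F × F) × (F × F) × (F × F)) :=
  (B ×ˢ B ×ˢ B).filter fun t =>
    dist2 t.1 t.2.1 = dist2 t.1 t.2.2 ∧ dot (t.2.1 - t.2.2) (t.2.1 - t.2.2) ≠ 0

lemma mem_isoscelesTriangles {F : Type*} [CommRing F] {B : Finset (F × F)} {a b c : F × F} :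
    (a, b, c) ∈ isoscelesTriangles B ↔ a ∈ B ∧ b ∈ B ∧ c ∈ B ∧
      dist2 a b = dist2 a c ∧ dot (b - c) (b - c) ≠ 0 := by
  simp [isoscelesTriangles, and_assoc]

lemma Tstar_eq_card {F : Type*} [CommRing F] (B : Finset (F × F)) :
    Tstar B = (isoscelesTriangles B).card := by
  rw [Tstar, ← Set.ncard_coe_finset]
  congr 1
  ext ⟨a, b, c⟩
  simp [mem_isoscelesTriangles]

lemma card_le_two_mul_of_fibers {α β : Type*} {S : Finset α} {t : Finset β} (f : α → β)
    (hf : ∀ x ∈ S, f x ∈ t)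
    (h : ∀ x ∈ S, ∀ y ∈ S, ∀ z ∈ S, f x = f y → f x = f z → x ≠ y → x ≠ z → y ≠ z → False) :
    S.card ≤ 2 * t.card := by
  classical
  refine Finset.card_le_mul_card_image_of_maps_to hf 2 fun p _ => ?_
  by_contra! hlt
  obtain ⟨x, y, z, hx, hy, hz, hxy, hxz, hyz⟩ := Finset.two_lt_card_iff.1 hlt
  simp only [Finset.mem_filter] at hx hy hz
  exact h x hx.1 y hy.1 z hz.1 (hx.2.trans hy.2.symm) (hx.2.trans hz.2.symm) hxy hxz hyz

section Geometry

variable {F : Type*} [Field F]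

lemma isoscelesTriangles_eq_empty (h2 : (2 : F) = 0) (B : Finset (F × F)) :
    isoscelesTriangles B = ∅ := by
  refine Finset.eq_empty_of_forall_notMem ?_
  rintro ⟨⟨a₁, a₂⟩, ⟨b₁, b₂⟩, ⟨c₁, c₂⟩⟩ h
  obtain ⟨-, -, -, h, h'⟩ := mem_isoscelesTriangles.1 h
  simp only [dist2, dot, Prod.fst_sub, Prod.snd_sub] at h h'
  apply h'
  linear_combination h + (a₁ * b₁ - a₁ * c₁ + a₂ * b₂ - a₂ * c₂ + c₁ ^ 2 + c₂ ^ 2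
    - b₁ * c₁ - b₂ * c₂) * h2

lemma cross_eq_zero_of_isotropic {v w : F × F} (hv : v ≠ 0) (hvv : dot v v = 0)
    (hvw : dot v w = 0) : v.1 * w.2 = v.2 * w.1 := by
  obtain ⟨v₁, v₂⟩ := v
  obtain ⟨w₁, w₂⟩ := w
  simp only [dot] at *
  by_cases h : v₂ = 0
  · subst h
    simp_all
  · apply mul_left_cancel₀ h
    linear_combination v₁ * hvw - w₁ * hvv

lemma dot_self_eq_zero_of_parallel {v w : F × F} (hv : v ≠ 0) (hvv : dot v v = 0)
    (hvw : v.1 * w.2 = v.2 * w.1) : dot w w = 0 := by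
  obtain ⟨v₁, v₂⟩ := v
  obtain ⟨w₁, w₂⟩ := w
  simp only [dot] at *
  by_cases h : v₁ = 0
  · subst h
    simp_all
  · apply mul_left_cancel₀ (pow_ne_zero 2 h)
    linear_combination w₁ ^ 2 * hvv + (v₁ * w₂ + v₂ * w₁) * hvw

/-- A line meeting a level set of `dist2 a` in three points is isotropic and passes
through `a`. -/
lemma isotropic_of_three_points (h2 : (2 : F) ≠ 0) {x v a : F × F} {ρ t₁ t₂ t₃ : F}
    (h₁ : dist2 a (x + t₁ • v) = ρ) (h₂ : dist2 a (x + t₂ • v) = ρ)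
    (h₃ : dist2 a (x + t₃ • v) = ρ) (h12 : t₁ ≠ t₂) (h13 : t₁ ≠ t₃) (h23 : t₂ ≠ t₃) :
    dot v v = 0 ∧ dot v (x - a) = 0 := by
  obtain ⟨v₁, v₂⟩ := v
  obtain ⟨x₁, x₂⟩ := x
  obtain ⟨a₁, a₂⟩ := a
  simp only [dist2, dot, Prod.fst_sub, Prod.snd_sub, Prod.fst_add, Prod.snd_add, Prod.smul_fst,
    Prod.smul_snd, smul_eq_mul] at *
  have e12 : (t₁ + t₂) * (v₁ * v₁ + v₂ * v₂)
      + 2 * (v₁ * (x₁ - a₁) + v₂ * (x₂ - a₂)) = 0 := by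
    apply mul_left_cancel₀ (sub_ne_zero.2 h12)
    linear_combination h₁ - h₂
  have e13 : (t₁ + t₃) * (v₁ * v₁ + v₂ * v₂)
      + 2 * (v₁ * (x₁ - a₁) + v₂ * (x₂ - a₂)) = 0 := by
    apply mul_left_cancel₀ (sub_ne_zero.2 h13)
    linear_combination h₁ - h₃
  have hv : v₁ * v₁ + v₂ * v₂ = 0 := by
    apply mul_left_cancel₀ (sub_ne_zero.2 h23)
    linear_combination e12 - e13
  refine ⟨hv, ?_⟩
  apply mul_left_cancel₀ h2
  linear_combination e12 - (t₁ + t₂) * hv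

/-- A circle of non-zero radius meets a line in at most two points. -/
lemma not_three_points_circle_inter_line (h2 : (2 : F) ≠ 0) {n c p q s : F × F} {r κ : F}
    (hn : n ≠ 0) (hr : r ≠ 0) (hp : dist2 p c = r) (hq : dist2 q c = r) (hs : dist2 s c = r)
    (lp : dot n p = κ) (lq : dot n q = κ) (ls : dot n s = κ)
    (hpq : p ≠ q) (hps : p ≠ s) (hqs : q ≠ s) : False := by
  set v : F × F := (-n.2, n.1) with hv
  have hv0 : v ≠ 0 := by
    intro h
    simp only [hv, Prod.ext_iff, Prod.fst_zero, Prod.snd_zero, neg_eq_zero] at h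
    exact hn (Prod.ext h.2 h.1)
  have param : ∀ y : F × F, dot n y = κ → ∃ t : F, y = p + t • v := by
    intro y hy
    obtain ⟨n₁, n₂⟩ := n
    obtain ⟨y₁, y₂⟩ := y
    obtain ⟨p₁, p₂⟩ := p
    simp only [dot, hv] at *
    by_cases h : n₁ = 0
    · have h' : n₂ ≠ 0 := fun h' => hn (by simp [h, h'])
      subst h
      refine ⟨-(y₁ - p₁) / n₂, ?_⟩
      ext
      · simp; field_simp; ring
      · simp
        apply mul_left_cancel₀ h'
        linear_combination hy - lp
    · refine ⟨(y₂ - p₂) / n₁, ?_⟩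
      ext
      · simp; field_simp
        linear_combination hy - lp
      · simp; field_simp; ring
  obtain ⟨t₂, rfl⟩ := param q lq
  obtain ⟨t₃, rfl⟩ := param s ls
  have comm : ∀ y z : F × F, dist2 y z = dist2 z y := fun y z => by simp only [dist2]; ring
  rw [comm] at hp hq hs
  obtain ⟨hvv, hvp⟩ := isotropic_of_three_points (t₁ := 0) h2 (by simpa using hp) hq hs
    (by rintro rfl; simp at hpq) (by rintro rfl; simp at hps) (by rintro rfl; simp at hqs)
  have h0 := dot_self_eq_zero_of_parallel hv0 hvv (cross_eq_zero_of_isotropic hv0 hvv hvp)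
  apply hr
  simp only [dist2, dot, Prod.fst_sub, Prod.snd_sub] at h0 hp
  linear_combination h0 - hp

/-- Reflection in a line: a line is the perpendicular bisector of `b` and at most one point. -/
lemma eq_of_common_bisector (h2 : (2 : F) ≠ 0) {x v b c c' : F × F}
    (hv : v ≠ 0) (hc : dot (b - c) (b - c) ≠ 0) (hc' : dot (b - c') (b - c') ≠ 0)
    (h : ∀ t : F, dist2 (x + t • v) b = dist2 (x + t • v) c)
    (h' : ∀ t : F, dist2 (x + t • v) b = dist2 (x + t • v) c') : c = c' := by
  have key : ∀ c : F × F, dot (b - c) (b - c) ≠ 0 →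
      (∀ t : F, dist2 (x + t • v) b = dist2 (x + t • v) c) →
      ∃ s : F, c = b + s • (-v.2, v.1) ∧
        s * dot v v = 2 * dot (-v.2, v.1) (x - b) ∧ dot v v ≠ 0 := by
    intro c hc h
    have h0 := h 0
    have h1 := h 1
    obtain ⟨v₁, v₂⟩ := v
    obtain ⟨x₁, x₂⟩ := x
    obtain ⟨b₁, b₂⟩ := b
    obtain ⟨c₁, c₂⟩ := c
    simp only [dist2, dot, Prod.fst_sub, Prod.snd_sub, Prod.fst_add, Prod.snd_add, Prod.smul_fst,
      Prod.smul_snd, smul_eq_mul] at *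
    have hperp : v₁ * (c₁ - b₁) + v₂ * (c₂ - b₂) = 0 := by
      apply mul_left_cancel₀ h2
      linear_combination h1 - h0
    obtain ⟨s, hs₁, hs₂⟩ : ∃ s : F, c₁ = b₁ + s * -v₂ ∧ c₂ = b₂ + s * v₁ := by
      by_cases hv₁ : v₁ = 0
      · have hv₂ : v₂ ≠ 0 := fun h' => hv (by simp [hv₁, h'])
        subst hv₁
        refine ⟨-(c₁ - b₁) / v₂, by field_simp; ring, ?_⟩
        apply mul_left_cancel₀ hv₂
        linear_combination hperp
      · refine ⟨(c₂ - b₂) / v₁, ?_, by field_simp; ring⟩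
        field_simp
        linear_combination hperp
    subst hs₁ hs₂
    have hne : s ^ 2 * (v₁ * v₁ + v₂ * v₂) ≠ 0 := by
      intro h
      apply hc
      linear_combination h
    have hs : s ≠ 0 := by
      rintro rfl
      simp at hne
    refine ⟨s, by simp, ?_, right_ne_zero_of_mul hne⟩
    apply mul_left_cancel₀ hs
    linear_combination -h0
  obtain ⟨s, rfl, hs, hvv⟩ := key c hc h
  obtain ⟨s', rfl, hs', -⟩ := key c' hc' h'
  rw [mul_right_cancel₀ hvv (hs.trans hs'.symm)]

/-- If two points of a line are equidistant from `b` and `c`, so are all its points. -/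
lemma dist2_eq_on_line {x v b c : F × F} {t₁ t₂ : F} (ht : t₁ ≠ t₂)
    (h₁ : dist2 (x + t₁ • v) b = dist2 (x + t₁ • v) c)
    (h₂ : dist2 (x + t₂ • v) b = dist2 (x + t₂ • v) c) (t : F) :
    dist2 (x + t • v) b = dist2 (x + t • v) c := by
  simp only [dist2, Prod.fst_add, Prod.snd_add, Prod.smul_fst, Prod.smul_snd, smul_eq_mul] at *
  apply mul_left_cancel₀ (sub_ne_zero.2 ht)
  linear_combination (t - t₂) * h₁ + (t₁ - t) * h₂

/-- Two zero-distance apexes on an isotropic line, for the same base, coincide. -/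
lemma apex_eq_of_isotropic (h2 : (2 : F) ≠ 0) {x v a a' b c : F × F} {t : F} (hv : v ≠ 0)
    (hvv : dot v v = 0) (ha : dot v (x - a) = 0) (ha' : dot v (x - a') = 0)
    (hb : b = x + t • v) (hc : dot (b - c) (b - c) ≠ 0)
    (h : dist2 a b = dist2 a c) (h' : dist2 a' b = dist2 a' c) : a = a' := by
  have par : ∀ a : F × F, dot v (x - a) = 0 → ∃ s : F, a = x + s • v := by
    intro a ha
    have hcross := cross_eq_zero_of_isotropic hv hvv ha
    obtain ⟨v₁, v₂⟩ := v
    obtain ⟨x₁, x₂⟩ := x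
    obtain ⟨a₁, a₂⟩ := a
    simp only [Prod.fst_sub, Prod.snd_sub] at hcross
    by_cases hv₁ : v₁ = 0
    · have hv₂ : v₂ ≠ 0 := fun h' => hv (by simp [hv₁, h'])
      subst hv₁
      refine ⟨(a₂ - x₂) / v₂, ?_⟩
      ext
      · simp
        apply mul_left_cancel₀ hv₂
        linear_combination hcross
      · simp; field_simp; ring
    · refine ⟨(a₁ - x₁) / v₁, ?_⟩
      ext
      · simp; field_simp; ring
      · simp; field_simp
        linear_combination -hcross
  obtain ⟨s, rfl⟩ := par a ha
  obtain ⟨s', rfl⟩ := par a' ha'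
  subst hb
  by_contra hne
  have hss : s ≠ s' := by
    rintro rfl
    exact hne rfl
  have hvc : dot v (x - c) = 0 := by
    apply mul_left_cancel₀ h2
    apply mul_left_cancel₀ (sub_ne_zero.2 hss)
    simp only [dist2, dot, Prod.fst_sub, Prod.snd_sub, Prod.fst_add, Prod.snd_add, Prod.smul_fst,
      Prod.smul_snd, smul_eq_mul] at *
    linear_combination h' - h + ((s - t) ^ 2 - (s' - t) ^ 2 - s ^ 2 + s' ^ 2) * hvv
  apply hc
  refine dot_self_eq_zero_of_parallel hv hvv (cross_eq_zero_of_isotropic hv hvv ?_)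
  simp only [dot, Prod.fst_sub, Prod.snd_sub, Prod.fst_add, Prod.snd_add, Prod.smul_fst,
    Prod.smul_snd, smul_eq_mul] at *
  linear_combination hvc + t * hvv

open Classical in
/-- Triangles with apex on a line or circle. -/
lemma card_apex_mem_le (h2 : (2 : F) ≠ 0) (B : Finset (F × F)) {γ : Set (F × F)}
    (hγ : IsLine γ ∨ IsCircle γ) :
    ((isoscelesTriangles B).filter fun t => t.1 ∈ γ).card ≤ 2 * (B ×ˢ B).card := by
  rcases hγ with ⟨x, v, hv, rfl⟩ | ⟨m, r, hr, rfl⟩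
  · set S := (isoscelesTriangles B).filter fun t => t.1 ∈ {y | ∃ t : F, y = x + t • v}
    rw [← Finset.card_filter_add_card_filter_not (s := S)
      (fun t => ∀ u : F, dist2 (x + u • v) t.2.1 = dist2 (x + u • v) t.2.2), two_mul]
    refine add_le_add
      (Finset.card_le_card_of_injOn (fun t => (t.1, t.2.1)) ?_ ?_)
      (Finset.card_le_card_of_injOn (fun t => t.2) ?_ ?_)
    · rintro ⟨a, b, c⟩ h
      simp only [S, Finset.coe_filter, Finset.mem_filter, mem_isoscelesTriangles,
        Set.mem_ofPred_eq] at h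
      simp [h.1.1.1, h.1.1.2.1]
    · rintro ⟨a, b, c⟩ h ⟨a', b', c'⟩ h' heq
      simp only [S, Finset.coe_filter, Finset.mem_filter, mem_isoscelesTriangles,
        Set.mem_ofPred_eq] at h h'
      obtain ⟨rfl, rfl⟩ := Prod.mk.inj heq
      rw [eq_of_common_bisector h2 hv h.1.1.2.2.2.2 h'.1.1.2.2.2.2 h.2 h'.2]
    · rintro ⟨a, b, c⟩ h
      simp only [S, Finset.coe_filter, Finset.mem_filter, mem_isoscelesTriangles,
        Set.mem_ofPred_eq] at h
      simp [h.1.1.2.1, h.1.1.2.2.1]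
    · rintro ⟨a, b, c⟩ h ⟨a', b', c'⟩ h' heq
      simp only [S, Finset.coe_filter, Finset.mem_filter, mem_isoscelesTriangles,
        Set.mem_ofPred_eq] at h h'
      obtain ⟨rfl, rfl⟩ := Prod.mk.inj heq
      obtain ⟨⟨⟨-, -, -, hd, -⟩, u, rfl⟩, hbad⟩ := h
      obtain ⟨⟨⟨-, -, -, hd', -⟩, u', rfl⟩, -⟩ := h'
      by_cases hu : u = u'
      · rw [hu]
      · exact (hbad (dist2_eq_on_line hu hd hd')).elim
  · refine card_le_two_mul_of_fibers (fun t => t.2) ?_ ?_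
    · rintro ⟨a, b, c⟩ h
      simp only [Finset.mem_filter, mem_isoscelesTriangles] at h
      simp [h.1.2.1, h.1.2.2.1]
    · rintro ⟨a, b, c⟩ h ⟨a', b', c'⟩ h' ⟨a'', b'', c''⟩ h'' heq heq' hne hne' hne''
      simp only [Finset.mem_filter, mem_isoscelesTriangles, Set.mem_ofPred_eq] at h h' h''
      obtain ⟨rfl, rfl⟩ := Prod.mk.inj heq
      obtain ⟨rfl, rfl⟩ := Prod.mk.inj heq'
      have hbc : b - c ≠ 0 := by
        intro h0
        apply h.1.2.2.2.2
        simp [h0, dot]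
      have lin : ∀ y : F × F, dist2 y b = dist2 y c →
          dot (b - c) y = (dot b b - dot c c) / 2 := by
        intro y hy
        rw [eq_div_iff h2]
        simp only [dist2, dot, Prod.fst_sub, Prod.snd_sub] at *
        linear_combination -hy
      exact not_three_points_circle_inter_line h2 hbc hr h.2 h'.2 h''.2
        (lin a h.1.2.2.2.1) (lin a' h'.1.2.2.2.1) (lin a'' h''.1.2.2.2.1)
        (by rintro rfl; exact hne rfl) (by rintro rfl; exact hne' rfl)
        (by rintro rfl; exact hne'' rfl)

open Classical in
/-- Triangles with a given base vertex on a line or circle. -/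
lemma card_base_mem_le (h2 : (2 : F) ≠ 0) (B : Finset (F × F)) {γ : Set (F × F)}
    (hγ : IsLine γ ∨ IsCircle γ) :
    ((isoscelesTriangles B).filter fun t => t.2.1 ∈ γ).card ≤ 3 * (B ×ˢ B).card := by
  rcases hγ with ⟨x, v, hv, rfl⟩ | ⟨m, r, hr, rfl⟩
  · set S := (isoscelesTriangles B).filter fun t => t.2.1 ∈ {y | ∃ t : F, y = x + t • v}
    rw [← Finset.card_filter_add_card_filter_not (s := S)
      (fun t => dot v v = 0 ∧ dot v (x - t.1) = 0),
      show 3 * (B ×ˢ B).card = (B ×ˢ B).card + 2 * (B ×ˢ B).card by ring]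
    refine add_le_add
      (Finset.card_le_card_of_injOn (fun t => t.2) ?_ ?_)
      (card_le_two_mul_of_fibers (fun t => (t.1, t.2.2)) ?_ ?_)
    · rintro ⟨a, b, c⟩ h
      simp only [S, Finset.coe_filter, Finset.mem_filter, mem_isoscelesTriangles,
        Set.mem_ofPred_eq] at h
      simp [h.1.1.2.1, h.1.1.2.2.1]
    · rintro ⟨a, b, c⟩ h ⟨a', b', c'⟩ h' heq
      simp only [S, Finset.coe_filter, Finset.mem_filter, mem_isoscelesTriangles,
        Set.mem_ofPred_eq] at h h'
      obtain ⟨rfl, rfl⟩ := Prod.mk.inj heq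
      obtain ⟨⟨⟨-, -, -, hd, hbc⟩, u, hu⟩, hvv, ha⟩ := h
      obtain ⟨⟨⟨-, -, -, hd', -⟩, -⟩, -, ha'⟩ := h'
      rw [apex_eq_of_isotropic h2 hv hvv ha ha' hu hbc hd hd']
    · rintro ⟨a, b, c⟩ h
      simp only [S, Finset.mem_filter, mem_isoscelesTriangles] at h
      simp [h.1.1.1, h.1.1.2.2.1]
    · rintro ⟨a, b, c⟩ h ⟨a', b', c'⟩ h' ⟨a'', b'', c''⟩ h'' heq heq' hne hne' hne''
      simp only [S, Finset.mem_filter, mem_isoscelesTriangles, Set.mem_ofPred_eq] at h h' h''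
      obtain ⟨rfl, rfl⟩ := Prod.mk.inj heq
      obtain ⟨rfl, rfl⟩ := Prod.mk.inj heq'
      obtain ⟨⟨⟨-, -, -, hd, -⟩, u, rfl⟩, hgood⟩ := h
      obtain ⟨⟨⟨-, -, -, hd', -⟩, u', rfl⟩, -⟩ := h'
      obtain ⟨⟨⟨-, -, -, hd'', -⟩, u'', rfl⟩, -⟩ := h''
      exact hgood (isotropic_of_three_points h2 hd hd' hd''
        (by rintro rfl; exact hne rfl) (by rintro rfl; exact hne' rfl)
        (by rintro rfl; exact hne'' rfl))
  · set S := (isoscelesTriangles B).filter fun t => t.2.1 ∈ {x | dist2 x m = r}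
    rw [← Finset.card_filter_add_card_filter_not (s := S) (fun t => t.1 = m),
      show 3 * (B ×ˢ B).card = (B ×ˢ B).card + 2 * (B ×ˢ B).card by ring]
    refine add_le_add
      (Finset.card_le_card_of_injOn (fun t => t.2) ?_ ?_)
      (card_le_two_mul_of_fibers (fun t => (t.1, t.2.2)) ?_ ?_)
    · rintro ⟨a, b, c⟩ h
      simp only [S, Finset.coe_filter, Finset.mem_filter, mem_isoscelesTriangles,
        Set.mem_ofPred_eq] at h
      simp [h.1.1.2.1, h.1.1.2.2.1]
    · rintro ⟨a, b, c⟩ h ⟨a', b', c'⟩ h' heq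
      simp only [S, Finset.coe_filter, Finset.mem_filter, Set.mem_ofPred_eq] at h h'
      exact Prod.ext (h.2.trans h'.2.symm) heq
    · rintro ⟨a, b, c⟩ h
      simp only [S, Finset.mem_filter, mem_isoscelesTriangles] at h
      simp [h.1.1.1, h.1.1.2.2.1]
    · rintro ⟨a, b, c⟩ h ⟨a', b', c'⟩ h' ⟨a'', b'', c''⟩ h'' heq heq' hne hne' hne''
      simp only [S, Finset.mem_filter, mem_isoscelesTriangles, Set.mem_ofPred_eq] at h h' h''
      obtain ⟨rfl, rfl⟩ := Prod.mk.inj heq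
      obtain ⟨rfl, rfl⟩ := Prod.mk.inj heq'
      have lin : ∀ y : F × F, dist2 a y = dist2 a c → dist2 y m = r →
          dot (a - m) y = (r - dist2 a c + dot a a - dot m m) / 2 := by
        intro y hy hm
        rw [eq_div_iff h2]
        simp only [dist2, dot, Prod.fst_sub, Prod.snd_sub] at *
        linear_combination hm - hy
      exact not_three_points_circle_inter_line h2 (sub_ne_zero.2 h.2) hr h.1.2 h'.1.2 h''.1.2
        (lin b h.1.1.2.2.2.1 h.1.2) (lin b' h'.1.1.2.2.2.1 h'.1.2)
        (lin b'' h''.1.1.2.2.2.1 h''.1.2)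
        (by rintro rfl; exact hne rfl) (by rintro rfl; exact hne' rfl)
        (by rintro rfl; exact hne'' rfl)

open Classical in
/-- Deleting a line or circle destroys at most `8|B|²` triangles. -/
lemma Tstar_le_Tstar_filter_notMem_add (B : Finset (F × F)) {γ : Set (F × F)}
    (hγ : IsLine γ ∨ IsCircle γ) :
    Tstar B ≤ Tstar (B.filter (· ∉ γ)) + 8 * B.card ^ 2 := by
  rw [Tstar_eq_card, Tstar_eq_card]
  by_cases h2 : (2 : F) = 0
  · simp [isoscelesTriangles_eq_empty h2]
  set S₁ := (isoscelesTriangles B).filter fun t => t.1 ∈ γ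
  set S₂ := (isoscelesTriangles B).filter fun t => t.2.1 ∈ γ
  set S₃ := (isoscelesTriangles B).filter fun t => t.2.2 ∈ γ
  have h₁ : S₁.card ≤ 2 * (B ×ˢ B).card := card_apex_mem_le h2 B hγ
  have h₂ : S₂.card ≤ 3 * (B ×ˢ B).card := card_base_mem_le h2 B hγ
  have h₃ : S₃.card ≤ S₂.card := by
    refine Finset.card_le_card_of_injOn (fun t => (t.1, t.2.2, t.2.1)) ?_ ?_
    · rintro ⟨a, b, c⟩ h
      simp only [S₂, S₃, Finset.coe_filter, mem_isoscelesTriangles, Set.mem_ofPred_eq] at h ⊢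
      obtain ⟨⟨ha, hb, hc, hd, hn⟩, hcγ⟩ := h
      refine ⟨⟨ha, hc, hb, hd.symm, ?_⟩, hcγ⟩
      convert hn using 1
      simp only [dot, Prod.fst_sub, Prod.snd_sub]
      ring
    · rintro ⟨a, b, c⟩ - ⟨a', b', c'⟩ - heq
      simp only [Prod.mk.injEq] at heq ⊢
      tauto
  have hsub : isoscelesTriangles B ⊆
      isoscelesTriangles (B.filter (· ∉ γ)) ∪ (S₁ ∪ (S₂ ∪ S₃)) := by
    rintro ⟨a, b, c⟩ h
    simp only [S₁, S₂, S₃, Finset.mem_union, Finset.mem_filter, mem_isoscelesTriangles] at h ⊢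
    tauto
  have hU := Finset.card_le_card hsub
  have hU₁ := Finset.card_union_le (isoscelesTriangles (B.filter (· ∉ γ))) (S₁ ∪ (S₂ ∪ S₃))
  have hU₂ := Finset.card_union_le S₁ (S₂ ∪ S₃)
  have hU₃ := Finset.card_union_le S₂ S₃
  rw [Finset.card_product] at h₁ h₂
  rw [pow_two]
  omega

/-- Iterated pruning of all curves containing more than `k` points. -/
lemma exists_pruned_subset {N : ℕ} {k : ℝ} (hk : 0 < k) (B : Finset (F × F)) (hB : B.card ≤ N) :
    ∃ B' ⊆ B, (∀ γ : Set (F × F), IsLine γ ∨ IsCircle γ →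
        (((B' : Set (F × F)) ∩ γ).ncard : ℝ) ≤ k) ∧
      (Tstar B : ℝ) ≤ Tstar B' + 8 * (N : ℝ) ^ 2 * (B.card / k) := by
  classical
  induction B using Finset.strongInduction with
  | H B ih =>
    by_cases hall : ∀ γ : Set (F × F), IsLine γ ∨ IsCircle γ →
        (((B : Set (F × F)) ∩ γ).ncard : ℝ) ≤ k
    · exact ⟨B, subset_rfl, hall, le_add_of_nonneg_right (by positivity)⟩
    push Not at hall
    obtain ⟨γ, hγ, hlt⟩ := hall
    have hcoe : (B : Set (F × F)) ∩ γ = ↑(B.filter (· ∈ γ)) := by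
      ext
      simp
    rw [hcoe, Set.ncard_coe_finset] at hlt
    have hcard := Finset.card_filter_add_card_filter_not (s := B) (· ∈ γ)
    have hpos : 0 < (B.filter (· ∈ γ)).card := by exact_mod_cast hk.trans hlt
    have hss : B.filter (· ∉ γ) ⊂ B :=
      (Finset.filter_subset _ _).ssubset_of_ne fun h => by
        rw [h] at hcard
        omega
    obtain ⟨B', hB', hlight, hT⟩ := ih _ hss (by omega)
    refine ⟨B', hB'.trans (Finset.filter_subset _ _), hlight, ?_⟩
    have hloss : (Tstar B : ℝ) ≤ Tstar (B.filter (· ∉ γ)) + 8 * (B.card : ℝ) ^ 2 := by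
      exact_mod_cast Tstar_le_Tstar_filter_notMem_add B hγ
    have hBN : (B.card : ℝ) ^ 2 ≤ (N : ℝ) ^ 2 := by gcongr
    have hone : 1 ≤ ((B.filter (· ∈ γ)).card : ℝ) / k := (one_le_div hk).2 hlt.le
    have hsplit : (B.card : ℝ) / k =
        (B.filter (· ∈ γ)).card / k + (B.filter (· ∉ γ)).card / k := by
      rw [← hcard, Nat.cast_add, add_div]
    rw [hsplit]
    nlinarith [mul_le_mul_of_nonneg_left hone (sq_nonneg (N : ℝ))]

end Geometry

/-- Pruning heavy lines and circles: every finite `A ⊆ F²` has a subset `A'` with at most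
`|A|^(2/3)` points of `A'` on any single line or circle of non-zero radius, and
`T*(A) ≤ T*(A') + 8|A|^(7/3)`. -/
theorem prune_heavy_lines_and_circles (F : Type) [Field F] (A : Finset (F × F)) :
    ∃ A' : Finset (F × F), A' ⊆ A ∧
      (∀ γ : Set (F × F), IsLine γ ∨ IsCircle γ →
        (((A' : Set (F × F)) ∩ γ).ncard : ℝ) ≤ (A.card : ℝ) ^ ((2 : ℝ) / 3)) ∧
      (Tstar A : ℝ) ≤ (Tstar A' : ℝ) + 8 * (A.card : ℝ) ^ ((7 : ℝ) / 3) := by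
  rcases A.eq_empty_or_nonempty with rfl | hA
  · exact ⟨∅, subset_rfl, by simp, by simp⟩
  have hpos : (0 : ℝ) < A.card := by exact_mod_cast hA.card_pos
  obtain ⟨A', hA', hlight, hT⟩ :=
    exists_pruned_subset (Real.rpow_pos_of_pos hpos ((2 : ℝ) / 3)) A le_rfl
  refine ⟨A', hA', hlight, hT.trans_eq ?_⟩
  have hpow : (A.card : ℝ) ^ 2 * (A.card / (A.card : ℝ) ^ ((2 : ℝ) / 3)) =
      (A.card : ℝ) ^ ((7 : ℝ) / 3) := by
    rw [← mul_div_assoc, ← pow_succ, ← Real.rpow_natCast, ← Real.rpow_sub hpos]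
    norm_num
  rw [mul_assoc, hpow]

end Stmt12
end
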